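/- Let −4 < ν ≤ −3, A > 0, and let h₀ : ℝ → ℝ be bounded, measurable, nonnegative, not almost everywhere zero, with h₀(x) ~ A x^ν e^{−x} as x → ∞. Let a ∈ ℝ, let η > −(3+ν)/2 be positive, and let m : [0,∞) → ℝ be twice continuously differentiable of the form m(t) = 2t − (3/2) log(t+1) + a + r(t), where r(0) = −a, r(t) → 0 as t → ∞, and r''(t) = O(t^{−2−η}) as t → ∞. Set b := −(A e^{−a}/(2√π)) 2^{ν+1} Γ(ν/2 + 1) > 0. Then there exists a constant α > 0 such that h(m(t)+x, t) → α x e^{−x} as t → ∞ for every x ≥ 0, and for each fixed x > 0 the following equivalence holds: r(t) = −3√π/√t − (b/α) t^{1+ν/2} + o(t^{1+ν/2}) as t → ∞ if and only if h(m(t)+x, t) = α x e^{−x} + o(t^{1+ν/2}) as t → ∞. -/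

import Mathlib

open MeasureTheory ProbabilityTheory Filter Real Set Asymptotics

/-- A one-dimensional Brownian motion with normalization `E[B_t^2] = 2t`. -/
structure IsBrownianMotion {Ω : Type*} [MeasurableSpace Ω] (P : Measure Ω)
    (B : ℝ → Ω → ℝ) : Prop where
  cont : ∀ᵐ ω ∂P, Continuous fun s => B s ω
  init : ∀ᵐ ω ∂P, B 0 ω = 0
  meas : ∀ s, Measurable (B s)
  indep : ∀ (n : ℕ) (t : ℕ → ℝ), Monotone t →
    iIndepFun
      (fun i : Fin n => fun ω => B (t ((i : ℕ) + 1)) ω - B (t (i : ℕ)) ω) P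
  gauss : ∀ s t : ℝ, 0 ≤ s → s ≤ t →
    Measure.map (fun ω => B t ω - B s ω) P = gaussianReal 0 ((2 * (t - s)).toNNReal)

/-- Feynman–Kac representation of the solution of the linearised FKPP equation
`∂_t h = ∂_x² h + h` for `x > m t`, with absorbing boundary `h (m t) t = 0` and
initial condition `h₀`:
`h(x,t) = e^t E[h₀(x + B_t) 1{x + B_s > m(t-s) ∀ s ∈ [0,t]}]`. -/
noncomputable def fkppSol {Ω : Type*} [MeasurableSpace Ω] (P : Measure Ω)
    (B : ℝ → Ω → ℝ) (h₀ m : ℝ → ℝ) (x t : ℝ) : ℝ :=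
  Real.exp t *
    ∫ ω, ({ω : Ω | ∀ s ∈ Icc (0:ℝ) t, m (t - s) < x + B s ω}.indicator
      (fun ω => h₀ (x + B t ω)) ω) ∂P

open scoped NNReal ENNReal Topology
set_option linter.all false
set_option linter.deprecated false

section PartI

variable {Ω : Type*} [MeasurableSpace Ω] {P : Measure Ω} [IsProbabilityMeasure P]
  {B : ℝ → Ω → ℝ}

lemma bm_pre (hB : IsBrownianMotion P B) :
    IsPreBrownianReal (fun (t : ℝ≥0) ω => B ((t : ℝ) / 2) ω) P := by
  apply HasIndepIncrements.isPreBrownianReal_of_hasLaw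
  · intro t
    refine ⟨(hB.meas _).aemeasurable, ?_⟩
    have h := hB.gauss 0 (t/2) le_rfl (by positivity)
    have h2 : Measure.map (B ((t:ℝ)/2)) P = Measure.map (fun ω => B (t/2) ω - B 0 ω) P := by
      apply Measure.map_congr
      filter_upwards [hB.init] with ω hω
      simp [hω]
    rw [h2, h]
    congr 1
    ext
    rw [Real.coe_toNNReal _ (by simp; positivity)]
    ring
  · intro n t ht
    have := hB.indep n (fun k => (t ⟨min n k, by omega⟩ : ℝ) / 2) (fun i j hij => by
      have : t ⟨min n i, by omega⟩ ≤ t ⟨min n j, by omega⟩ := ht (by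
        simp only [Fin.mk_le_mk]; omega)
      have h2 : (t ⟨min n i, by omega⟩ : ℝ) ≤ t ⟨min n j, by omega⟩ := by exact_mod_cast this
      simp only
      linarith)
    convert this using 3 with i
    · rename_i ω
      have e1 : i.succ = ⟨min n (i + 1), by omega⟩ := by ext; simp
      have e2 : i.castSucc = ⟨min n i, by omega⟩ := by ext; simp
      rw [e1, e2]

lemma bm_indep (hB : IsBrownianMotion P B) {τ : ℝ} (hτ : 0 ≤ τ) :
    IndepFun (fun ω (u : ℝ) => B (τ + max u 0) ω - B τ ω)
      (fun ω (u : ℝ) => B (min (max u 0) τ) ω) P := by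
  have h := (bm_pre hB).indepFun_shift (2 * τ).toNNReal
  have h2τ : 0 ≤ 2 * τ := by linarith
  let φ : (ℝ≥0 → ℝ) → (ℝ → ℝ) := fun f u => f ((2 * max u 0).toNNReal)
  let ψ : ((Set.Iic (2 * τ).toNNReal) → ℝ) → (ℝ → ℝ) :=
    fun f u => f ⟨(2 * min (max u 0) τ).toNNReal, by
      apply Real.toNNReal_le_toNNReal
      have := min_le_right (max u 0) τ
      linarith⟩
  have hφ : Measurable φ := by
    refine measurable_pi_lambda _ fun u => measurable_pi_apply _
  have hψ : Measurable ψ := by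
    refine measurable_pi_lambda _ fun u => measurable_pi_apply _
  have h3 := h.comp hφ hψ
  convert h3 using 1
  · ext ω u
    have : 0 ≤ 2 * max u 0 := by positivity
    simp only [φ, Function.comp]
    simp only [NNReal.coe_add, Real.coe_toNNReal _ h2τ, Real.coe_toNNReal _ this]
    congr 2 <;> ring
  · ext ω u
    have : 0 ≤ 2 * min (max u 0) τ := by
      have : 0 ≤ min (max u 0) τ := le_min (le_max_right _ _) hτ
      linarith
    simp only [ψ, Function.comp]
    simp only [Real.coe_toNNReal _ this]
    congr 1; ring

lemma pre_law_eq {X Y : ℝ≥0 → Ω → ℝ} (hX : IsPreBrownianReal X P) (hY : IsPreBrownianReal Y P)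
    (hXm : ∀ t, Measurable (X t)) (hYm : ∀ t, Measurable (Y t)) :
    Measure.map (fun ω t => X t ω) P = Measure.map (fun ω t => Y t ω) P := by
  rw [map_eq_iff_forall_finset_map_restrict_eq]
  · intro I
    exact (hX.hasLaw I).map_eq.trans (hY.hasLaw I).map_eq.symm
  · exact (measurable_pi_lambda _ fun t => hXm t).aemeasurable
  · exact (measurable_pi_lambda _ fun t => hYm t).aemeasurable

lemma bm_law (hB : IsBrownianMotion P B) {τ : ℝ} (hτ : 0 ≤ τ) :
    Measure.map (fun ω (u : ℝ) => B (τ + max u 0) ω - B τ ω) P =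
      Measure.map (fun ω (u : ℝ) => B (max u 0) ω) P := by
  have h2τ : 0 ≤ 2 * τ := by linarith
  have h := pre_law_eq ((bm_pre hB).shift (2 * τ).toNNReal) (bm_pre hB)
    (fun t => (hB.meas _).sub (hB.meas _)) (fun t => hB.meas _)
  let φ : (ℝ≥0 → ℝ) → (ℝ → ℝ) := fun f u => f ((2 * max u 0).toNNReal)
  have hφ : Measurable φ := by
    refine measurable_pi_lambda _ fun u => measurable_pi_apply _
  have h1 := congrArg (Measure.map φ) h
  have hm1 : Measurable (fun ω (t : ℝ≥0) => B (((2 * τ).toNNReal + t : ℝ≥0) / 2) ω -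
      B ((2 * τ).toNNReal / 2) ω) :=
    measurable_pi_lambda _ fun t => (hB.meas _).sub (hB.meas _)
  have hm2 : Measurable (fun ω (t : ℝ≥0) => B (t / 2) ω) :=
    measurable_pi_lambda _ fun t => hB.meas _
  rw [Measure.map_map hφ hm1, Measure.map_map hφ hm2] at h1
  convert h1 using 2
  · ext ω u
    have : 0 ≤ 2 * max u 0 := by positivity
    simp only [φ, Function.comp]
    simp only [NNReal.coe_add, Real.coe_toNNReal _ h2τ, Real.coe_toNNReal _ this]
    congr 2 <;> ring
  · ext ω u
    have : 0 ≤ 2 * max u 0 := by positivity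
    simp only [φ, Function.comp]
    simp only [Real.coe_toNNReal _ this]
    congr 1; ring

/-- Rational-time version of the survival event. -/
def Svv (g : ℝ → ℝ) (T : ℝ) : Set (ℝ × (ℝ → ℝ)) :=
  ⋃ j : ℕ, ⋂ q : {q : ℚ // 0 ≤ q ∧ q ≤ 1},
    {z | g ((q.1 : ℝ) * T) + 1 / ((j : ℝ) + 1) ≤ z.1 + z.2 ((q.1 : ℝ) * T)}

lemma Svv_meas (g : ℝ → ℝ) (T : ℝ) : MeasurableSet (Svv g T) := by
  refine MeasurableSet.iUnion fun j => MeasurableSet.iInter fun q => ?_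
  refine measurableSet_le measurable_const ?_
  exact measurable_fst.add ((measurable_pi_apply _).comp measurable_snd)

lemma Svv_iff {g : ℝ → ℝ} (hg : Continuous g) {T : ℝ} (hT : 0 ≤ T) {x : ℝ} {f : ℝ → ℝ}
    (hf : Continuous f) : (x, f) ∈ Svv g T ↔ ∀ s ∈ Icc (0:ℝ) T, g s < x + f s := by
  constructor
  · intro h s hs
    simp only [Svv, mem_iUnion, mem_iInter, mem_setOf_eq] at h
    obtain ⟨j, hj⟩ := h
    have key : ∀ v ∈ Icc (0:ℝ) 1, g (v * T) + 1 / ((j : ℝ) + 1) ≤ x + f (v * T) := by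
      have hcl : IsClosed {v : ℝ | g (v * T) + 1 / ((j : ℝ) + 1) ≤ x + f (v * T)} := by
        apply isClosed_le <;> fun_prop
      have hsub : Ioo (0:ℝ) 1 ∩ range ((↑) : ℚ → ℝ) ⊆
          {v : ℝ | g (v * T) + 1 / ((j : ℝ) + 1) ≤ x + f (v * T)} := by
        rintro v ⟨hv, q, rfl⟩
        exact hj ⟨q, by exact_mod_cast hv.1.le, by exact_mod_cast hv.2.le⟩
      have hd : Icc (0:ℝ) 1 ⊆ closure (Ioo (0:ℝ) 1 ∩ range ((↑) : ℚ → ℝ)) := by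
        have := (Rat.denseRange_cast (𝕜 := ℝ)).open_subset_closure_inter (isOpen_Ioo (a := (0:ℝ)) (b := 1))
        have h2 := closure_mono this
        rw [closure_Ioo (by norm_num), closure_closure] at h2
        exact h2
      intro v hv
      exact (closure_minimal hsub hcl) (hd hv)
    rcases hT.eq_or_lt with h0 | h0
    · have := key 0 (by simp)
      have hs0 : s = 0 := le_antisymm (by rw [h0]; exact hs.2) hs.1
      subst hs0
      simp only [zero_mul] at this
      have : 0 < 1 / ((j:ℝ) + 1) := by positivity
      linarith
    · have := key (s / T) ⟨div_nonneg hs.1 hT, (div_le_one h0).2 hs.2⟩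
      rw [div_mul_cancel₀ _ h0.ne'] at this
      have : 0 < 1 / ((j:ℝ) + 1) := by positivity
      linarith
  · intro h
    obtain ⟨s, hs, hmin⟩ := isCompact_Icc.exists_isMinOn (nonempty_Icc.2 hT)
      (f := fun s => x + f s - g s) (by fun_prop)
    have hpos : 0 < x + f s - g s := by have := h s hs; linarith
    obtain ⟨j, hj⟩ := exists_nat_one_div_lt hpos
    simp only [Svv, mem_iUnion, mem_iInter, mem_setOf_eq]
    refine ⟨j, fun q => ?_⟩
    have h0 : (0:ℝ) ≤ q.1 := by exact_mod_cast q.2.1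
    have h1 : (q.1:ℝ) ≤ 1 := by exact_mod_cast q.2.2
    have hq : (q.1:ℝ) * T ∈ Icc (0:ℝ) T := ⟨by positivity, by nlinarith⟩
    have := hmin hq
    simp only [mem_setOf_eq] at this
    linarith

/-- path of the Brownian motion indexed by the reals -/
def bpath (B : ℝ → Ω → ℝ) (ω : Ω) : ℝ → ℝ := fun u => B (max u 0) ω

lemma bpath_meas (hB : IsBrownianMotion P B) : Measurable (bpath B) :=
  measurable_pi_lambda _ fun _ => hB.meas _

/-- path functional -/
noncomputable def Gf (m : ℝ → ℝ) (f0 : ℝ → ℝ≥0∞) (t : ℝ) (z : ℝ × (ℝ → ℝ)) : ℝ≥0∞ :=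
  (Svv (fun u => m (t - u)) t).indicator (fun z => f0 (z.1 + z.2 t)) z

/-- killed expectation -/
noncomputable def Hf (P : Measure Ω) (B : ℝ → Ω → ℝ) (m : ℝ → ℝ) (f0 : ℝ → ℝ≥0∞) (x t : ℝ) : ℝ≥0∞ :=
  ∫⁻ ω, Gf m f0 t (x, bpath B ω) ∂P

lemma Gf_meas {m : ℝ → ℝ} {f0 : ℝ → ℝ≥0∞} (hf0 : Measurable f0) (t : ℝ) :
    Measurable (Gf m f0 t) := by
  refine Measurable.indicator ?_ (Svv_meas _ _)
  exact hf0.comp (measurable_fst.add ((measurable_pi_apply _).comp measurable_snd))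

lemma Hf_meas (hB : IsBrownianMotion P B) {m : ℝ → ℝ} {f0 : ℝ → ℝ≥0∞} (hf0 : Measurable f0) (t : ℝ) :
    Measurable (fun x => Hf P B m f0 x t) := by
  unfold Hf
  refine Measurable.lintegral_prod_right' (f := fun z : ℝ × Ω => Gf m f0 t (z.1, bpath B z.2)) ?_
  exact (Gf_meas hf0 t).comp (measurable_fst.prodMk ((bpath_meas hB).comp measurable_snd))

lemma Hf_le {m : ℝ → ℝ} {f0 : ℝ → ℝ≥0∞} {C : ℝ≥0∞} (hC : ∀ x, f0 x ≤ C)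
    (x t : ℝ) : Hf P B m f0 x t ≤ C := by
  unfold Hf
  calc _ ≤ ∫⁻ _, C ∂P := lintegral_mono fun ω => by
          unfold Gf
          exact (indicator_le_self' (fun _ _ => zero_le) _).trans (hC _)
    _ = C := by simp

lemma bpath_cont (hB : IsBrownianMotion P B) : ∀ᵐ ω ∂P, Continuous (bpath B ω) := by
  filter_upwards [hB.cont] with ω hω
  exact hω.comp (continuous_id.max continuous_const)

/-- shifted functional, integrated over the shift, for fixed past -/
lemma Hf_markov (hB : IsBrownianMotion P B) {m : ℝ → ℝ} (hm : Continuous m) {f0 : ℝ → ℝ≥0∞}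
    (hf0 : Measurable f0) (x : ℝ) {s τ : ℝ} (hs : 0 ≤ s) (hτ : 0 ≤ τ) :
    Hf P B m f0 x (s + τ) = ∫⁻ ω, {ω | ∀ u ∈ Icc (0:ℝ) τ, m (s + τ - u) < x + bpath B ω u}.indicator
      (fun ω => Hf P B m f0 (x + B τ ω) s) ω ∂P := by
  set past : Ω → (ℝ → ℝ) := fun ω u => B (min (max u 0) τ) ω with hpast
  set sh : Ω → (ℝ → ℝ) := fun ω u => B (τ + max u 0) ω - B τ ω with hsh
  have hpastm : Measurable past := measurable_pi_lambda _ fun u => hB.meas _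
  have hshm : Measurable sh := measurable_pi_lambda _ fun u => (hB.meas _).sub (hB.meas _)
  set g : ℝ → ℝ := fun u => m (s + τ - u) with hg
  have hgc : Continuous g := by fun_prop
  let F : (ℝ → ℝ) × (ℝ → ℝ) → ℝ≥0∞ := fun z =>
    (Svv g τ).indicator 1 (x, z.2) * Gf m f0 s (x + z.2 τ, z.1)
  have hFm : Measurable F := by
    refine Measurable.mul ?_ ?_
    · exact (measurable_one.indicator (Svv_meas g τ)).comp
        (measurable_const.prodMk measurable_snd)
    · refine (Gf_meas hf0 s).comp (Measurable.prodMk ?_ measurable_fst)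
      exact measurable_const.add ((measurable_pi_apply _).comp measurable_snd)
  have h1 : Hf P B m f0 x (s + τ) = ∫⁻ ω, F (sh ω, past ω) ∂P := by
    unfold Hf
    apply lintegral_congr_ae
    filter_upwards [hB.cont] with ω hc
    have hc1 : Continuous (bpath B ω) := hc.comp (continuous_id.max continuous_const)
    have hc2 : Continuous (past ω) :=
      hc.comp ((continuous_id.max continuous_const).min continuous_const)
    have hc3 : Continuous (sh ω) :=
      (hc.comp (continuous_const.add (continuous_id.max continuous_const))).sub continuous_const
    have hiff : (x, bpath B ω) ∈ Svv (fun u => m (s + τ - u)) (s + τ) ↔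
        (x, past ω) ∈ Svv g τ ∧ (x + past ω τ, sh ω) ∈ Svv (fun u => m (s - u)) s := by
      rw [Svv_iff (by fun_prop) (by linarith) hc1, Svv_iff hgc hτ hc2,
        Svv_iff (by fun_prop) hs hc3]
      constructor
      · intro h
        constructor
        · intro u hu
          have := h u ⟨hu.1, by linarith [hu.2]⟩
          simpa [bpath, hpast, hg, max_eq_left hu.1, min_eq_left hu.2] using this
        · intro u hu
          have := h (τ + u) ⟨by linarith [hu.1], by linarith [hu.2]⟩
          have e : max (τ + u) 0 = τ + u := max_eq_left (by linarith [hu.1])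
          have e2 : s + τ - (τ + u) = s - u := by ring
          simp only [bpath, e, e2] at this
          simp only [hpast, hsh, max_eq_left hτ, min_self, max_eq_left hu.1]
          linarith
      · rintro ⟨ha, hb⟩ u hu
        rcases le_total u τ with h | h
        · have := ha u ⟨hu.1, h⟩
          simpa [bpath, hpast, hg, max_eq_left hu.1, min_eq_left h] using this
        · have := hb (u - τ) ⟨by linarith, by linarith [hu.2]⟩
          simp only [hpast, hsh, max_eq_left hτ, min_self,
            max_eq_left (sub_nonneg.2 h)] at this
          have e2 : s - (u - τ) = s + τ - u := by ring
          have e3 : τ + (u - τ) = u := by ring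
          rw [e2, e3] at this
          simp only [bpath, max_eq_left hu.1]
          linarith
    have hval : x + bpath B ω (s + τ) = x + past ω τ + sh ω s := by
      have e : max (s + τ) 0 = τ + s := by rw [max_eq_left (by linarith)]; ring
      simp only [bpath, hpast, hsh, max_eq_left hτ, min_self, max_eq_left hs, e]
      ring
    by_cases hmem : (x, bpath B ω) ∈ Svv (fun u => m (s + τ - u)) (s + τ)
    · have h' := hiff.1 hmem
      simp only [F, Gf, indicator_of_mem hmem, indicator_of_mem h'.1, indicator_of_mem h'.2,
        Pi.one_apply, one_mul, hval]
    · simp only [Gf, F, indicator_of_notMem hmem]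
      rw [hiff, not_and_or] at hmem
      rcases hmem with h | h
      · simp only [indicator_of_notMem h, zero_mul]
      · simp only [indicator_of_notMem h, mul_zero]
  have hind : IndepFun sh past P := bm_indep hB hτ
  have hlaw : Measure.map sh P = Measure.map (bpath B) P := bm_law hB hτ
  have h2 : ∫⁻ ω, F (sh ω, past ω) ∂P = ∫⁻ y, ∫⁻ z, F (z, y) ∂(P.map (bpath B)) ∂(P.map past) := by
    have hmap := (indepFun_iff_map_prod_eq_prod_map_map hshm.aemeasurable hpastm.aemeasurable).1 hind
    have : ∫⁻ ω, F (sh ω, past ω) ∂P = ∫⁻ z, F z ∂(P.map (fun ω => (sh ω, past ω))) :=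
      (lintegral_map hFm (hshm.prodMk hpastm)).symm
    rw [this, hmap, hlaw]
    haveI := Measure.isProbabilityMeasure_map (μ := P) (bpath_meas hB).aemeasurable
    haveI := Measure.isProbabilityMeasure_map (μ := P) hpastm.aemeasurable
    exact lintegral_prod_symm' F hFm
  rw [h1, h2, lintegral_map]
  · apply lintegral_congr_ae
    filter_upwards [hB.cont] with ω hc
    have hc1 : Continuous (bpath B ω) := hc.comp (continuous_id.max continuous_const)
    have hc2 : Continuous (past ω) :=
      hc.comp ((continuous_id.max continuous_const).min continuous_const)
    have hFp : Measurable (fun z => F (z, past ω)) := hFm.comp measurable_prodMk_right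
    rw [lintegral_map hFp (bpath_meas hB)]
    have hp : past ω τ = B τ ω := by simp [hpast, hτ]
    have hiff : (x, past ω) ∈ Svv g τ ↔
        ω ∈ {ω | ∀ u ∈ Icc (0:ℝ) τ, m (s + τ - u) < x + bpath B ω u} := by
      rw [Svv_iff hgc hτ hc2]
      refine forall₂_congr fun u hu => ?_
      simp [bpath, hpast, hg, max_eq_left hu.1, min_eq_left hu.2]
    simp only [F, hp]
    by_cases hmem : (x, past ω) ∈ Svv g τ
    · rw [indicator_of_mem (hiff.1 hmem)]
      simp only [indicator_of_mem hmem, Pi.one_apply, one_mul]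
      rfl
    · rw [indicator_of_notMem (fun h => hmem (hiff.2 h))]
      simp [indicator_of_notMem hmem]
  · haveI := Measure.isProbabilityMeasure_map (μ := P) (bpath_meas hB).aemeasurable
    exact Measurable.lintegral_prod_left' hFm
  · exact hpastm

end PartI

open MeasureTheory ProbabilityTheory Filter Real Set Asymptotics
open scoped NNReal ENNReal Topology
set_option linter.all false
set_option linter.deprecated false

section PartB

/-- heat kernel -/
noncomputable def hk (τ u : ℝ) : ℝ := (√(4 * π * τ))⁻¹ * Real.exp (-u ^ 2 / (4 * τ))

lemma hk_nonneg (τ u : ℝ) : 0 ≤ hk τ u := by unfold hk; positivity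

lemma hk_le {τ : ℝ} (hτ : 0 < τ) (u : ℝ) : hk τ u ≤ (√(4 * π * τ))⁻¹ := by
  unfold hk
  have : Real.exp (-u ^ 2 / (4 * τ)) ≤ 1 := by
    rw [Real.exp_le_one_iff]
    apply div_nonpos_of_nonpos_of_nonneg <;> nlinarith [sq_nonneg u]
  have h2 : 0 ≤ (√(4 * π * τ))⁻¹ := by positivity
  nlinarith

lemma hk_neg (τ u : ℝ) : hk τ (-u) = hk τ u := by simp [hk]

lemma hk_sub_comm (τ x y : ℝ) : hk τ (x - y) = hk τ (y - x) := by
  rw [← hk_neg]; congr 1; ring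

lemma hk_cont (τ : ℝ) : Continuous (hk τ) := by unfold hk; fun_prop

lemma hk_eq_pdf {τ : ℝ} (hτ : 0 ≤ τ) (x y : ℝ) :
    hk τ (x - y) = gaussianPDFReal x (2 * τ).toNNReal y := by
  unfold hk gaussianPDFReal
  rw [Real.coe_toNNReal _ (by linarith)]
  rw [show 2 * π * (2 * τ) = 4 * π * τ by ring, show 2 * (2 * τ) = 4 * τ by ring,
    show (y - x) ^ 2 = (x - y) ^ 2 by ring]

lemma hk_integral {τ : ℝ} (hτ : 0 < τ) (x : ℝ) : ∫⁻ y, ENNReal.ofReal (hk τ (x - y)) = 1 := by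
  simp_rw [hk_eq_pdf hτ.le]
  exact lintegral_gaussianPDFReal_eq_one x (by simp [hτ])

lemma hk_integral' {τ : ℝ} (hτ : 0 < τ) (y : ℝ) : ∫⁻ x, ENNReal.ofReal (hk τ (x - y)) = 1 := by
  simp_rw [hk_sub_comm τ _ y]
  exact hk_integral hτ y

lemma hk_integrable {τ : ℝ} (hτ : 0 < τ) : Integrable (hk τ) := by
  have := integrable_gaussianPDFReal 0 (2 * τ).toNNReal
  convert this using 1
  ext y
  rw [← hk_eq_pdf hτ.le, zero_sub, hk_neg]

lemma hk_int_one {τ : ℝ} (hτ : 0 < τ) : ∫ u, hk τ u = 1 := by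
  have := integral_gaussianPDFReal_eq_one 0 (v := (2 * τ).toNNReal) (by simp [hτ])
  convert this using 2
  ext y
  rw [← hk_eq_pdf hτ.le, zero_sub, hk_neg]

lemma hk_mul {τ δ : ℝ} (hτ : 0 < τ) (hδ : 0 < δ) (a b z : ℝ) :
    hk τ (a - z) * hk δ (z - b) =
      hk (τ + δ) (a - b) * hk (τ * δ / (τ + δ)) ((a * δ + b * τ) / (τ + δ) - z) := by
  unfold hk
  have h1 : √(4 * π * τ) * √(4 * π * δ) =
      √(4 * π * (τ + δ)) * √(4 * π * (τ * δ / (τ + δ))) := by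
    rw [← Real.sqrt_mul (by positivity), ← Real.sqrt_mul (by positivity)]
    congr 1; field_simp
  have h2 : Real.exp (-(a - z) ^ 2 / (4 * τ)) * Real.exp (-(z - b) ^ 2 / (4 * δ)) =
      Real.exp (-(a - b) ^ 2 / (4 * (τ + δ))) *
      Real.exp (-((a * δ + b * τ) / (τ + δ) - z) ^ 2 / (4 * (τ * δ / (τ + δ)))) := by
    rw [← Real.exp_add, ← Real.exp_add]
    congr 1
    have : τ + δ ≠ 0 := by positivity
    field_simp
    ring
  calc _ = (√(4 * π * τ) * √(4 * π * δ))⁻¹ *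
        (Real.exp (-(a - z) ^ 2 / (4 * τ)) * Real.exp (-(z - b) ^ 2 / (4 * δ))) := by
          rw [mul_inv]; ring
    _ = _ := by rw [h1, h2, mul_inv]; ring

lemma hk_semigroup {τ δ : ℝ} (hτ : 0 < τ) (hδ : 0 < δ) (a b : ℝ) :
    ∫⁻ z, ENNReal.ofReal (hk τ (a - z)) * ENNReal.ofReal (hk δ (z - b)) =
      ENNReal.ofReal (hk (τ + δ) (a - b)) := by
  simp_rw [← ENNReal.ofReal_mul (hk_nonneg _ _), hk_mul hτ hδ,
    ENNReal.ofReal_mul (hk_nonneg _ _)]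
  rw [lintegral_const_mul _ (by
    have := hk_cont (τ * δ / (τ + δ))
    exact ENNReal.measurable_ofReal.comp (this.measurable.comp (measurable_const.sub measurable_id)))]
  rw [hk_integral (by positivity), mul_one]

lemma hk_meas_left (τ y : ℝ) : Measurable fun x => ENNReal.ofReal (hk τ (x - y)) :=
  ENNReal.measurable_ofReal.comp ((hk_cont τ).measurable.comp (measurable_id.sub measurable_const))

lemma hk_meas_right (τ x : ℝ) : Measurable fun y => ENNReal.ofReal (hk τ (x - y)) :=
  ENNReal.measurable_ofReal.comp ((hk_cont τ).measurable.comp (measurable_const.sub measurable_id))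

lemma hk_meas2 (τ : ℝ) : Measurable fun z : ℝ × ℝ => ENNReal.ofReal (hk τ (z.1 - z.2)) :=
  ENNReal.measurable_ofReal.comp ((hk_cont τ).measurable.comp (measurable_fst.sub measurable_snd))

variable {Ω : Type*} [MeasurableSpace Ω] {P : Measure Ω} [IsProbabilityMeasure P]
  {B : ℝ → Ω → ℝ}

lemma bm_marg (hB : IsBrownianMotion P B) {τ : ℝ} (hτ : 0 ≤ τ) :
    Measure.map (B τ) P = gaussianReal 0 (2 * τ).toNNReal := by
  have h := hB.gauss 0 τ le_rfl hτ
  rw [sub_zero] at h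
  rw [← h]
  apply Measure.map_congr
  filter_upwards [hB.init] with ω hω
  simp [hω]

lemma bm_expect (hB : IsBrownianMotion P B) {τ : ℝ} (hτ : 0 < τ) {f : ℝ → ℝ≥0∞}
    (hf : Measurable f) (x : ℝ) :
    ∫⁻ ω, f (x + B τ ω) ∂P = ∫⁻ y, ENNReal.ofReal (hk τ (x - y)) * f y := by
  have h1 : ∫⁻ ω, f (x + B τ ω) ∂P = ∫⁻ y, f y ∂(gaussianReal x (2 * τ).toNNReal) := by
    have : gaussianReal x (2 * τ).toNNReal = Measure.map (fun ω => x + B τ ω) P := by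
      have h2 := gaussianReal_map_const_add (μ := 0) (v := (2 * τ).toNNReal) x
      rw [← bm_marg hB hτ.le, Measure.map_map (by fun_prop) (hB.meas _), zero_add] at h2
      exact h2.symm
    have hm : Measurable (fun ω => x + B τ ω) := measurable_const.add (hB.meas _)
    rw [this, lintegral_map hf hm]
  rw [h1, gaussianReal_of_var_ne_zero _ (by simp [hτ]),
    lintegral_withDensity_eq_lintegral_mul _ (measurable_gaussianPDF _ _) hf]
  simp only [Pi.mul_apply, gaussianPDF, hk_eq_pdf hτ.le]

lemma gauss_tail (hB : IsBrownianMotion P B) {s δ : ℝ} (hs : 0 ≤ s) (hδ : 0 < δ) {c : ℝ} (hc : 0 < c) :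
    P {ω | c ≤ |B (s + δ) ω - B s ω|} ≤ ENNReal.ofReal (64 * δ ^ 2 / c ^ 4) := by
  set X : Ω → ℝ := fun ω => B (s + δ) ω - B s ω with hX
  have hXm : Measurable X := (hB.meas _).sub (hB.meas _)
  have hlaw : Measure.map X P = gaussianReal 0 (2 * δ).toNNReal := by
    have := hB.gauss s (s + δ) hs (by linarith)
    rwa [show s + δ - s = δ by ring] at this
  have hinteg : ∀ t, Integrable (fun ω => Real.exp (t * X ω)) P := by
    intro t
    have h := integrable_exp_mul_gaussianReal (μ := 0) (v := (2 * δ).toNNReal) t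
    rw [← hlaw] at h
    exact h.comp_measurable hXm
  have hv : (((2 * δ).toNNReal : ℝ≥0) : ℝ) = 2 * δ := Real.coe_toNNReal _ (by linarith)
  have hexp : Real.exp (-(c ^ 2 / (4 * δ))) ≤ 32 * δ ^ 2 / c ^ 4 := by
    have h1 : (c ^ 2 / (4 * δ)) ^ 2 / 2 ≤ Real.exp (c ^ 2 / (4 * δ)) := by
      have := Real.quadratic_le_exp_of_nonneg (x := c ^ 2 / (4 * δ)) (by positivity)
      have : 0 ≤ c ^ 2 / (4 * δ) := by positivity
      linarith
    rw [Real.exp_neg]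
    calc _ ≤ ((c ^ 2 / (4 * δ)) ^ 2 / 2)⁻¹ := inv_anti₀ (by positivity) h1
      _ = _ := by field_simp; ring
  have hplus : P.real {ω | c ≤ X ω} ≤ 32 * δ ^ 2 / c ^ 4 := by
    have h := measure_ge_le_exp_mul_mgf (μ := P) (X := X) (t := c / (2 * δ)) c (by positivity) (hinteg _)
    rw [mgf_gaussianReal hlaw, hv, ← Real.exp_add] at h
    refine h.trans (le_trans (le_of_eq ?_) hexp)
    congr 1; field_simp; ring
  have hminus : P.real {ω | X ω ≤ -c} ≤ 32 * δ ^ 2 / c ^ 4 := by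
    have h := measure_le_le_exp_mul_mgf (μ := P) (X := X) (t := -(c / (2 * δ))) (-c)
      (by have : 0 ≤ c / (2 * δ) := by positivity
          linarith) (hinteg _)
    rw [mgf_gaussianReal hlaw, hv, ← Real.exp_add] at h
    refine h.trans (le_trans (le_of_eq ?_) hexp)
    congr 1; field_simp; ring
  have hsub : {ω | c ≤ |X ω|} ⊆ {ω | c ≤ X ω} ∪ {ω | X ω ≤ -c} := by
    intro ω hω
    rcases le_abs.1 (show c ≤ |X ω| from hω) with h | h
    · exact Or.inl h
    · exact Or.inr (show X ω ≤ -c by linarith)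
  rw [← ofReal_measureReal (μ := P)]
  apply ENNReal.ofReal_le_ofReal
  calc P.real {ω | c ≤ |X ω|} ≤ P.real ({ω | c ≤ X ω} ∪ {ω | X ω ≤ -c}) :=
        measureReal_mono hsub
    _ ≤ _ := measureReal_union_le _ _
    _ ≤ 32 * δ ^ 2 / c ^ 4 + 32 * δ ^ 2 / c ^ 4 := add_le_add hplus hminus
    _ = _ := by ring

lemma chain_det {f : ℝ → ℝ} (hf : Continuous f) (h0 : f 0 = 0) {δ c : ℝ} (hδ : 0 < δ)
    (hc : 0 ≤ c)
    (h : ∀ n k : ℕ, k < 2 ^ n →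
      |f (k * (δ / 2 ^ n) + δ / 2 ^ n) - f (k * (δ / 2 ^ n))| ≤ c / 10 * (9 / 10) ^ n) :
    ∀ u ∈ Icc (0:ℝ) δ, |f u| ≤ c := by
  intro u hu
  rcases hu.2.eq_or_lt with rfl | hlt
  · have := h 0 0 (by norm_num)
    simp [h0] at this
    linarith
  have hx0 : 0 ≤ u / δ := div_nonneg hu.1 hδ.le
  have hx1 : u / δ < 1 := (div_lt_one hδ).2 hlt
  set x := u / δ with hx
  let d : ℕ → ℕ := fun n => ⌊x * 2 ^ n⌋₊
  have hd : ∀ n, d n < 2 ^ n := by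
    intro n
    rw [Nat.floor_lt (by positivity)]
    push_cast
    have : (0:ℝ) < 2 ^ n := by positivity
    nlinarith
  have hstep : ∀ n, d (n + 1) = 2 * d n ∨ d (n + 1) = 2 * d n + 1 := by
    intro n
    have e : d (n + 1) / 2 = d n := by
      have := Nat.floor_div_natCast (x * 2 ^ (n + 1)) 2
      simp only [d]
      rw [← this]
      congr 1
      push_cast
      rw [pow_succ]; ring
    omega
  have hbd : ∀ n, |f (d n * (δ / 2 ^ n))| ≤ ∑ i ∈ Finset.range (n + 1), c / 10 * (9 / 10) ^ i := by
    intro n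
    induction n with
    | zero =>
      have : d 0 = 0 := by have := hd 0; simpa using this
      simp [this, h0]; positivity
    | succ n ih =>
      rw [Finset.sum_range_succ]
      have hp : (2:ℝ) ^ (n + 1) = 2 * 2 ^ n := by rw [pow_succ]; ring
      rcases hstep n with e | e
      · have : (d (n + 1) : ℝ) * (δ / 2 ^ (n + 1)) = d n * (δ / 2 ^ n) := by
          rw [e, hp]; push_cast; field_simp
        rw [this]
        have : 0 ≤ c / 10 * (9 / 10) ^ (n + 1) := by positivity
        linarith
      · have e1 : (d (n + 1) : ℝ) * (δ / 2 ^ (n + 1)) =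
            ((2 * d n : ℕ) : ℝ) * (δ / 2 ^ (n + 1)) + δ / 2 ^ (n + 1) := by
          rw [e]; push_cast; ring
        have e2 : ((2 * d n : ℕ) : ℝ) * (δ / 2 ^ (n + 1)) = d n * (δ / 2 ^ n) := by
          rw [hp]; push_cast; field_simp
        have h3 := h (n + 1) (2 * d n) (by have := hd n; rw [pow_succ]; omega)
        rw [e1]
        rw [e2] at h3 ⊢
        have := abs_sub_abs_le_abs_sub (f (d n * (δ / 2 ^ n) + δ / 2 ^ (n + 1))) (f (d n * (δ / 2 ^ n)))
        linarith
  have hgeo : ∀ n, ∑ i ∈ Finset.range (n + 1), c / 10 * (9 / 10 : ℝ) ^ i ≤ c := by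
    intro n
    rw [← Finset.mul_sum, geom_sum_eq (by norm_num)]
    have h7 : (0:ℝ) ≤ c * (9 / 10) ^ (n + 1) := by positivity
    have h8 : c / 10 * (((9 / 10 : ℝ) ^ (n + 1) - 1) / (9 / 10 - 1)) =
      c - c * (9 / 10) ^ (n + 1) := by ring
    rw [h8]; linarith
  have hlim : Tendsto (fun n => (d n : ℝ) * (δ / 2 ^ n)) atTop (𝓝 u) := by
    have h1 : Tendsto (fun n : ℕ => δ / 2 ^ n) atTop (𝓝 0) := by
      have := (tendsto_pow_atTop_nhds_zero_of_lt_one (r := (1/2:ℝ)) (by norm_num) (by norm_num)).const_mul δ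
      simp only [mul_zero] at this
      refine this.congr fun n => ?_
      rw [one_div, inv_pow]; rfl
    have h2 : Tendsto (fun n : ℕ => u - δ / 2 ^ n) atTop (𝓝 u) := by
      simpa using tendsto_const_nhds.sub h1
    have hux : u = x * δ := by rw [hx]; field_simp
    refine tendsto_of_tendsto_of_tendsto_of_le_of_le h2 tendsto_const_nhds ?_ ?_
    · intro n
      have := Nat.lt_floor_add_one (x * 2 ^ n)
      have hp : (0:ℝ) < δ / 2 ^ n := by positivity
      have h4 : x * 2 ^ n * (δ / 2 ^ n) = u := by rw [hux]; field_simp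
      simp only [d]
      nlinarith
    · intro n
      have := Nat.floor_le (a := x * 2 ^ n) (by positivity)
      have hp : (0:ℝ) < δ / 2 ^ n := by positivity
      have h4 : x * 2 ^ n * (δ / 2 ^ n) = u := by rw [hux]; field_simp
      simp only [d]
      nlinarith
  have hlim2 := ((hf.tendsto u).comp hlim).abs
  exact le_of_tendsto' hlim2 fun n => (hbd n).trans (hgeo n)

lemma max_ineq (hB : IsBrownianMotion P B) {δ c : ℝ} (hδ : 0 < δ) (hc : 0 < c) :
    P {ω | ∃ u ∈ Icc (0:ℝ) δ, c < |B u ω|} ≤ ENNReal.ofReal (64 * 10 ^ 6 * δ ^ 2 / c ^ 4) := by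
  let E : ℕ → ℕ → Set Ω := fun n k => {ω | c / 10 * (9 / 10) ^ n ≤
    |B (k * (δ / 2 ^ n) + δ / 2 ^ n) ω - B (k * (δ / 2 ^ n)) ω|}
  have hsub : P {ω | ∃ u ∈ Icc (0:ℝ) δ, c < |B u ω|} ≤ P (⋃ n, ⋃ k ∈ Finset.range (2 ^ n), E n k) := by
    apply measure_mono_ae
    filter_upwards [hB.cont, hB.init] with ω h1 h2 h3
    obtain ⟨u, hu, hcu⟩ := h3
    by_contra hcon
    have hcon' : ∀ n k : ℕ, k < 2 ^ n → |B (k * (δ / 2 ^ n) + δ / 2 ^ n) ω - B (k * (δ / 2 ^ n)) ω|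
        ≤ c / 10 * (9 / 10) ^ n := by
      intro n k hk
      by_contra hlt
      push Not at hlt
      apply hcon
      show ω ∈ ⋃ n, ⋃ k ∈ Finset.range (2 ^ n), E n k
      simp only [mem_iUnion]
      exact ⟨n, k, by simpa using hk, hlt.le⟩
    have := chain_det h1 h2 hδ hc.le hcon' u hu
    linarith
  have hE : ∀ n k : ℕ, P (E n k) ≤ ENNReal.ofReal (64 * (δ / 2 ^ n) ^ 2 / (c / 10 * (9 / 10) ^ n) ^ 4) :=
    fun n k => gauss_tail hB (by positivity) (by positivity) (by positivity)
  have hn : ∀ n : ℕ, P (⋃ k ∈ Finset.range (2 ^ n), E n k) ≤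
      ENNReal.ofReal (64 * 10 ^ 4 * δ ^ 2 / c ^ 4 * (8 / 10) ^ n) := by
    intro n
    calc _ ≤ ∑ k ∈ Finset.range (2 ^ n), P (E n k) := measure_biUnion_finset_le _ _
      _ ≤ ∑ k ∈ Finset.range (2 ^ n), ENNReal.ofReal (64 * (δ / 2 ^ n) ^ 2 / (c / 10 * (9 / 10) ^ n) ^ 4) :=
          Finset.sum_le_sum fun k _ => hE n k
      _ = ENNReal.ofReal (2 ^ n * (64 * (δ / 2 ^ n) ^ 2 / (c / 10 * (9 / 10) ^ n) ^ 4)) := by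
          rw [Finset.sum_const, Finset.card_range, nsmul_eq_mul, ENNReal.ofReal_mul (by positivity)]
          congr 1
          rw [ENNReal.ofReal_pow (by norm_num)]
          simp
      _ ≤ _ := by
          apply ENNReal.ofReal_le_ofReal
          have : (2:ℝ) ^ n * (64 * (δ / 2 ^ n) ^ 2 / (c / 10 * (9 / 10) ^ n) ^ 4) =
            64 * 10 ^ 4 * δ ^ 2 / c ^ 4 * ((1/2) ^ n * ((10 / 9) ^ 4) ^ n) := by
            have e : ((10:ℝ) / 9) = (9/10)⁻¹ := by norm_num
            rw [e, ← pow_mul, mul_comm 4 n, pow_mul, inv_pow, one_div, inv_pow]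
            field_simp
          rw [this]
          apply mul_le_mul_of_nonneg_left _ (by positivity)
          rw [← mul_pow]
          apply pow_le_pow_left₀ (by norm_num)
          norm_num
  calc _ ≤ _ := hsub
    _ ≤ ∑' n, P (⋃ k ∈ Finset.range (2 ^ n), E n k) := measure_iUnion_le _
    _ ≤ ∑' n : ℕ, ENNReal.ofReal (64 * 10 ^ 4 * δ ^ 2 / c ^ 4 * (8 / 10) ^ n) := ENNReal.tsum_le_tsum hn
    _ = ENNReal.ofReal (∑' n : ℕ, 64 * 10 ^ 4 * δ ^ 2 / c ^ 4 * (8 / 10) ^ n) := by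
        rw [ENNReal.ofReal_tsum_of_nonneg (fun n => by positivity)]
        exact (summable_geometric_of_lt_one (by norm_num) (by norm_num)).mul_left _
    _ ≤ _ := by
        apply ENNReal.ofReal_le_ofReal
        rw [tsum_mul_left, tsum_geometric_of_lt_one (by norm_num) (by norm_num)]
        have : 0 ≤ δ ^ 2 / c ^ 4 := by positivity
        have e1 : 64 * 10 ^ 4 * δ ^ 2 / c ^ 4 = 64 * 10 ^ 4 * (δ ^ 2 / c ^ 4) := by ring
        have e2 : 64 * 10 ^ 6 * δ ^ 2 / c ^ 4 = 64 * 10 ^ 6 * (δ ^ 2 / c ^ 4) := by ring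
        rw [e1, e2]
        norm_num
        nlinarith

end PartB

open MeasureTheory ProbabilityTheory Filter Real Set Asymptotics
open scoped NNReal ENNReal Topology
set_option linter.all false
set_option linter.deprecated false

section PartC

/-- heat convolution -/
noncomputable def cv (δ : ℝ) (f : ℝ → ℝ≥0∞) (z : ℝ) : ℝ≥0∞ :=
  ∫⁻ y, ENNReal.ofReal (hk δ (z - y)) * f y

lemma cv_meas (δ : ℝ) {f : ℝ → ℝ≥0∞} (hf : Measurable f) : Measurable (cv δ f) := by
  refine Measurable.lintegral_prod_right'
    (f := fun z : ℝ × ℝ => ENNReal.ofReal (hk δ (z.1 - z.2)) * f z.2) ?_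
  exact (hk_meas2 δ).mul (hf.comp measurable_snd)

lemma cv_integral {δ : ℝ} (hδ : 0 < δ) {f : ℝ → ℝ≥0∞} (hf : Measurable f) :
    ∫⁻ z, cv δ f z = ∫⁻ y, f y := by
  unfold cv
  rw [lintegral_lintegral_swap]
  · congr 1; ext y
    rw [lintegral_mul_const _ (hk_meas_left δ y), hk_integral' hδ, one_mul]
  · exact ((hk_meas2 δ).mul (hf.comp measurable_snd)).aemeasurable

lemma cv_cv {τ δ : ℝ} (hτ : 0 < τ) (hδ : 0 < δ) {f : ℝ → ℝ≥0∞} (hf : Measurable f) (x : ℝ) :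
    cv τ (cv δ f) x = cv (τ + δ) f x := by
  unfold cv
  have h1 : ∀ z, ENNReal.ofReal (hk τ (x - z)) * ∫⁻ y, ENNReal.ofReal (hk δ (z - y)) * f y =
      ∫⁻ y, ENNReal.ofReal (hk τ (x - z)) * (ENNReal.ofReal (hk δ (z - y)) * f y) := fun z =>
    (lintegral_const_mul _ ((hk_meas_right δ z).mul hf)).symm
  simp_rw [h1]
  rw [lintegral_lintegral_swap]
  · congr 1; ext y
    simp_rw [← mul_assoc]
    have h2 : Measurable (fun z => ENNReal.ofReal (hk τ (x - z)) * ENNReal.ofReal (hk δ (z - y))) :=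
      (hk_meas_right τ x).mul (hk_meas_left δ y)
    rw [lintegral_mul_const _ h2, hk_semigroup hτ hδ]
  · refine Measurable.aemeasurable ?_
    refine ((hk_meas_right τ x).comp measurable_fst).mul ?_
    exact (hk_meas2 δ).mul (hf.comp measurable_snd)

lemma cv_le {δ : ℝ} (hδ : 0 < δ) {f : ℝ → ℝ≥0∞} {C : ℝ≥0∞} (hC : ∀ x, f x ≤ C) (z : ℝ) :
    cv δ f z ≤ C := by
  unfold cv
  calc _ ≤ ∫⁻ y, ENNReal.ofReal (hk δ (z - y)) * C := by
        apply lintegral_mono; intro y; exact mul_le_mul_right (hC y) _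
    _ = C := by rw [lintegral_mul_const _ (hk_meas_right δ z), hk_integral hδ, one_mul]

/-- defect -/
noncomputable def kap (H : ℝ → ℝ → ℝ≥0∞) (s δ z : ℝ) : ℝ≥0∞ :=
  cv δ (fun y => H y s) z - H z (s + δ)

/-- abstract killed heat flow -/
structure KD (m : ℝ → ℝ) (H : ℝ → ℝ → ℝ≥0∞) : Prop where
  bdd : ∃ C : ℝ≥0, ∀ x t, H x t ≤ C
  meas : ∀ t, Measurable fun x => H x t
  integ : ∫⁻ x, H x 0 ≠ ∞
  zero : ∀ t ≥ 0, ∀ x ≤ m t, H x t = 0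
  super : ∀ s ≥ 0, ∀ δ > 0, ∀ z, H z (s + δ) ≤ cv δ (fun y => H y s) z
  conc : ∀ ε > 0, ∀ S > 0, ∀ θ > 0, ∃ δ0 > 0, ∀ s ∈ Icc (0:ℝ) S, ∀ δ ∈ Ioc (0:ℝ) δ0,
    (∀ z, ε < |z - m s| → kap H s δ z ≤ ENNReal.ofReal (θ * δ)) ∧
    ∫⁻ z in {z | ε < |z - m s|}, kap H s δ z ≤ ENNReal.ofReal (θ * δ)

variable {Ω : Type*} [MeasurableSpace Ω] {P : Measure Ω} [IsProbabilityMeasure P]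
  {B : ℝ → Ω → ℝ}

lemma Hf_KD (hB : IsBrownianMotion P B) {m : ℝ → ℝ} (hm : Continuous m) {f0 : ℝ → ℝ≥0∞}
    (hf0 : Measurable f0) {C : ℝ≥0} (hC : ∀ x, f0 x ≤ C)
    (hinteg : ∫⁻ x in Ioi (m 0), f0 x ≠ ∞) :
    KD m (Hf P B m f0) ∧ ∀ x, Hf P B m f0 x 0 = (Ioi (m 0)).indicator f0 x := by
  have hH0 : ∀ x, Hf P B m f0 x 0 = (Ioi (m 0)).indicator f0 x := by
    intro x
    have : Hf P B m f0 x 0 = ∫⁻ ω, (Ioi (m 0)).indicator f0 x ∂P := by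
      unfold Hf
      apply lintegral_congr_ae
      filter_upwards [bpath_cont hB, hB.init] with ω h1 h2
      have h3 : bpath B ω 0 = 0 := by simp [bpath, h2]
      unfold Gf
      by_cases hx : m 0 < x
      · rw [indicator_of_mem (show x ∈ Ioi (m 0) from hx), indicator_of_mem]
        · simp [h3]
        · rw [Svv_iff (by fun_prop) le_rfl h1]
          intro s hs
          have : s = 0 := le_antisymm hs.2 hs.1
          subst this
          simpa [h3] using hx
      · rw [indicator_of_notMem (show x ∉ Ioi (m 0) from hx), indicator_of_notMem]
        rw [Svv_iff (by fun_prop) le_rfl h1]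
        intro h
        have := h 0 (by simp)
        simp [h3] at this
        exact hx this
    rw [this]; simp
  have hzero : ∀ t ≥ 0, ∀ x ≤ m t, Hf P B m f0 x t = 0 := by
    intro t ht x hx
    have : Hf P B m f0 x t = ∫⁻ ω, 0 ∂P := by
      unfold Hf
      apply lintegral_congr_ae
      filter_upwards [bpath_cont hB, hB.init] with ω h1 h2
      have h3 : bpath B ω 0 = 0 := by simp [bpath, h2]
      unfold Gf
      rw [indicator_of_notMem]
      rw [Svv_iff (by fun_prop) ht h1]
      intro h
      have := h 0 ⟨le_rfl, ht⟩
      simp [h3] at this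
      linarith
    rw [this]; simp
  have hmeas : ∀ t, Measurable fun x => Hf P B m f0 x t := fun t => Hf_meas hB hf0 t
  have hbdd : ∀ x t, Hf P B m f0 x t ≤ C := fun x t => Hf_le hC x t
  have hsuper : ∀ s ≥ 0, ∀ δ > 0, ∀ z, Hf P B m f0 z (s + δ) ≤ cv δ (fun y => Hf P B m f0 y s) z := by
    intro s hs δ hδ z
    rw [Hf_markov hB hm hf0 z hs hδ.le]
    unfold cv
    rw [← bm_expect hB hδ (hmeas s)]
    apply lintegral_mono
    intro ω
    exact indicator_le_self' (fun _ _ => zero_le) _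
  have hint0 : ∫⁻ x, Hf P B m f0 x 0 = ∫⁻ x in Ioi (m 0), f0 x := by
    simp_rw [hH0]
    rw [lintegral_indicator measurableSet_Ioi]
  have hG : ∀ s ≥ 0, ∫⁻ x, Hf P B m f0 x s ≤ ∫⁻ x, Hf P B m f0 x 0 := by
    intro s hs
    rcases hs.eq_or_lt with h | h
    · rw [← h]
    · have := lintegral_mono (μ := volume) (hsuper 0 le_rfl s h)
      rwa [cv_integral h (hmeas 0), zero_add] at this
  refine ⟨⟨⟨C, hbdd⟩, hmeas, by rw [hint0]; exact hinteg, hzero, hsuper, ?_⟩, hH0⟩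
  intro ε hε S hS θ hθ
  -- modulus of continuity
  obtain ⟨δ1, hδ1, hmod⟩ : ∃ δ1 > 0, ∀ s ∈ Icc (0:ℝ) S, ∀ v, 0 ≤ v → v ≤ δ1 → |m (s + v) - m s| ≤ ε / 2 := by
    have huc := (isCompact_Icc (a := (0:ℝ)) (b := S + 1)).uniformContinuousOn_of_continuous
      hm.continuousOn
    rw [Metric.uniformContinuousOn_iff] at huc
    obtain ⟨d, hd, h⟩ := huc (ε / 2) (by positivity)
    refine ⟨min (d / 2) 1, by positivity, fun s hs v hv hv2 => ?_⟩
    have h1 := min_le_left (d / 2) 1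
    have h2 := min_le_right (d / 2) 1
    have := h (s + v) ⟨by linarith [hs.1], by linarith [hs.2]⟩ s ⟨hs.1, by linarith [hs.2]⟩
      (by rw [Real.dist_eq]; rw [show s + v - s = v by ring, abs_of_nonneg hv]; linarith)
    rw [Real.dist_eq] at this
    exact this.le
  set G0 : ℝ := (∫⁻ x, Hf P B m f0 x 0).toReal with hG0
  have hG0e : ∫⁻ x, Hf P B m f0 x 0 = ENNReal.ofReal G0 := by
    rw [hG0, ENNReal.ofReal_toReal]; rw [hint0]; exact hinteg
  have hG0nn : 0 ≤ G0 := ENNReal.toReal_nonneg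
  set K : ℝ := 64 * 10 ^ 6 / (ε / 2) ^ 4 * (C + G0 + 1) with hK
  have hKpos : 0 < K := by positivity
  refine ⟨min δ1 (θ / K), by positivity, ?_⟩
  intro s hs δ hδ
  have hδ0 : 0 < δ := hδ.1
  have hδa : δ ≤ δ1 := hδ.2.trans (min_le_left _ _)
  have hδb : K * δ ≤ θ := by
    have := hδ.2.trans (min_le_right _ _)
    rwa [le_div_iff₀ hKpos, mul_comm] at this
  set E : Set Ω := toMeasurable P {ω | ∃ u ∈ Icc (0:ℝ) δ, ε / 2 < |B u ω|} with hE
  have hEm : MeasurableSet E := measurableSet_toMeasurable _ _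
  have hEsub : {ω | ∃ u ∈ Icc (0:ℝ) δ, ε / 2 < |B u ω|} ⊆ E := subset_toMeasurable _ _
  have hPE : P E ≤ ENNReal.ofReal (64 * 10 ^ 6 * δ ^ 2 / (ε / 2) ^ 4) := by
    rw [hE, measure_toMeasurable]
    exact max_ineq hB hδ0 (by positivity)
  have hkey : ∀ z, ε < |z - m s| → kap (Hf P B m f0) s δ z ≤
      ∫⁻ ω, E.indicator (fun ω => Hf P B m f0 (z + B δ ω) s) ω ∂P := by
    intro z hz
    unfold kap
    rw [tsub_le_iff_left]
    rw [Hf_markov hB hm hf0 z hs.1 hδ0.le]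
    have hmz : Measurable (fun ω => Hf P B m f0 (z + B δ ω) s) :=
      (hmeas s).comp (measurable_const.add (hB.meas _))
    rw [← lintegral_add_right _ (hmz.indicator hEm)]
    unfold cv
    rw [← bm_expect hB hδ0 (hmeas s)]
    apply lintegral_mono
    intro ω
    simp only
    by_cases hωE : ω ∈ E
    · rw [indicator_of_mem hωE]
      exact le_add_self
    · have hno : ∀ u ∈ Icc (0:ℝ) δ, |B u ω| ≤ ε / 2 := by
        intro u hu
        by_contra hcon
        push Not at hcon
        exact hωE (hEsub ⟨u, hu, hcon⟩)
      rcases lt_abs.1 hz with h | h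
      · rw [indicator_of_mem (show ω ∈ {ω | ∀ u ∈ Icc (0:ℝ) δ, m (s + δ - u) < z + bpath B ω u} from ?_)]
        · exact le_self_add
        · intro u hu
          have h1 := (abs_le.1 (hno u hu)).1
          have h2 := (abs_le.1 (hmod s hs (δ - u) (by linarith [hu.2]) (by linarith [hu.1]))).2
          rw [show s + (δ - u) = s + δ - u by ring] at h2
          simp only [bpath, max_eq_left hu.1]
          linarith
      · have h1 := (abs_le.1 (hno δ ⟨hδ0.le, le_rfl⟩)).2
        rw [hzero s hs.1 (z + B δ ω) (by linarith)]
        exact zero_le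
  constructor
  · intro z hz
    refine (hkey z hz).trans ?_
    calc _ ≤ ∫⁻ ω, E.indicator (fun _ => (C : ℝ≥0∞)) ω ∂P := by
            apply lintegral_mono; intro ω
            exact indicator_le_indicator (hbdd _ _)
      _ = C * P E := by rw [lintegral_indicator hEm]; simp
      _ ≤ C * ENNReal.ofReal (64 * 10 ^ 6 * δ ^ 2 / (ε / 2) ^ 4) := mul_le_mul_right hPE _
      _ = ENNReal.ofReal (C * (64 * 10 ^ 6 * δ ^ 2 / (ε / 2) ^ 4)) := by
          rw [ENNReal.ofReal_mul (by positivity)]; simp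
      _ ≤ _ := by
          apply ENNReal.ofReal_le_ofReal
          have h1 : (C:ℝ) * (64 * 10 ^ 6 * δ ^ 2 / (ε / 2) ^ 4) =
            64 * 10 ^ 6 / (ε / 2) ^ 4 * C * δ * δ := by ring
          rw [h1]
          apply mul_le_mul_of_nonneg_right _ hδ0.le
          refine le_trans ?_ hδb
          apply mul_le_mul_of_nonneg_right _ hδ0.le
          rw [hK]
          apply mul_le_mul_of_nonneg_left _ (by positivity)
          linarith
  · have hsetm : MeasurableSet {z | ε < |z - m s|} := by
      apply measurableSet_lt measurable_const
      exact (measurable_id.sub measurable_const).abs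
    have hjm : Measurable (fun z : ℝ × Ω => E.indicator (fun ω => Hf P B m f0 (z.1 + B δ ω) s) z.2) := by
      have h1 : Measurable (fun z : ℝ × Ω => Hf P B m f0 (z.1 + B δ z.2) s) :=
        (hmeas s).comp (measurable_fst.add ((hB.meas _).comp measurable_snd))
      have h2 := h1.indicator (measurable_snd hEm)
      convert h2 using 1
      ext z; simp [indicator]; rfl
    calc _ ≤ ∫⁻ z in {z | ε < |z - m s|},
          ∫⁻ ω, E.indicator (fun ω => Hf P B m f0 (z + B δ ω) s) ω ∂P := by
            apply setLIntegral_mono' hsetm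
            exact hkey
      _ ≤ ∫⁻ z, ∫⁻ ω, E.indicator (fun ω => Hf P B m f0 (z + B δ ω) s) ω ∂P :=
          setLIntegral_le_lintegral _ _
      _ = ∫⁻ ω, (∫⁻ z : ℝ, E.indicator (fun ω => Hf P B m f0 (z + B δ ω) s) ω) ∂P :=
          lintegral_lintegral_swap hjm.aemeasurable
      _ ≤ ∫⁻ ω, E.indicator (fun ω => ENNReal.ofReal G0) ω ∂P := by
          apply lintegral_mono
          intro ω
          simp only
          by_cases hω : ω ∈ E
          · simp only [indicator_of_mem hω]
            rw [lintegral_add_right_eq_self (fun z => Hf P B m f0 z s)]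
            rw [← hG0e]
            exact hG s hs.1
          · simp [indicator_of_notMem hω]
      _ = ENNReal.ofReal G0 * P E := by rw [lintegral_indicator hEm]; simp
      _ ≤ ENNReal.ofReal G0 * ENNReal.ofReal (64 * 10 ^ 6 * δ ^ 2 / (ε / 2) ^ 4) :=
          mul_le_mul_right hPE _
      _ = ENNReal.ofReal (G0 * (64 * 10 ^ 6 * δ ^ 2 / (ε / 2) ^ 4)) := by
          rw [ENNReal.ofReal_mul (by positivity)]
      _ ≤ _ := by
          apply ENNReal.ofReal_le_ofReal
          have h1 : G0 * (64 * 10 ^ 6 * δ ^ 2 / (ε / 2) ^ 4) =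
            64 * 10 ^ 6 / (ε / 2) ^ 4 * G0 * δ * δ := by ring
          rw [h1]
          apply mul_le_mul_of_nonneg_right _ hδ0.le
          refine le_trans ?_ hδb
          apply mul_le_mul_of_nonneg_right _ hδ0.le
          rw [hK]
          apply mul_le_mul_of_nonneg_left _ (by positivity)
          have : (0:ℝ) ≤ C := C.2
          linarith

end PartC

open MeasureTheory ProbabilityTheory Filter Real Set Asymptotics
open scoped NNReal ENNReal Topology
set_option linter.all false
set_option linter.deprecated false

section PartD

lemma telescope {D F : ℝ → ℝ} {s0 s1 δ0 : ℝ} (h01 : s0 ≤ s1) (hδ0 : 0 < δ0)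
    (h : ∀ s δ, s0 ≤ s → s + δ ≤ s1 → 0 < δ → δ ≤ δ0 → |D (s + δ) - D s| ≤ F (s + δ) - F s) :
    |D s1 - D s0| ≤ F s1 - F s0 := by
  rcases h01.eq_or_lt with rfl | hlt
  · simp
  obtain ⟨n, hn⟩ := exists_nat_gt ((s1 - s0) / δ0)
  have hd : 0 < s1 - s0 := by linarith
  have hnpos : (0:ℝ) < n := lt_of_le_of_lt (by positivity) hn
  set e := (s1 - s0) / n with he
  have hepos : 0 < e := by positivity
  have hele : e ≤ δ0 := by
    rw [he, div_le_iff₀ hnpos]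
    rw [div_lt_iff₀ hδ0] at hn
    linarith
  have hne : n * e = s1 - s0 := by rw [he]; field_simp
  have key : ∀ k : ℕ, k ≤ n → |D (s0 + k * e) - D s0| ≤ F (s0 + k * e) - F s0 := by
    intro k
    induction k with
    | zero => simp
    | succ k ih =>
      intro hk
      have h1 := ih (by omega)
      have hkr : ((k:ℝ) + 1) ≤ n := by exact_mod_cast hk
      have h2 := h (s0 + k * e) e (by have : (0:ℝ) ≤ k * e := by positivity
                                      linarith) (by nlinarith) hepos hele
      have e1 : s0 + ((k + 1 : ℕ) : ℝ) * e = s0 + k * e + e := by push_cast; ring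
      rw [e1]
      have := abs_sub_le (D (s0 + k * e + e)) (D (s0 + k * e)) (D s0)
      linarith
  have := key n le_rfl
  rwa [hne, show s0 + (s1 - s0) = s1 by ring] at this

variable {m : ℝ → ℝ} {H : ℝ → ℝ → ℝ≥0∞}

lemma KD.kap_meas (h : KD m H) (s δ : ℝ) : Measurable (kap H s δ) :=
  (cv_meas δ (h.meas s)).sub (h.meas _)

lemma KD.add_kap (h : KD m H) {s δ : ℝ} (hs : 0 ≤ s) (hδ : 0 < δ) (z : ℝ) :
    H z (s + δ) + kap H s δ z = cv δ (fun y => H y s) z :=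
  add_tsub_cancel_of_le (h.super s hs δ hδ z)

/-- total mass -/
noncomputable def Gm (H : ℝ → ℝ → ℝ≥0∞) (s : ℝ) : ℝ≥0∞ := ∫⁻ x, H x s

lemma KD.Gm_add (h : KD m H) {s δ : ℝ} (hs : 0 ≤ s) (hδ : 0 < δ) :
    Gm H (s + δ) + ∫⁻ z, kap H s δ z = Gm H s := by
  unfold Gm
  rw [← lintegral_add_left (h.meas _)]
  simp_rw [h.add_kap hs hδ]
  exact cv_integral hδ (h.meas s)

lemma KD.Gm_anti (h : KD m H) {s t : ℝ} (hs : 0 ≤ s) (hst : s ≤ t) : Gm H t ≤ Gm H s := by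
  rcases hst.eq_or_lt with rfl | hlt
  · exact le_rfl
  · have := h.Gm_add hs (sub_pos.2 hlt)
    rw [show s + (t - s) = t by ring] at this
    rw [← this]; exact le_self_add

lemma KD.Gm_ne_top (h : KD m H) {s : ℝ} (hs : 0 ≤ s) : Gm H s ≠ ∞ :=
  ne_top_of_le_ne_top h.integ (h.Gm_anti le_rfl hs)

lemma KD.kap_integral (h : KD m H) {s δ : ℝ} (hs : 0 ≤ s) (hδ : 0 < δ) :
    ∫⁻ z, kap H s δ z = ENNReal.ofReal ((Gm H s).toReal - (Gm H (s + δ)).toReal) := by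
  have h1 := h.Gm_add hs hδ
  have h2 := h.Gm_ne_top (show 0 ≤ s + δ by linarith)
  have h3 : ∫⁻ z, kap H s δ z ≠ ∞ := by
    refine ne_top_of_le_ne_top (h.Gm_ne_top hs) ?_
    rw [← h1]; exact le_add_self
  rw [← h1, ENNReal.toReal_add h2 h3, add_sub_cancel_left, ENNReal.ofReal_toReal h3]

lemma KD.kap_near (h : KD m H) : ∃ C : ℝ≥0, ∀ s ≥ 0, ∀ δ > 0, ∀ ε > 0,
    ∫⁻ z, kap H s δ z ≤ ENNReal.ofReal (2 * ε * C) + ∫⁻ z in {z | ε < |z - m s|}, kap H s δ z := by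
  obtain ⟨C, hC⟩ := h.bdd
  refine ⟨C, fun s hs δ hδ ε hε => ?_⟩
  have hsetm : MeasurableSet {z | ε < |z - m s|} :=
    measurableSet_lt measurable_const (measurable_id.sub measurable_const).abs
  rw [← lintegral_add_compl _ hsetm, add_comm]
  gcongr
  have hsub : {z | ε < |z - m s|}ᶜ ⊆ Icc (m s - ε) (m s + ε) := by
    intro z hz
    simp only [mem_compl_iff, mem_setOf_eq, not_lt, abs_le] at hz
    exact ⟨by linarith, by linarith⟩
  calc _ ≤ ∫⁻ z in Icc (m s - ε) (m s + ε), kap H s δ z := lintegral_mono_set hsub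
    _ ≤ ∫⁻ z in Icc (m s - ε) (m s + ε), C := by
        apply lintegral_mono
        intro z
        exact tsub_le_self.trans (cv_le hδ (fun y => hC y s) z)
    _ = _ := by
        rw [setLIntegral_const, Real.volume_Icc, ENNReal.ofReal_mul (by positivity), mul_comm]
        congr 1
        · congr 1; ring
        · simp

/-- Stieltjes function of the flux -/
noncomputable def KD.stf (h : KD m H) : StieltjesFunction ℝ where
  toFun s := -(Gm H (max s 0)).toReal
  mono' := by
    intro s t hst
    simp only [neg_le_neg_iff]
    apply ENNReal.toReal_mono (h.Gm_ne_top (le_max_right _ _))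
    exact h.Gm_anti (le_max_right _ _) (max_le_max hst le_rfl)
  right_continuous' := by
    intro s
    have hcont : ContinuousWithinAt (fun s => -(Gm H s).toReal) (Ici (max s 0)) (max s 0) := by
      set a := max s 0 with ha
      have ha0 : 0 ≤ a := le_max_right _ _
      obtain ⟨C, hC⟩ := h.kap_near
      rw [Metric.continuousWithinAt_iff]
      intro ε hε
      set e1 := ε / (8 * (C + 1)) with he1
      have he1p : 0 < e1 := by positivity
      obtain ⟨δ0, hδ0, hc⟩ := h.conc e1 he1p (a + 1) (by positivity) 1 one_pos
      refine ⟨min δ0 (ε / 4), by positivity, ?_⟩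
      intro v hv hdist
      rcases (show a ≤ v from hv).eq_or_lt with rfl | hlt
      · simpa using hε
      rw [Real.dist_eq, abs_of_pos (by linarith)] at hdist
      have hd1 := hdist.trans_le (min_le_left _ _)
      have hd2 := hdist.trans_le (min_le_right _ _)
      have h1 := (hC a ha0 (v - a) (by linarith) e1 he1p).trans
        (add_le_add_right (hc a ⟨ha0, by linarith⟩ (v - a) ⟨by linarith, hd1.le⟩).2 _)
      rw [h.kap_integral ha0 (by linarith), show a + (v - a) = v by ring,
        ← ENNReal.ofReal_add (by positivity) (by linarith),
        ENNReal.ofReal_le_ofReal_iff (by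
          have : 0 ≤ 2 * e1 * (C:ℝ) := by positivity
          linarith)] at h1
      have hmono : (Gm H v).toReal ≤ (Gm H a).toReal :=
        ENNReal.toReal_mono (h.Gm_ne_top ha0) (h.Gm_anti ha0 hlt.le)
      have h2 : 2 * e1 * (C:ℝ) ≤ ε / 4 := by
        rw [he1]
        have : (0:ℝ) ≤ C := C.2
        have h3 : 2 * (ε / (8 * ((C:ℝ) + 1))) * C = ε / 4 * (C / (C + 1)) := by field_simp; ring
        rw [h3]
        have h4 : (C:ℝ) / (C + 1) ≤ 1 := by rw [div_le_one (by positivity)]; linarith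
        nlinarith
      rw [Real.dist_eq, show -(Gm H v).toReal - -(Gm H a).toReal = (Gm H a).toReal - (Gm H v).toReal by ring,
        abs_of_nonneg (by linarith)]
      linarith
    have hmax : ContinuousWithinAt (fun s => max s (0:ℝ)) (Ici s) s :=
      (continuous_id.max continuous_const).continuousWithinAt
    exact hcont.comp (f := fun s => max s (0:ℝ)) hmax (fun v hv => show max s 0 ≤ max v 0 from max_le_max hv le_rfl)

/-- flux measure -/
noncomputable def KD.Jm (h : KD m H) : Measure ℝ := h.stf.measure

instance (h : KD m H) : IsLocallyFiniteMeasure h.Jm := by unfold KD.Jm; infer_instance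

instance (h : KD m H) : SFinite h.Jm := by unfold KD.Jm; infer_instance

lemma KD.Jm_Ioc (h : KD m H) {s δ : ℝ} (hs : 0 ≤ s) (hδ : 0 < δ) :
    h.Jm (Ioc s (s + δ)) = ∫⁻ z, kap H s δ z := by
  rw [h.kap_integral hs hδ]
  unfold KD.Jm
  rw [StieltjesFunction.measure_Ioc]
  congr 1
  show -(Gm H (max (s + δ) 0)).toReal - -(Gm H (max s 0)).toReal = _
  rw [max_eq_left hs, max_eq_left (by linarith)]
  ring

lemma hk_joint_cont {t X : ℝ} {S : Set (ℝ × ℝ)} (hS : ∀ z ∈ S, z.1 < t) :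
    ContinuousOn (fun z : ℝ × ℝ => hk (t - z.1) (X - z.2)) S := by
  unfold hk
  have h1 : ∀ z ∈ S, 4 * (t - z.1) ≠ 0 := fun z hz => by have := hS z hz; linarith
  have h2 : ∀ z ∈ S, √(4 * π * (t - z.1)) ≠ 0 := fun z hz => by
    have := hS z hz
    have : 0 < t - z.1 := by linarith
    positivity
  apply ContinuousOn.mul
  · apply ContinuousOn.inv₀ (by fun_prop) h2
  · apply Continuous.comp_continuousOn Real.continuous_exp
    exact ContinuousOn.div (by fun_prop) (by fun_prop) h1

lemma KD.local_est (h : KD m H) (hm : Continuous m) (X : ℝ) {t s0 s1 : ℝ} (hs0 : 0 ≤ s0) (h01 : s0 ≤ s1)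
    (h1t : s1 < t) {e : ℝ} (he : 0 < e) : ∃ δ0 > 0, ∀ s δ, s0 ≤ s → s + δ ≤ s1 → 0 < δ → δ ≤ δ0 →
    (∫⁻ z, ENNReal.ofReal (hk (t - (s + δ)) (X - z)) * kap H s δ z ≤
      ∫⁻ u in Ioc s (s + δ), ENNReal.ofReal (hk (t - u) (X - m u)) ∂h.Jm +
        (ENNReal.ofReal (2 * e) * h.Jm (Ioc s (s + δ)) + ENNReal.ofReal (e * δ))) ∧
    (∫⁻ u in Ioc s (s + δ), ENNReal.ofReal (hk (t - u) (X - m u)) ∂h.Jm ≤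
      (∫⁻ z, ENNReal.ofReal (hk (t - (s + δ)) (X - z)) * kap H s δ z) +
        (ENNReal.ofReal (2 * e) * h.Jm (Ioc s (s + δ)) + ENNReal.ofReal (e * δ))) := by
  -- bound for m
  obtain ⟨R, hR⟩ : ∃ R, ∀ u ∈ Icc s0 s1, |m u| ≤ R := by
    obtain ⟨R, hR⟩ := (isCompact_Icc (a := s0) (b := s1)).exists_bound_of_continuousOn hm.continuousOn
    exact ⟨R, fun u hu => by simpa using hR u hu⟩
  have hcomp : IsCompact (Icc s0 s1 ×ˢ Icc (-(R + 1)) (R + 1)) := isCompact_Icc.prod isCompact_Icc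
  have huc := hcomp.uniformContinuousOn_of_continuous
    (hk_joint_cont (t := t) (X := X) (fun z hz => lt_of_le_of_lt hz.1.2 h1t))
  rw [Metric.uniformContinuousOn_iff] at huc
  obtain ⟨d, hd, hφ⟩ := huc e he
  have hmuc := (isCompact_Icc (a := s0) (b := s1)).uniformContinuousOn_of_continuous hm.continuousOn
  rw [Metric.uniformContinuousOn_iff] at hmuc
  obtain ⟨d1, hd1, hmd⟩ := hmuc (min (d / 4) (1/2)) (by positivity)
  set ρ := min (d / 4) (1 / 2) with hρ
  have hρp : 0 < ρ := by positivity
  set Mx := (√(4 * π * (t - s1)))⁻¹ with hMx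
  have hMxp : 0 < Mx := by
    have : 0 < t - s1 := by linarith
    positivity
  have hhkle : ∀ u ≤ s1, ∀ z, hk (t - u) z ≤ Mx := by
    intro u hu z
    refine (hk_le (by linarith) z).trans ?_
    apply inv_anti₀
    · have : 0 < t - s1 := by linarith
      positivity
    · apply Real.sqrt_le_sqrt
      have : 0 < 4 * π := by positivity
      nlinarith
  obtain ⟨δc, hδc, hconc⟩ := h.conc ρ hρp (s1 + 1) (by linarith) (e / Mx) (by positivity)
  refine ⟨min (min (d1 / 2) (d / 4)) δc, by positivity, ?_⟩
  intro s δ hs hsδ hδ hδle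
  have hδ1 : δ ≤ d1 / 2 := hδle.trans ((min_le_left _ _).trans (min_le_left _ _))
  have hδ2 : δ ≤ d / 4 := hδle.trans ((min_le_left _ _).trans (min_le_right _ _))
  have hδ3 : δ ≤ δc := hδle.trans (min_le_right _ _)
  have hfar := (hconc s ⟨by linarith, by linarith⟩ δ ⟨hδ, hδ3⟩).2
  set far := {z | ρ < |z - m s|} with hfardef
  have hfarm : MeasurableSet far :=
    measurableSet_lt measurable_const (measurable_id.sub measurable_const).abs
  set φs := hk (t - (s + δ)) (X - m (s + δ)) with hφs
  have hφs0 : 0 ≤ φs := hk_nonneg _ _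
  have hρd : ρ ≤ d / 4 := min_le_left _ _
  have hρ1 : ρ ≤ 1 / 2 := min_le_right _ _
  have hmem : ∀ u ∈ Icc s (s + δ), u ∈ Icc s0 s1 := fun u hu => ⟨by linarith [hu.1], by linarith [hu.2]⟩
  have hmclose : ∀ u ∈ Icc s (s + δ), ∀ v ∈ Icc s (s + δ), |m u - m v| < ρ := by
    intro u hu v hv
    have := hmd u (hmem u hu) v (hmem v hv) (by
      rw [Real.dist_eq, abs_lt]
      constructor <;> linarith [hu.1, hu.2, hv.1, hv.2])
    rwa [Real.dist_eq] at this
  have hsm : s ∈ Icc s (s + δ) := ⟨le_rfl, by linarith⟩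
  have hsδm : s + δ ∈ Icc s (s + δ) := ⟨by linarith, le_rfl⟩
  -- near values
  have hnear : ∀ z, z ∉ far → |hk (t - (s + δ)) (X - z) - φs| < e := by
    intro z hz
    simp only [hfardef, mem_setOf_eq, not_lt] at hz
    have h1 := hmclose s hsm (s + δ) hsδm
    have h2 := hR s (hmem s hsm)
    have h3 := hR (s + δ) (hmem _ hsδm)
    rw [abs_le] at hz h2 h3
    rw [abs_lt] at h1
    have := hφ (s + δ, z) ⟨hmem _ hsδm, ⟨by simp only; linarith, by simp only; linarith⟩⟩
      (s + δ, m (s + δ)) ⟨hmem _ hsδm, ⟨by simp only; linarith, by simp only; linarith⟩⟩ (by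
        rw [Prod.dist_eq, Real.dist_eq, Real.dist_eq]
        simp only [sub_self, abs_zero]
        rw [max_lt_iff]
        refine ⟨hd, ?_⟩
        rw [abs_lt]; constructor <;> linarith)
    rwa [Real.dist_eq] at this
  have hbd : ∀ u ∈ Ioc s (s + δ), |hk (t - u) (X - m u) - φs| < e := by
    intro u hu'
    have hu : u ∈ Icc s (s + δ) := Ioc_subset_Icc_self hu'
    have h1 := hmclose u hu (s + δ) hsδm
    have h2 := hR u (hmem u hu)
    have h3 := hR (s + δ) (hmem _ hsδm)
    rw [abs_le] at h2 h3
    rw [abs_lt] at h1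
    have := hφ (u, m u) ⟨hmem _ hu, ⟨by simp only; linarith, by simp only; linarith⟩⟩
      (s + δ, m (s + δ)) ⟨hmem _ hsδm, ⟨by simp only; linarith, by simp only; linarith⟩⟩ (by
        rw [Prod.dist_eq, Real.dist_eq, Real.dist_eq]
        simp only
        rw [max_lt_iff, abs_lt, abs_lt]
        constructor <;> constructor <;> linarith [hu.1, hu.2])
    rwa [Real.dist_eq] at this
  set j := h.Jm (Ioc s (s + δ)) with hj
  have hjk : j = ∫⁻ z, kap H s δ z := h.Jm_Ioc (by linarith) hδ
  have hkm := h.kap_meas s δ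
  have hfar2 : ENNReal.ofReal Mx * ∫⁻ z in far, kap H s δ z ≤ ENNReal.ofReal (e * δ) := by
    calc _ ≤ ENNReal.ofReal Mx * ENNReal.ofReal (e / Mx * δ) := mul_le_mul_right hfar _
      _ = _ := by
        rw [← ENNReal.ofReal_mul hMxp.le]; congr 1; field_simp
  have hA1 : ∫⁻ z, ENNReal.ofReal (hk (t - (s + δ)) (X - z)) * kap H s δ z ≤
      ENNReal.ofReal (φs + e) * j + ENNReal.ofReal (e * δ) := by
    rw [← lintegral_add_compl _ hfarm, add_comm]
    gcongr
    · calc _ ≤ ∫⁻ z in farᶜ, ENNReal.ofReal (φs + e) * kap H s δ z := by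
            apply setLIntegral_mono' hfarm.compl
            intro z hz
            gcongr
            have := (abs_lt.1 (hnear z hz)).2
            linarith
        _ ≤ ∫⁻ z, ENNReal.ofReal (φs + e) * kap H s δ z := setLIntegral_le_lintegral _ _
        _ = _ := by rw [lintegral_const_mul _ hkm, hjk]
    · calc _ ≤ ∫⁻ z in far, ENNReal.ofReal Mx * kap H s δ z := by
            apply lintegral_mono
            intro z
            simp only
            gcongr
            exact hhkle _ hsδ _
        _ = ENNReal.ofReal Mx * ∫⁻ z in far, kap H s δ z := lintegral_const_mul _ hkm
        _ ≤ _ := hfar2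
  have hA2 : ENNReal.ofReal φs * j ≤ (∫⁻ z, ENNReal.ofReal (hk (t - (s + δ)) (X - z)) * kap H s δ z) +
      ENNReal.ofReal e * j + ENNReal.ofReal (e * δ) := by
    rw [hjk, ← lintegral_const_mul _ hkm, ← lintegral_add_compl _ hfarm, add_comm]
    gcongr
    · have hm3 : Measurable (fun z => ENNReal.ofReal (hk (t - (s + δ)) (X - z)) * kap H s δ z) :=
        (hk_meas_right _ X).mul hkm
      rw [← lintegral_const_mul _ hkm, ← lintegral_add_left hm3]
      calc _ ≤ ∫⁻ z in farᶜ, (ENNReal.ofReal (hk (t - (s + δ)) (X - z)) * kap H s δ z +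
            ENNReal.ofReal e * kap H s δ z) := by
            apply setLIntegral_mono' hfarm.compl
            intro z hz
            rw [← add_mul, ← ENNReal.ofReal_add (hk_nonneg _ _) he.le]
            gcongr
            have := (abs_lt.1 (hnear z hz)).1
            linarith
        _ ≤ _ := setLIntegral_le_lintegral _ _
    · calc _ ≤ ∫⁻ z in far, ENNReal.ofReal Mx * kap H s δ z := by
            apply lintegral_mono
            intro z
            simp only
            gcongr
            exact hhkle _ hsδ _
        _ = ENNReal.ofReal Mx * ∫⁻ z in far, kap H s δ z := lintegral_const_mul _ hkm
        _ ≤ _ := hfar2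
  have hB1 : ∫⁻ u in Ioc s (s + δ), ENNReal.ofReal (hk (t - u) (X - m u)) ∂h.Jm ≤
      ENNReal.ofReal (φs + e) * j := by
    calc _ ≤ ∫⁻ u in Ioc s (s + δ), ENNReal.ofReal (φs + e) ∂h.Jm := by
          apply setLIntegral_mono' measurableSet_Ioc
          intro u hu
          gcongr
          have := (abs_lt.1 (hbd u hu)).2
          linarith
      _ = _ := by rw [setLIntegral_const]
  have hB2 : ENNReal.ofReal φs * j ≤ ∫⁻ u in Ioc s (s + δ), ENNReal.ofReal (hk (t - u) (X - m u)) ∂h.Jm +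
      ENNReal.ofReal e * j := by
    calc _ = ∫⁻ u in Ioc s (s + δ), ENNReal.ofReal φs ∂h.Jm := by rw [setLIntegral_const]
      _ ≤ ∫⁻ u in Ioc s (s + δ), (ENNReal.ofReal (hk (t - u) (X - m u)) + ENNReal.ofReal e) ∂h.Jm := by
          apply setLIntegral_mono' measurableSet_Ioc
          intro u hu
          rw [← ENNReal.ofReal_add (hk_nonneg _ _) he.le]
          gcongr
          have := (abs_lt.1 (hbd u hu)).1
          linarith
      _ = _ := by
          rw [lintegral_add_right _ measurable_const, setLIntegral_const]
  have h2e : ENNReal.ofReal (2 * e) * j = ENNReal.ofReal e * j + ENNReal.ofReal e * j := by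
    rw [← add_mul, ← ENNReal.ofReal_add he.le he.le]; congr 2; ring
  have hsplit : ENNReal.ofReal (φs + e) * j = ENNReal.ofReal φs * j + ENNReal.ofReal e * j := by
    rw [ENNReal.ofReal_add hφs0 he.le, add_mul]
  constructor
  · refine hA1.trans ?_
    rw [hsplit, h2e]
    calc _ ≤ (∫⁻ u in Ioc s (s + δ), ENNReal.ofReal (hk (t - u) (X - m u)) ∂h.Jm +
      ENNReal.ofReal e * j) + ENNReal.ofReal e * j + ENNReal.ofReal (e * δ) := by gcongr
      _ = _ := by ring
  · refine hB1.trans ?_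
    rw [hsplit, h2e]
    calc _ ≤ ((∫⁻ z, ENNReal.ofReal (hk (t - (s + δ)) (X - z)) * kap H s δ z) +
      ENNReal.ofReal e * j + ENNReal.ofReal (e * δ)) + ENNReal.ofReal e * j := by gcongr
      _ = _ := by ring

end PartD

open MeasureTheory ProbabilityTheory Filter Real Set Asymptotics
open scoped NNReal ENNReal Topology
set_option linter.all false
set_option linter.deprecated false

section PartE
variable {m : ℝ → ℝ} {H : ℝ → ℝ → ℝ≥0∞}

lemma KD.Jm_Ioc_ne_top (h : KD m H) (s s' : ℝ) : h.Jm (Ioc s s') ≠ ∞ := by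
  unfold KD.Jm
  rw [StieltjesFunction.measure_Ioc]; simp

lemma hk_int_meas (hm : Continuous m) (X t : ℝ) :
    Measurable (fun u => ENNReal.ofReal (hk (t - u) (X - m u))) := by
  apply ENNReal.measurable_ofReal.comp
  unfold hk
  have := hm.measurable
  fun_prop

lemma KD.P1a (h : KD m H) (hm : Continuous m) (X : ℝ) {t s0 s1 : ℝ} (hs0 : 0 ≤ s0) (h01 : s0 ≤ s1)
    (h1t : s1 < t) :
    cv (t - s1) (fun y => H y s1) X + ∫⁻ u in Ioc s0 s1, ENNReal.ofReal (hk (t - u) (X - m u)) ∂h.Jm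
      = cv (t - s0) (fun y => H y s0) X := by
  set Φ : ℝ → ℝ≥0∞ := fun s => cv (t - s) (fun y => H y s) X with hΦ
  set I : ℝ → ℝ≥0∞ := fun s => ∫⁻ u in Ioc s0 s, ENNReal.ofReal (hk (t - u) (X - m u)) ∂h.Jm with hI
  obtain ⟨C, hC⟩ := h.bdd
  have hΦf : ∀ s < t, Φ s ≠ ∞ := by
    intro s hs
    have : Φ s ≤ C := cv_le (by linarith) (fun y => hC y s) X
    exact ne_top_of_le_ne_top (by simp) this
  have hIf : ∀ s < t, I s ≠ ∞ := by
    intro s hs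
    have : I s ≤ ∫⁻ u in Ioc s0 s, ENNReal.ofReal ((√(4 * π * (t - s)))⁻¹) ∂h.Jm := by
      apply setLIntegral_mono' measurableSet_Ioc
      intro u hu
      gcongr
      refine (hk_le (by linarith [hu.2]) _).trans ?_
      apply inv_anti₀
      · have : 0 < t - s := by linarith
        positivity
      · apply Real.sqrt_le_sqrt
        have : 0 < 4 * π := by positivity
        have := hu.2
        nlinarith
    rw [setLIntegral_const] at this
    exact ne_top_of_le_ne_top (ENNReal.mul_ne_top (by simp) (h.Jm_Ioc_ne_top _ _)) this
  have hΦadd : ∀ s δ, 0 ≤ s → 0 < δ → s + δ < t →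
      Φ s = Φ (s + δ) + ∫⁻ z, ENNReal.ofReal (hk (t - (s + δ)) (X - z)) * kap H s δ z := by
    intro s δ hs hδ hst
    have h1 := cv_cv (f := fun y => H y s) (show 0 < t - (s + δ) by linarith) hδ (h.meas s) X
    simp only [hΦ]
    rw [show t - s = t - (s + δ) + δ by ring, ← h1]
    unfold cv
    have hm3 : Measurable (fun z => ENNReal.ofReal (hk (t - (s + δ)) (X - z)) * H z (s + δ)) :=
        (hk_meas_right _ X).mul (h.meas _)
    rw [← lintegral_add_left hm3]
    apply lintegral_congr
    intro z
    rw [← mul_add]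
    congr 1
    exact (h.add_kap hs hδ z).symm
  have hIadd : ∀ s δ, s0 ≤ s → 0 < δ → I (s + δ) = I s +
      ∫⁻ u in Ioc s (s + δ), ENNReal.ofReal (hk (t - u) (X - m u)) ∂h.Jm := by
    intro s δ hs hδ
    simp only [hI]
    rw [← lintegral_union measurableSet_Ioc (Ioc_disjoint_Ioc_of_le le_rfl),
      Ioc_union_Ioc_eq_Ioc hs (by linarith)]
  set D : ℝ → ℝ := fun s => (Φ s).toReal + (I s).toReal with hD
  have key : ∀ e > 0, |D s1 - D s0| ≤ e * (2 * (h.stf s1 - h.stf s0) + (s1 - s0)) := by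
    intro e he
    obtain ⟨δ0, hδ0, hloc⟩ := h.local_est hm X hs0 h01 h1t he
    have := telescope (D := D) (F := fun s => 2 * e * h.stf s + e * s) h01 hδ0 ?_
    · exact this.trans (le_of_eq (by ring))
    intro s δ hs hs1 hδ hδ'
    obtain ⟨hl1, hl2⟩ := hloc s δ hs hs1 hδ hδ'
    have e1 := hΦadd s δ (hs0.trans hs) hδ (by linarith)
    have e2 := hIadd s δ hs hδ
    set K := ∫⁻ z, ENNReal.ofReal (hk (t - (s + δ)) (X - z)) * kap H s δ z
    set i := ∫⁻ u in Ioc s (s + δ), ENNReal.ofReal (hk (t - u) (X - m u)) ∂h.Jm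
    have hKf : K ≠ ∞ := by
      intro hK; rw [hK] at e1; exact hΦf s (by linarith) (by simp [e1])
    have hif : i ≠ ∞ := by
      intro hK; rw [hK] at e2; exact hIf (s+δ) (by linarith) (by simp [e2])
    have hj : h.Jm (Ioc s (s + δ)) = ENNReal.ofReal (h.stf (s + δ) - h.stf s) := by
      unfold KD.Jm; rw [StieltjesFunction.measure_Ioc]
    have hmono : 0 ≤ h.stf (s + δ) - h.stf s := sub_nonneg.2 (h.stf.mono (by linarith))
    rw [hj, ← ENNReal.ofReal_mul (by positivity), ← ENNReal.ofReal_add (by positivity) (by positivity)] at hl1 hl2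
    have hl1' := ENNReal.toReal_mono (by finiteness) hl1
    have hl2' := ENNReal.toReal_mono (by finiteness) hl2
    rw [ENNReal.toReal_add hif (by finiteness), ENNReal.toReal_ofReal (by positivity)] at hl1'
    rw [ENNReal.toReal_add hKf (by finiteness), ENNReal.toReal_ofReal (by positivity)] at hl2'
    have e1' : (Φ s).toReal = (Φ (s+δ)).toReal + K.toReal := by
      rw [e1, ENNReal.toReal_add (hΦf _ (by linarith)) hKf]
    have e2' : (I (s+δ)).toReal = (I s).toReal + i.toReal := by
      rw [e2, ENNReal.toReal_add (hIf _ (by linarith)) hif]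
    simp only [hD]
    rw [abs_le]
    constructor <;> nlinarith
  have hEq : D s1 = D s0 := by
    have hA : 0 ≤ 2 * (h.stf s1 - h.stf s0) + (s1 - s0) := by
      have := h.stf.mono h01
      linarith
    set Q := 2 * (h.stf s1 - h.stf s0) + (s1 - s0)
    have : |D s1 - D s0| ≤ 0 := by
      apply le_of_forall_pos_le_add
      intro e he
      have h2 := key (e / (Q + 1)) (by positivity)
      refine h2.trans ?_
      rw [zero_add, div_mul_eq_mul_div, div_le_iff₀ (by positivity)]
      nlinarith
    have := abs_nonpos_iff.1 this
    linarith
  have hI0 : I s0 = 0 := by simp [hI]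
  have h1 : (Φ s1 + I s1).toReal = (Φ s0).toReal := by
    rw [ENNReal.toReal_add (hΦf _ h1t) (hIf _ h1t)]
    have := hEq
    simp only [hD, hI0] at this
    simpa using this
  exact (ENNReal.toReal_eq_toReal_iff' (ENNReal.add_ne_top.2 ⟨hΦf _ h1t, hIf _ h1t⟩) (hΦf _ (by linarith))).1 h1

lemma KD.P1 (h : KD m H) (hm : Continuous m) {X t s0 : ℝ} (hs0 : 0 ≤ s0) (h0t : s0 < t)
    (hX : X ≠ m t) :
    H X t + ∫⁻ u in Ioo s0 t, ENNReal.ofReal (hk (t - u) (X - m u)) ∂h.Jm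
      = cv (t - s0) (fun y => H y s0) X := by
  have hL : Tendsto (fun s1 => cv (t - s1) (fun y => H y s1) X +
      ∫⁻ u in Ioc s0 s1, ENNReal.ofReal (hk (t - u) (X - m u)) ∂h.Jm) (𝓝[<] t)
      (𝓝 (cv (t - s0) (fun y => H y s0) X)) := by
    apply tendsto_const_nhds.congr'
    filter_upwards [Ioo_mem_nhdsLT h0t] with s hs
    exact (h.P1a hm X hs0 hs.1.le hs.2).symm
  have hR : Tendsto (fun s1 => cv (t - s1) (fun y => H y s1) X +
      ∫⁻ u in Ioc s0 s1, ENNReal.ofReal (hk (t - u) (X - m u)) ∂h.Jm) (𝓝[<] t)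
      (𝓝 (H X t + ∫⁻ u in Ioo s0 t, ENNReal.ofReal (hk (t - u) (X - m u)) ∂h.Jm)) := by
    apply Tendsto.add
    · set ε := |X - m t| / 2
      have hε : 0 < ε := by
        have : 0 < |X - m t| := abs_pos.2 (sub_ne_zero.2 hX)
        positivity
      have hk0 : Tendsto (fun s1 => kap H s1 (t - s1) X) (𝓝[<] t) (𝓝 0) := by
        obtain ⟨δ0, hδ0, hc⟩ := h.conc ε hε t (by linarith) 1 one_pos
        have hu : Tendsto (fun s1 => ENNReal.ofReal (1 * (t - s1))) (𝓝[<] t) (𝓝 0) := by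
          have : Tendsto (fun s1 => ENNReal.ofReal (1 * (t - s1))) (𝓝 t) (𝓝 (ENNReal.ofReal (1 * (t - t)))) := by
            apply ENNReal.tendsto_ofReal
            apply Continuous.tendsto
            fun_prop
          simp only [sub_self, mul_zero, ENNReal.ofReal_zero] at this
          exact this.mono_left nhdsWithin_le_nhds
        refine tendsto_of_tendsto_of_tendsto_of_le_of_le' tendsto_const_nhds hu (by simp) ?_
        have hm1 : ∀ᶠ s in 𝓝 t, |m s - m t| < ε := by
          have := hm.tendsto t
          exact (Metric.tendsto_nhds.1 this) ε hε
        filter_upwards [nhdsWithin_le_nhds hm1, Ioo_mem_nhdsLT h0t,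
          Ioo_mem_nhdsLT (show t - δ0 < t by linarith)] with s h1 h2 h3
        refine (hc s ⟨by linarith [h2.1], h2.2.le⟩ (t - s) ⟨by linarith [h2.2], by linarith [h3.1]⟩).1 X ?_
        have h4 : |X - m t| ≤ |X - m s| + |m s - m t| := abs_sub_le _ _ _
        have : |X - m t| = 2 * ε := by simp only [ε]; ring
        linarith
      have : Tendsto (fun s1 => H X t + kap H s1 (t - s1) X) (𝓝[<] t) (𝓝 (H X t + 0)) :=
        tendsto_const_nhds.add hk0
      rw [add_zero] at this
      apply this.congr'
      filter_upwards [Ioo_mem_nhdsLT h0t] with s hs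
      have := h.add_kap (hs0.trans hs.1.le) (show 0 < t - s by linarith [hs.2]) X
      rw [← this]; congr 2; ring
    · have hM : Monotone (fun s1 => ∫⁻ u in Ioc s0 s1, ENNReal.ofReal (hk (t - u) (X - m u)) ∂h.Jm) := by
        intro a b hab
        exact lintegral_mono_set (Ioc_subset_Ioc_right hab)
      have hl := hM.tendsto_nhdsLT t
      convert hl using 2
      set f := fun u => ENNReal.ofReal (hk (t - u) (X - m u))
      apply le_antisymm
      · obtain ⟨q, hq1, hq2, hq3⟩ := exists_seq_strictMono_tendsto' h0t
        have hun : Ioo s0 t = ⋃ n, Ioc s0 (q n) := by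
          ext u
          simp only [mem_Ioo, mem_iUnion, mem_Ioc]
          constructor
          · rintro ⟨h1, h2⟩
            obtain ⟨n, hn⟩ := (hq3.eventually (lt_mem_nhds h2)).exists
            exact ⟨n, h1, hn.le⟩
          · rintro ⟨n, h1, h2⟩
            exact ⟨h1, lt_of_le_of_lt h2 (hq2 n).2⟩
        have hdir : Monotone (fun n => Ioc s0 (q n)) := fun i j hij => Ioc_subset_Ioc_right (hq1.monotone hij)
        rw [hun, setLIntegral_iUnion_of_directed _ (directed_of_isDirected_le hdir)]
        apply iSup_le
        intro n
        exact le_csSup (OrderTop.bddAbove _) ⟨q n, (hq2 n).2, rfl⟩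
      · apply csSup_le
        · exact ⟨_, ⟨s0, h0t, rfl⟩⟩
        · rintro _ ⟨s, hs, rfl⟩
          apply lintegral_mono_set
          intro u hu
          exact ⟨hu.1, lt_of_le_of_lt hu.2 hs⟩
  haveI : (𝓝[<] t).NeBot := inferInstance
  exact tendsto_nhds_unique hR hL

end PartE

open MeasureTheory ProbabilityTheory Filter Real Set Asymptotics
open scoped NNReal ENNReal Topology
set_option linter.all false
set_option linter.deprecated false

section PartF

/-- abstract data after exponential tilting -/
structure AD (M : ℝ → ℝ) (w : ℝ → ℝ → ℝ≥0∞) (J : Measure ℝ) : Prop where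
  cont : Continuous M
  meas : ∀ t, Measurable fun x => w x t
  integ : ∫⁻ x, w x 0 ≠ ∞
  zero : ∀ t ≥ 0, ∀ x ≤ M t, w x t = 0
  ident : ∀ s ≥ 0, ∀ t > s, ∀ X ≠ M t,
    w X t + ∫⁻ u in Ioo s t, ENNReal.ofReal (hk (t - u) (X - M u)) ∂J =
      ∫⁻ y, ENNReal.ofReal (hk (t - s) (X - y)) * w y s
  Jneg : J (Iic 0) = 0
  Jfin : J univ ≤ ∫⁻ x, w x 0

lemma hk_tilt {τ : ℝ} (hτ : 0 < τ) (v : ℝ) : hk τ (v + 2 * τ) = hk τ v * Real.exp (-v - τ) := by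
  unfold hk
  rw [mul_assoc (√(4 * π * τ))⁻¹, ← Real.exp_add]
  congr 2
  field_simp
  ring

lemma hk_int_meas2 {M : ℝ → ℝ} (hM : Continuous M) (t : ℝ) :
    Measurable (fun z : ℝ × ℝ => ENNReal.ofReal (hk (t - z.2) (z.1 - M z.2))) := by
  apply ENNReal.measurable_ofReal.comp
  unfold hk
  have := hM.measurable
  fun_prop

lemma AD_of_KD {m : ℝ → ℝ} {H : ℝ → ℝ → ℝ≥0∞} (h : KD m H) (hm : Continuous m)
    (hinteg : ∫⁻ x, ENNReal.ofReal (Real.exp x) * H x 0 ≠ ∞) :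
    ∃ J : Measure ℝ, AD (fun t => m t - 2 * t)
      (fun X t => ENNReal.ofReal (Real.exp (X + t)) * H (X + 2 * t) t) J := by
  set M : ℝ → ℝ := fun t => m t - 2 * t with hMdef
  have hMc : Continuous M := by fun_prop
  set dens : ℝ → ℝ≥0∞ := fun s => ENNReal.ofReal (Real.exp (M s + s)) with hdens
  have hdm : Measurable dens := by
    apply ENNReal.measurable_ofReal.comp
    have := hMc.measurable
    fun_prop
  set J : Measure ℝ := (h.Jm.withDensity dens).restrict (Ioi 0) with hJ
  set w : ℝ → ℝ → ℝ≥0∞ := fun X t => ENNReal.ofReal (Real.exp (X + t)) * H (X + 2 * t) t with hw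
  have hwm : ∀ t, Measurable fun x => w x t := by
    intro t
    have h1 : Measurable fun x => H (x + 2 * t) t := (h.meas t).comp (measurable_id.add_const _)
    have h2 : Measurable fun x : ℝ => ENNReal.ofReal (Real.exp (x + t)) := by fun_prop
    exact h2.mul h1
  have hid : ∀ s ≥ 0, ∀ t > s, ∀ X ≠ M t,
    w X t + ∫⁻ u in Ioo s t, ENNReal.ofReal (hk (t - u) (X - M u)) ∂J =
      ∫⁻ y, ENNReal.ofReal (hk (t - s) (X - y)) * w y s := by
    intro s hs t hst X hX
    have hP := h.P1 hm (X := X + 2 * t) hs hst (by intro hc; apply hX; simp only [hMdef]; linarith)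
    have hP2 := congrArg (fun z => ENNReal.ofReal (Real.exp (X + t)) * z) hP
    simp only [mul_add] at hP2
    rw [← lintegral_const_mul _ (hk_int_meas hm _ _)] at hP2
    have hss : Ioo s t ⊆ Ioi 0 := fun u hu => lt_of_le_of_lt hs hu.1
    have hJr : ∀ f : ℝ → ℝ≥0∞, Measurable f →
        ∫⁻ u in Ioo s t, f u ∂J = ∫⁻ u in Ioo s t, dens u * f u ∂h.Jm := by
      intro f hf
      rw [hJ, Measure.restrict_restrict measurableSet_Ioo, inter_eq_left.2 hss, restrict_withDensity measurableSet_Ioo,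
        lintegral_withDensity_eq_lintegral_mul _ hdm hf]
      rfl
    rw [hJr _ (hk_int_meas hMc _ _)]
    have e1 : ∫⁻ u in Ioo s t, dens u * ENNReal.ofReal (hk (t - u) (X - M u)) ∂h.Jm =
        ∫⁻ u in Ioo s t, ENNReal.ofReal (Real.exp (X + t)) *
          ENNReal.ofReal (hk (t - u) (X + 2 * t - m u)) ∂h.Jm := by
      apply setLIntegral_congr_fun measurableSet_Ioo
      intro u hu
      simp only [hdens]
      rw [← ENNReal.ofReal_mul (Real.exp_pos _).le, ← ENNReal.ofReal_mul (Real.exp_pos _).le]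
      congr 1
      have : X + 2 * t - m u = (X - M u) + 2 * (t - u) := by simp only [hMdef]; ring
      rw [this, hk_tilt (by linarith [hu.2]), mul_comm, mul_left_comm, ← Real.exp_add]
      congr 2
      simp only [hMdef]
      ring
    rw [e1, hP2]
    unfold cv
    rw [← lintegral_add_right_eq_self _ (2 * s),
      ← lintegral_const_mul]
    · apply lintegral_congr
      intro y
      simp only [hw]
      have : X + 2 * t - (y + 2 * s) = (X - y) + 2 * (t - s) := by ring
      rw [this, hk_tilt (by linarith), ← mul_assoc, ← mul_assoc,
        ← ENNReal.ofReal_mul (Real.exp_pos _).le, ← ENNReal.ofReal_mul (hk_nonneg _ _)]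
      congr 2
      rw [mul_left_comm, ← Real.exp_add]
      congr 2
      ring
    · have h1 : Measurable fun x => H (x + 2 * s) s := (h.meas s).comp (measurable_id.add_const _)
      have h2 : Measurable fun y => ENNReal.ofReal (hk (t - s) (X + 2 * t - (y + 2 * s))) :=
        (hk_meas_right (t - s) (X + 2 * t)).comp (measurable_id.add_const (2 * s))
      exact h2.mul h1
  have hw0 : ∀ x, w x 0 = ENNReal.ofReal (Real.exp x) * H x 0 := by intro x; simp [hw]
  refine ⟨J, hMc, hwm, by simp_rw [hw0]; exact hinteg, ?_, hid, ?_, ?_⟩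
  · intro t ht X hX
    simp only [hw]
    rw [h.zero t ht _ (by simp only [hMdef] at hX; linarith), mul_zero]
  · rw [hJ, Measure.restrict_apply measurableSet_Iic]
    have : Iic (0:ℝ) ∩ Ioi 0 = ∅ := by ext u; simp
    simp [this]
  · -- total mass
    have hIoo : ∀ t > 0, J (Ioo 0 t) ≤ ∫⁻ x, w x 0 := by
      intro t ht
      haveI : SFinite J := by rw [hJ]; infer_instance
      have h1 : ∫⁻ X, (w X t + ∫⁻ u in Ioo 0 t, ENNReal.ofReal (hk (t - u) (X - M u)) ∂J) =
          ∫⁻ X, ∫⁻ y, ENNReal.ofReal (hk (t - 0) (X - y)) * w y 0 := by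
        apply lintegral_congr_ae
        have : ∀ᵐ X : ℝ, X ≠ M t := by simp [ae_iff]
        filter_upwards [this] with X hX
        exact hid 0 le_rfl t ht X hX
      rw [sub_zero] at h1
      have h2 : ∫⁻ X, ∫⁻ y, ENNReal.ofReal (hk t (X - y)) * w y 0 = ∫⁻ y, w y 0 :=
        cv_integral ht (hwm 0)
      rw [h2, lintegral_add_left (hwm t)] at h1
      rw [← h1]
      refine le_trans ?_ le_add_self
      rw [lintegral_lintegral_swap]
      · calc J (Ioo 0 t) = ∫⁻ u in Ioo 0 t, 1 ∂J := by simp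
          _ ≤ _ := by
            apply setLIntegral_mono' measurableSet_Ioo
            intro u hu
            rw [hk_integral' (by linarith [hu.2])]
      · exact (hk_int_meas2 hMc t).aemeasurable
    have hun : J univ = J (⋃ n : ℕ, Ioo (0:ℝ) (n + 1)) := by
      have h0 : J univ = J (Ioi 0) := by
        rw [hJ]; simp [Measure.restrict_apply]
      rw [h0]; congr 1
      ext u
      simp only [mem_Ioi, mem_iUnion, mem_Ioo]
      constructor
      · intro hu
        obtain ⟨n, hn⟩ := exists_nat_gt u
        exact ⟨n, hu, by linarith⟩
      · rintro ⟨n, h, -⟩; exact h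
    rw [hun, Directed.measure_iUnion]
    · apply iSup_le
      intro n
      exact hIoo _ (by positivity)
    · apply directed_of_isDirected_le
      intro i j hij
      apply Ioo_subset_Ioo_right
      have : (i:ℝ) ≤ j := by exact_mod_cast hij
      linarith

variable {Ω : Type*} [MeasurableSpace Ω] {P : Measure Ω} [IsProbabilityMeasure P]
  {B : ℝ → Ω → ℝ}

lemma fkpp_link (hB : IsBrownianMotion P B) {m h₀ : ℝ → ℝ} (hm : Continuous m)
    (hh : Measurable h₀) (hnn : ∀ x, 0 ≤ h₀ x) (x : ℝ) {t : ℝ} (ht : 0 ≤ t) :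
    fkppSol P B h₀ m x t =
      Real.exp t * (Hf P B m (fun y => ENNReal.ofReal (h₀ y)) x t).toReal := by
  unfold fkppSol
  congr 1
  have hGm : Measurable fun ω => Gf m (fun y => ENNReal.ofReal (h₀ y)) t (x, bpath B ω) :=
    (Gf_meas (ENNReal.measurable_ofReal.comp hh) t).comp (measurable_const.prodMk (bpath_meas hB))
  have : ∫ ω, ({ω : Ω | ∀ s ∈ Icc (0:ℝ) t, m (t - s) < x + B s ω}.indicator
      (fun ω => h₀ (x + B t ω)) ω) ∂P =
      ∫ ω, (Gf m (fun y => ENNReal.ofReal (h₀ y)) t (x, bpath B ω)).toReal ∂P := by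
    apply integral_congr_ae
    filter_upwards [bpath_cont hB] with ω hω
    unfold Gf
    have hb : ∀ s ≥ 0, bpath B ω s = B s ω := by
      intro s hs; simp [bpath, max_eq_left hs]
    have hiff := Svv_iff (g := fun u => m (t - u)) (by fun_prop) ht hω (x := x)
    by_cases hc : ∀ s ∈ Icc (0:ℝ) t, m (t - s) < x + B s ω
    · rw [indicator_of_mem (show ω ∈ {ω : Ω | ∀ s ∈ Icc (0:ℝ) t, m (t - s) < x + B s ω} from hc),
        indicator_of_mem]
      · simp [hb t ht, ENNReal.toReal_ofReal (hnn _)]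
      · rw [hiff]; intro s hs; rw [hb s hs.1]; exact hc s hs
    · rw [indicator_of_notMem (show ω ∉ {ω : Ω | ∀ s ∈ Icc (0:ℝ) t, m (t - s) < x + B s ω} from hc),
        indicator_of_notMem]
      · simp
      · rw [hiff]; intro hcc; apply hc; intro s hs; rw [← hb s hs.1]; exact hcc s hs
  rw [this, integral_toReal hGm.aemeasurable]
  · rfl
  · filter_upwards with ω
    unfold Gf indicator
    split_ifs <;> simp

end PartF

open MeasureTheory ProbabilityTheory Filter Real Set Asymptotics
open scoped NNReal ENNReal Topology
set_option linter.all false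
set_option linter.deprecated false

section PartG

/-- twice the gaussian tail -/
noncomputable def Nf (τ d : ℝ) : ℝ≥0∞ := 2 * ∫⁻ v in Ioi d, ENNReal.ofReal (hk τ v)

lemma hkE_meas (τ : ℝ) : Measurable fun v => ENNReal.ofReal (hk τ v) :=
  ENNReal.measurable_ofReal.comp (hk_cont τ).measurable

lemma hk_tail (τ b c : ℝ) :
    ∫⁻ X in Iio b, ENNReal.ofReal (hk τ (X - c)) = ∫⁻ v in Ioi (c - b), ENNReal.ofReal (hk τ v) := by
  rw [← lintegral_indicator measurableSet_Iio, ← lintegral_indicator measurableSet_Ioi,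
    ← lintegral_sub_left_eq_self _ c]
  apply lintegral_congr
  intro X
  unfold indicator
  have : c - X ∈ Iio b ↔ X ∈ Ioi (c - b) := by
    simp only [mem_Iio, mem_Ioi]; constructor <;> intro <;> linarith
  simp only [this]
  split_ifs
  · rw [show c - X - c = -X by ring, hk_neg]
  · rfl

lemma Nf_anti (τ : ℝ) : Antitone (Nf τ) := by
  intro a b hab
  unfold Nf
  gcongr

lemma Nf_zero {τ : ℝ} (hτ : 0 < τ) : Nf τ 0 = 1 := by
  have h1 := hk_integral hτ 0
  simp only [zero_sub, hk_neg] at h1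
  rw [← lintegral_add_compl _ (measurableSet_Ioi (a := (0:ℝ))), compl_Ioi] at h1
  have h2 : ∫⁻ v in Iic (0:ℝ), ENNReal.ofReal (hk τ v) = ∫⁻ v in Ioi 0, ENNReal.ofReal (hk τ v) := by
    have := hk_tail τ 0 0
    simp only [sub_zero] at this
    rw [← this]
    exact setLIntegral_congr Iio_ae_eq_Iic.symm
  rw [h2, ← two_mul] at h1
  exact h1

lemma Nf_le_one {τ d : ℝ} (hτ : 0 < τ) (hd : 0 ≤ d) : Nf τ d ≤ 1 := by
  rw [← Nf_zero hτ]; exact Nf_anti τ hd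

lemma Nf_ge {τ d : ℝ} (hτ : 0 < τ) (hd : 0 ≤ d) :
    1 ≤ Nf τ d + ENNReal.ofReal (2 * d * (√(4 * π * τ))⁻¹) := by
  rw [← Nf_zero hτ]
  unfold Nf
  rw [← Ioc_union_Ioi_eq_Ioi hd, lintegral_union measurableSet_Ioi
    (by rw [Set.disjoint_left]; intro x hx hx2; exact not_lt.2 hx.2 hx2), mul_add, add_comm]
  gcongr
  rw [mul_assoc, ENNReal.ofReal_mul (by norm_num)]
  have : ENNReal.ofReal 2 = 2 := by simp
  rw [this]
  gcongr
  calc ∫⁻ v in Ioc 0 d, ENNReal.ofReal (hk τ v) ≤ ∫⁻ v in Ioc 0 d, ENNReal.ofReal ((√(4 * π * τ))⁻¹) := by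
        apply lintegral_mono
        intro v
        exact ENNReal.ofReal_le_ofReal (hk_le hτ v)
    _ = _ := by
      rw [setLIntegral_const, Real.volume_Ioc, mul_comm, sub_zero, ENNReal.ofReal_mul hd]


variable {M : ℝ → ℝ} {w : ℝ → ℝ → ℝ≥0∞} {J : Measure ℝ}

lemma AD.finite (h : AD M w J) : IsFiniteMeasure J := ⟨lt_of_le_of_lt h.Jfin (lt_top_iff_ne_top.2 h.integ)⟩

lemma AD.flux (h : AD M w J) {s t : ℝ} (hs : 0 ≤ s) (hst : s < t) :
    ∫⁻ u in Ioo s t, Nf (t - u) (M u - M t) ∂J = ∫⁻ y, Nf (t - s) (y - M t) * w y s := by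
  haveI := h.finite
  have h1 : ∫⁻ X in Iio (M t), ∫⁻ u in Ioo s t, ENNReal.ofReal (hk (t - u) (X - M u)) ∂J =
      ∫⁻ X in Iio (M t), ∫⁻ y, ENNReal.ofReal (hk (t - s) (X - y)) * w y s := by
    apply setLIntegral_congr_fun measurableSet_Iio
    intro X hX
    have := h.ident s hs t hst X (ne_of_lt hX)
    rw [h.zero t (by linarith) X (le_of_lt hX), zero_add] at this
    exact this
  have hsw : ∫⁻ X in Iio (M t), ∫⁻ y, ENNReal.ofReal (hk (t - s) (X - y)) * w y s =
      ∫⁻ y, ∫⁻ X in Iio (M t), ENNReal.ofReal (hk (t - s) (X - y)) * w y s := by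
    apply lintegral_lintegral_swap
    exact (((hk_meas2 (t - s)).mul ((h.meas s).comp measurable_snd))).aemeasurable
  rw [hsw, lintegral_lintegral_swap (hk_int_meas2 h.cont t).aemeasurable] at h1
  simp_rw [hk_tail] at h1
  have h2 : ∀ y, ∫⁻ X in Iio (M t), ENNReal.ofReal (hk (t - s) (X - y)) * w y s =
      (∫⁻ v in Ioi (y - M t), ENNReal.ofReal (hk (t - s) v)) * w y s := by
    intro y
    rw [lintegral_mul_const _ (hk_meas_left _ _), hk_tail]
  simp_rw [h2] at h1
  unfold Nf
  simp_rw [mul_assoc]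
  rw [lintegral_const_mul' _ _ (by simp), lintegral_const_mul' _ _ (by simp), h1]

lemma hk_mom {τ : ℝ} (hτ : 0 < τ) {q : ℝ} (hq : -1 < q) :
    IntegrableOn (fun v => v ^ q * hk τ v) (Ioi 0) ∧
    ∫ v in Ioi 0, v ^ q * hk τ v = (√(4 * π * τ))⁻¹ * ((4 * τ) ^ ((q + 1) / 2) * (1 / 2) * Real.Gamma ((q + 1) / 2)) := by
  have e : ∀ v, v ^ q * hk τ v = (√(4 * π * τ))⁻¹ * (v ^ q * Real.exp (-(1 / (4 * τ)) * v ^ (2:ℝ))) := by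
    intro v
    unfold hk
    rw [Real.rpow_two, show -(1 / (4 * τ)) * v ^ 2 = -v ^ 2 / (4 * τ) by ring]
    ring
  simp_rw [e]
  constructor
  · exact (integrableOn_rpow_mul_exp_neg_mul_rpow hq two_pos (by positivity)).const_mul _
  · rw [integral_const_mul, integral_rpow_mul_exp_neg_mul_rpow two_pos hq (by positivity)]
    congr 3
    rw [one_div, Real.inv_rpow (by positivity), ← Real.rpow_neg (by positivity)]
    congr 1; ring

lemma hk_mom2 {τ : ℝ} (hτ : 0 < τ) : ∫ v in Ioi 0, v ^ (2:ℝ) * hk τ v = τ := by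
  rw [(hk_mom hτ (by norm_num)).2]
  have hG : Real.Gamma ((2 + 1) / 2) = √π / 2 := by
    rw [show ((2:ℝ) + 1) / 2 = 1 / 2 + 1 by norm_num, Real.Gamma_add_one (by norm_num),
      Real.Gamma_one_half_eq]; ring
  rw [hG, show ((2:ℝ) + 1) / 2 = 1 + 1 / 2 by norm_num, Real.rpow_add (by positivity), Real.rpow_one,
    ← Real.sqrt_eq_rpow, show 4 * π * τ = π * (4 * τ) by ring, Real.sqrt_mul (by positivity)]
  have h1 : √π ≠ 0 := by positivity
  have h2 : √(4 * τ) ≠ 0 := by positivity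
  field_simp
  norm_num

lemma lint_mul_Nf (τ : ℝ) (f : ℝ → ℝ≥0∞) (hf : Measurable f) (e : ℝ) (b : ℝ) :
    ∫⁻ x in Ioc 0 b, f x * Nf τ (x + e) =
      ∫⁻ v, ENNReal.ofReal (hk τ v) * (2 * ∫⁻ x in Ioc 0 (min b (v - e)), f x) := by
  have h1 : ∀ x, f x * Nf τ (x + e) = ∫⁻ v, (Ioi (x + e)).indicator (fun v => 2 * f x * ENNReal.ofReal (hk τ v)) v := by
    intro x
    unfold Nf
    rw [lintegral_indicator measurableSet_Ioi, lintegral_const_mul _ (hkE_meas τ)]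
    ring
  simp_rw [h1]
  rw [lintegral_lintegral_swap]
  · apply lintegral_congr
    intro v
    rw [← lintegral_const_mul _ hf, ← lintegral_const_mul _ (hf.const_mul 2),
      ← lintegral_indicator measurableSet_Ioc, ← lintegral_indicator measurableSet_Ioc]
    apply lintegral_congr_ae
    have : ∀ᵐ x : ℝ, x ≠ v - e := by simp [ae_iff]
    filter_upwards [this] with x hx
    unfold indicator
    simp only [mem_Ioc, mem_Ioi, le_min_iff]
    by_cases h2 : x + e < v
    · have : x ≤ v - e := by linarith
      simp only [h2, this, and_true, if_true]
      split_ifs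
      · ring
      · rfl
    · have : ¬ x ≤ v - e := by
        intro h3; rcases h3.lt_or_eq with h4 | h4
        · exact h2 (by linarith)
        · exact hx h4
      simp [h2, this]
  · have hs : MeasurableSet {z : ℝ × ℝ | z.1 + e < z.2} :=
      measurableSet_lt (measurable_fst.add_const e) measurable_snd
    have : Measurable ({z : ℝ × ℝ | z.1 + e < z.2}.indicator
        (fun z => 2 * f z.1 * ENNReal.ofReal (hk τ z.2))) := by
      apply Measurable.indicator _ hs
      exact ((hf.comp measurable_fst).const_mul 2).mul ((hkE_meas τ).comp measurable_snd)
    exact this.aemeasurable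

lemma lint_id {a : ℝ} : ∫⁻ x in Ioc 0 a, ENNReal.ofReal x = ENNReal.ofReal (max a 0 ^ 2 / 2) := by
  rcases le_or_gt a 0 with h | h
  · simp [Ioc_eq_empty (not_lt.2 h), max_eq_right h]
  · rw [← ofReal_integral_eq_lintegral_ofReal, ← intervalIntegral.integral_of_le h.le]
    · simp [max_eq_left h.le]
    · exact (intervalIntegrable_iff_integrableOn_Ioc_of_le h.le).1 (by simp)
    · filter_upwards [ae_restrict_mem measurableSet_Ioc] with x hx
      exact hx.1.le

lemma Nf_upper {δ : ℝ} (hδ : 0 < δ) : ∫⁻ x in Ioi 0, ENNReal.ofReal x * Nf δ x ≤ ENNReal.ofReal δ := by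
  have hb : ∀ n : ℕ, ∫⁻ x in Ioc 0 (n:ℝ), ENNReal.ofReal x * Nf δ x ≤ ENNReal.ofReal δ := by
    intro n
    have := lint_mul_Nf δ (fun x => ENNReal.ofReal x) (by fun_prop) 0 n
    simp only [add_zero, sub_zero, lint_id] at this
    rw [this]
    calc _ ≤ ∫⁻ v in Ioi 0, ENNReal.ofReal (v ^ (2:ℝ) * hk δ v) := by
          rw [← lintegral_indicator measurableSet_Ioi]
          apply lintegral_mono
          intro v
          simp only
          have h2 : (2:ℝ≥0∞) = ENNReal.ofReal 2 := by simp
          rw [h2, ← ENNReal.ofReal_mul (by norm_num), ← ENNReal.ofReal_mul (hk_nonneg _ _)]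
          by_cases hv : 0 < v
          · rw [indicator_of_mem (show v ∈ Ioi 0 from hv)]
            apply ENNReal.ofReal_le_ofReal
            rw [mul_comm]
            apply mul_le_mul_of_nonneg_right _ (hk_nonneg _ _)
            rw [Real.rpow_two]
            have h1 : max (min (n:ℝ) v) 0 ≤ v := max_le (min_le_right _ _) hv.le
            have h0 : 0 ≤ max (min (n:ℝ) v) 0 := le_max_right _ _
            nlinarith
          · rw [indicator_of_notMem (by simpa using hv)]
            have : max (min (n:ℝ) v) 0 = 0 := max_eq_right ((min_le_right _ _).trans (not_lt.1 hv))
            simp [this]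
      _ = ENNReal.ofReal δ := by
          rw [← ofReal_integral_eq_lintegral_ofReal (hk_mom hδ (by norm_num)).1, hk_mom2 hδ]
          filter_upwards [ae_restrict_mem measurableSet_Ioi] with x hx
          exact mul_nonneg (Real.rpow_nonneg (le_of_lt hx) _) (hk_nonneg _ _)
  have hun : Ioi (0:ℝ) = ⋃ n : ℕ, Ioc (0:ℝ) n := by
    ext u
    simp only [mem_Ioi, mem_iUnion, mem_Ioc]
    constructor
    · intro hu
      obtain ⟨n, hn⟩ := exists_nat_gt u
      exact ⟨n, hu, hn.le⟩
    · rintro ⟨n, h, -⟩; exact h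
  rw [hun, setLIntegral_iUnion_of_directed]
  · exact iSup_le hb
  · apply directed_of_isDirected_le
    intro i j hij
    apply Ioc_subset_Ioc_right
    exact_mod_cast hij

lemma Nf_lower {L : ℝ} (hL : 0 ≤ L) : ∃ K ≥ 0, ∀ δ ∈ Ioc (0:ℝ) 1,
    ENNReal.ofReal (δ - K * δ ^ (3/2 : ℝ)) ≤ ∫⁻ x in Ioc 0 1, ENNReal.ofReal x * Nf δ (x + L * δ) := by
  set G1 := (√(4 * π))⁻¹ * (4 ^ (((1:ℝ) + 1) / 2) * (1 / 2) * Real.Gamma ((1 + 1) / 2)) with hG1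
  set G4 := (√(4 * π))⁻¹ * (4 ^ (((4:ℝ) + 1) / 2) * (1 / 2) * Real.Gamma ((4 + 1) / 2)) with hG4
  have hG1p : 0 ≤ G1 := by
    have := Real.Gamma_pos_of_pos (show 0 < ((1:ℝ) + 1) / 2 by norm_num)
    positivity
  have hG4p : 0 ≤ G4 := by
    have := Real.Gamma_pos_of_pos (show 0 < ((4:ℝ) + 1) / 2 by norm_num)
    positivity
  refine ⟨2 * L * G1 + G4, by positivity, ?_⟩
  intro δ hδ
  have hδ0 : 0 < δ := hδ.1
  have hm : ∀ q : ℝ, -1 < q → ∫ v in Ioi 0, v ^ q * hk δ v =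
      δ ^ (q / 2) * ((√(4 * π))⁻¹ * (4 ^ ((q + 1) / 2) * (1 / 2) * Real.Gamma ((q + 1) / 2))) := by
    intro q hq
    rw [(hk_mom hδ0 hq).2, Real.mul_rpow (by norm_num) hδ0.le, Real.sqrt_mul (by positivity),
      show (q + 1) / 2 = q / 2 + 1 / 2 by ring, Real.rpow_add hδ0, ← Real.sqrt_eq_rpow δ]
    have : √δ ≠ 0 := by positivity
    have : √(4 * π) ≠ 0 := by positivity
    field_simp
  have h1 := hm 1 (by norm_num)
  have h4 := hm 4 (by norm_num)
  have h2 := hk_mom2 hδ0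
  have i1 := (hk_mom hδ0 (q := 1) (by norm_num)).1
  have i2 := (hk_mom hδ0 (q := 2) (by norm_num)).1
  have i4 := (hk_mom hδ0 (q := 4) (by norm_num)).1
  have hinteg : ∫ v in Ioi 0, (v ^ (2:ℝ) * hk δ v - 2 * L * δ * (v ^ (1:ℝ) * hk δ v) - v ^ (4:ℝ) * hk δ v) =
      δ - 2 * L * δ * (δ ^ ((1:ℝ) / 2) * G1) - δ ^ ((4:ℝ)/2) * G4 := by
    have i12 : IntegrableOn (fun v => v ^ (2:ℝ) * hk δ v - 2 * L * δ * (v ^ (1:ℝ) * hk δ v)) (Ioi 0) :=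
      i2.sub (i1.const_mul _)
    rw [integral_sub i12 i4, integral_sub i2 (i1.const_mul _), integral_const_mul,
      h1, h2, h4]
  have hle : δ - (2 * L * G1 + G4) * δ ^ (3/2 : ℝ) ≤
      ∫ v in Ioi 0, (v ^ (2:ℝ) * hk δ v - 2 * L * δ * (v ^ (1:ℝ) * hk δ v) - v ^ (4:ℝ) * hk δ v) := by
    rw [hinteg]
    have e1 : δ * δ ^ ((1:ℝ)/2) = δ ^ (3/2:ℝ) := by
      rw [show (3/2:ℝ) = 1 + 1/2 by norm_num, Real.rpow_add hδ0, Real.rpow_one]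
    have e2 : δ ^ ((4:ℝ)/2) ≤ δ ^ (3/2:ℝ) :=
      Real.rpow_le_rpow_of_exponent_ge hδ0 hδ.2 (by norm_num)
    have : 2 * L * δ * (δ ^ ((1:ℝ) / 2) * G1) = 2 * L * G1 * δ ^ (3/2:ℝ) := by rw [← e1]; ring
    rw [this]
    nlinarith
  have hl := lint_mul_Nf δ (fun x => ENNReal.ofReal x) (by fun_prop) (L * δ) 1
  rw [hl]
  simp only [lint_id]
  refine (ENNReal.ofReal_le_ofReal hle).trans ?_
  have hpt : ∀ v ∈ Ioi (0:ℝ), v ^ (2:ℝ) * hk δ v - 2 * L * δ * (v ^ (1:ℝ) * hk δ v) - v ^ (4:ℝ) * hk δ v ≤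
      hk δ v * (max (min 1 (v - L * δ)) 0 ^ 2) := by
    intro v hv
    have hv0 : 0 < v := hv
    have e4 : v ^ (4:ℝ) = v ^ 4 := by
      rw [show (4:ℝ) = ((4:ℕ):ℝ) by norm_num, Real.rpow_natCast]
    rw [Real.rpow_two, Real.rpow_one, e4]
    have : v ^ 2 - 2 * L * δ * v - v ^ 4 ≤ max (min 1 (v - L * δ)) 0 ^ 2 := by
      have hLδ : 0 ≤ L * δ := by positivity
      set c := L * δ
      rcases le_total (v - c) 0 with h | h
      · have : 0 ≤ max (min 1 (v - c)) 0 ^ 2 := by positivity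
        nlinarith [sq_nonneg (v^2)]
      · rcases le_total 1 (v - c) with h' | h'
        · have h5 : max (min 1 (v - c)) 0 = 1 := by simp [min_eq_left h']
          rw [h5]
          have : 1 ≤ v := by linarith
          nlinarith [sq_nonneg (v^2), mul_nonneg hLδ hv0.le, mul_self_nonneg (v^2 - 1)]
        · have h5 : max (min 1 (v - c)) 0 = v - c := by rw [min_eq_right h', max_eq_left h]
          rw [h5]
          nlinarith [sq_nonneg (v^2), sq_nonneg c]
    nlinarith [hk_nonneg δ v]
  set F : ℝ → ℝ := fun v => hk δ v * (max (min 1 (v - L * δ)) 0 ^ 2) with hF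
  have hFc : Continuous F := by have := hk_cont δ; fun_prop
  have hF0 : ∀ v, 0 ≤ F v := fun v => mul_nonneg (hk_nonneg _ _) (by positivity)
  have hFi : IntegrableOn F (Ioi 0) := by
    refine ((hk_integrable hδ0).integrableOn (s := Ioi 0)).mono' hFc.aestronglyMeasurable ?_
    filter_upwards with v
    rw [Real.norm_of_nonneg (hF0 v)]
    have h0 : 0 ≤ max (min 1 (v - L * δ)) 0 := le_max_right _ _
    have h1 : max (min 1 (v - L * δ)) 0 ≤ 1 := max_le (min_le_left _ _) zero_le_one
    have : max (min 1 (v - L * δ)) 0 ^ 2 ≤ 1 := by nlinarith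
    simp only [hF]
    nlinarith [hk_nonneg δ v]
  have hmono := setIntegral_mono_on ((i2.sub (i1.const_mul (2 * L * δ))).sub i4) hFi measurableSet_Ioi hpt
  refine (ENNReal.ofReal_le_ofReal hmono).trans ?_
  rw [ofReal_integral_eq_lintegral_ofReal hFi (Eventually.of_forall hF0)]
  refine (setLIntegral_le_lintegral _ _).trans (lintegral_mono ?_)
  intro v
  have h2 : (2:ℝ≥0∞) = ENNReal.ofReal 2 := by simp
  simp only
  rw [h2, ← ENNReal.ofReal_mul (by norm_num), ← ENNReal.ofReal_mul (hk_nonneg _ _)]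
  apply ENNReal.ofReal_le_ofReal
  simp only [hF]
  apply le_of_eq; ring

lemma AD.flux_up (h : AD M w J) {t L D : ℝ} (ht : 0 ≤ t) (hL : 0 ≤ L) (hD : 0 ≤ D)
    (hM : ∀ s s', t ≤ s → s ≤ s' → 0 ≤ M s - M s' ∧ M s - M s' ≤ L * (s' - s))
    (hw : ∀ x > 0, w (M t + x) t ≤ ENNReal.ofReal (D * x)) {δ : ℝ} (hδ : 0 < δ) :
    J (Ioo t (t + δ)) ≤ ENNReal.ofReal (D * δ) + ENNReal.ofReal (L * √δ) * J (Ioo t (t + δ)) := by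
  have hf := h.flux ht (show t < t + δ by linarith)
  rw [show t + δ - t = δ by ring] at hf
  have hR : ∫⁻ y, Nf δ (y - M (t + δ)) * w y t ≤ ENNReal.ofReal (D * δ) := by
    calc _ = ∫⁻ x, Nf δ (x + M t - M (t + δ)) * w (x + M t) t := (lintegral_add_right_eq_self _ (M t)).symm
      _ ≤ ∫⁻ x in Ioi 0, ENNReal.ofReal D * (ENNReal.ofReal x * Nf δ x) := by
        rw [← lintegral_indicator measurableSet_Ioi]
        apply lintegral_mono
        intro x
        simp only
        by_cases hx : 0 < x
        · rw [indicator_of_mem (show x ∈ Ioi 0 from hx)]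
          have h1 := hw x hx
          rw [ENNReal.ofReal_mul hD] at h1
          rw [mul_comm, ← mul_assoc]
          gcongr
          · rw [add_comm]; exact h1
          · apply Nf_anti
            have := (hM t (t + δ) le_rfl (by linarith)).1
            linarith
        · rw [h.zero t ht _ (by linarith)]; simp
      _ = ENNReal.ofReal D * ∫⁻ x in Ioi 0, ENNReal.ofReal x * Nf δ x := by
        rw [lintegral_const_mul' _ _ (by simp)]
      _ ≤ _ := by
        rw [ENNReal.ofReal_mul hD]
        gcongr
        exact Nf_upper hδ
  rw [← hf] at hR
  calc J (Ioo t (t + δ)) = ∫⁻ u in Ioo t (t + δ), 1 ∂J := by simp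
    _ ≤ ∫⁻ u in Ioo t (t + δ), (Nf (t + δ - u) (M u - M (t + δ)) + ENNReal.ofReal (L * √δ)) ∂J := by
      apply setLIntegral_mono' measurableSet_Ioo
      intro u hu
      have hτ : 0 < t + δ - u := by linarith [hu.2]
      obtain ⟨hm1, hm2⟩ := hM u (t + δ) hu.1.le hu.2.le
      refine (Nf_ge hτ hm1).trans ?_
      refine add_le_add le_rfl (ENNReal.ofReal_le_ofReal ?_)
      set τ := t + δ - u
      have hτδ : τ ≤ δ := by simp only [τ]; linarith [hu.1]
      calc 2 * (M u - M (t + δ)) * (√(4 * π * τ))⁻¹ ≤ 2 * (L * τ) * (√(4 * τ))⁻¹ := by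
            gcongr
            nlinarith [Real.pi_gt_three]
        _ = L * √τ := by
            rw [show (4:ℝ) * τ = 2^2 * τ by ring, Real.sqrt_mul (by norm_num), Real.sqrt_sq (by norm_num)]
            have h1 : √τ * √τ = τ := Real.mul_self_sqrt hτ.le
            have h2 : √τ ≠ 0 := by positivity
            field_simp
            rw [pow_two, h1]
        _ ≤ L * √δ := by gcongr
    _ = _ := by
      rw [lintegral_add_right _ measurable_const, setLIntegral_const]
    _ ≤ _ := by gcongr

lemma AD.flux_low (h : AD M w J) {L : ℝ} (hL : 0 ≤ L) : ∃ K ≥ 0, ∀ t ≥ 0, ∀ D ≥ 0,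
    (∀ s s', t ≤ s → s ≤ s' → 0 ≤ M s - M s' ∧ M s - M s' ≤ L * (s' - s)) →
    (∀ x ∈ Ioc (0:ℝ) 1, ENNReal.ofReal (D * x) ≤ w (M t + x) t) → ∀ δ ∈ Ioc (0:ℝ) 1,
    ENNReal.ofReal (D * (δ - K * δ ^ (3/2:ℝ))) ≤ J (Ioo t (t + δ)) := by
  obtain ⟨K, hK, hlow⟩ := Nf_lower hL
  refine ⟨K, hK, ?_⟩
  intro t ht D hD hM hw δ hδ
  have hδ0 := hδ.1
  have hf := h.flux ht (show t < t + δ by linarith)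
  rw [show t + δ - t = δ by ring] at hf
  calc ENNReal.ofReal (D * (δ - K * δ ^ (3/2:ℝ))) =
        ENNReal.ofReal D * ENNReal.ofReal (δ - K * δ ^ (3/2:ℝ)) := ENNReal.ofReal_mul hD
    _ ≤ ENNReal.ofReal D * ∫⁻ x in Ioc 0 1, ENNReal.ofReal x * Nf δ (x + L * δ) := by
      gcongr; exact hlow δ hδ
    _ = ∫⁻ x in Ioc 0 1, ENNReal.ofReal D * (ENNReal.ofReal x * Nf δ (x + L * δ)) := by
      rw [lintegral_const_mul' _ _ (by simp)]
    _ ≤ ∫⁻ x, Nf δ (x + M t - M (t + δ)) * w (x + M t) t := by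
      rw [← lintegral_indicator measurableSet_Ioc]
      apply lintegral_mono
      intro x
      simp only
      by_cases hx : x ∈ Ioc (0:ℝ) 1
      · rw [indicator_of_mem hx]
        have h1 := hw x hx
        rw [ENNReal.ofReal_mul hD] at h1
        rw [← mul_assoc, mul_comm]
        gcongr
        · apply Nf_anti
          have := (hM t (t + δ) le_rfl (by linarith)).2
          linarith
        · rw [add_comm]; exact h1
      · rw [indicator_of_notMem hx]; simp
    _ = ∫⁻ y, Nf δ (y - M (t + δ)) * w y t := lintegral_add_right_eq_self (fun y => Nf δ (y - M (t + δ)) * w y t) (M t)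
    _ ≤ _ := by
      rw [← hf]
      calc _ ≤ ∫⁻ u in Ioo t (t + δ), 1 ∂J := by
            apply setLIntegral_mono' measurableSet_Ioo
            intro u hu
            exact Nf_le_one (by linarith [hu.2]) (hM u (t + δ) hu.1.le hu.2.le).1
        _ = _ := by simp

end PartG

open MeasureTheory ProbabilityTheory Filter Real Set Asymptotics
open scoped NNReal ENNReal Topology
set_option linter.all false
set_option linter.deprecated false

section PartH

/-- the reduced Dirichlet kernel -/
noncomputable def gk (τ x d : ℝ) : ℝ := Real.exp (-(x ^ 2 + d ^ 2) / (4 * τ)) *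
  (Real.sinh (x * d / (2 * τ)) / (x * d / (2 * τ)))

lemma sinh_le_mul_cosh {u : ℝ} (hu : 0 ≤ u) : Real.sinh u ≤ u * Real.cosh u := by
  have hmono : MonotoneOn (fun u => u * Real.cosh u - Real.sinh u) (Ici 0) := by
    apply monotoneOn_of_deriv_nonneg (convex_Ici 0)
    · fun_prop
    · fun_prop
    · intro v hv
      rw [interior_Ici] at hv
      have : HasDerivAt (fun u => u * Real.cosh u - Real.sinh u) (1 * Real.cosh v + v * Real.sinh v - Real.cosh v) v :=
        ((hasDerivAt_id v).mul (Real.hasDerivAt_cosh v)).sub (Real.hasDerivAt_sinh v)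
      rw [this.deriv]
      have h1 : 0 ≤ Real.sinh v := Real.sinh_nonneg_iff.2 (le_of_lt hv)
      have h2 : 0 < v := hv
      nlinarith
  have := hmono (show (0:ℝ) ∈ Ici 0 by simp) (show u ∈ Ici 0 from hu) hu
  simp at this
  linarith

lemma S_ge {u : ℝ} (hu : 0 < u) : 1 ≤ Real.sinh u / u := by
  rw [le_div_iff₀ hu, one_mul]; exact Real.self_le_sinh_iff.2 hu.le

lemma S_le {u : ℝ} (hu : 0 < u) : Real.sinh u / u ≤ Real.cosh u := by
  rw [div_le_iff₀ hu, mul_comm]; exact sinh_le_mul_cosh hu.le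

lemma gk_lower {τ x d : ℝ} (hτ : 0 < τ) (hx : 0 < x) (hd : 0 < d) :
    Real.exp (-(x ^ 2 + d ^ 2) / (4 * τ)) ≤ gk τ x d := by
  unfold gk
  have := S_ge (show 0 < x * d / (2 * τ) by positivity)
  nlinarith [Real.exp_pos (-(x ^ 2 + d ^ 2) / (4 * τ))]

lemma gk_upper {τ x d : ℝ} (hτ : 0 < τ) (hx : 0 < x) (hd : 0 < d) :
    gk τ x d ≤ Real.exp (-(d ^ 2 / (4 * τ)) * (1 - x ^ 2 / (2 * τ))) := by
  unfold gk
  have h1 := S_le (show 0 < x * d / (2 * τ) by positivity)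
  have h2 := Real.cosh_le_exp_half_sq (x * d / (2 * τ))
  calc _ ≤ Real.exp (-(x ^ 2 + d ^ 2) / (4 * τ)) * Real.exp ((x * d / (2 * τ)) ^ 2 / 2) := by
        gcongr; exact h1.trans h2
    _ = Real.exp (-(x ^ 2 + d ^ 2) / (4 * τ) + (x * d / (2 * τ)) ^ 2 / 2) := by rw [← Real.exp_add]
    _ ≤ _ := by
        apply Real.exp_le_exp.2
        have : -(d ^ 2 / (4 * τ)) * (1 - x ^ 2 / (2 * τ)) =
          -(x ^ 2 + d ^ 2) / (4 * τ) + (x * d / (2 * τ)) ^ 2 / 2 + x ^ 2 / (4 * τ) := by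
            field_simp; ring
        rw [this]
        have : 0 ≤ x ^ 2 / (4 * τ) := by positivity
        linarith

lemma gk_le_one {τ x d : ℝ} (hτ : 0 < τ) (hx : 0 < x) (hd : 0 ≤ d) : gk τ x d ≤ 1 := by
  rcases hd.eq_or_lt with rfl | hd
  · simp [gk]
  unfold gk
  have hu : 0 < x * d / (2 * τ) := by positivity
  have h1 := S_le hu
  have h2 : Real.cosh (x * d / (2 * τ)) ≤ Real.exp (x * d / (2 * τ)) := by
    rw [Real.cosh_eq]
    have : Real.exp (-(x * d / (2 * τ))) ≤ Real.exp (x * d / (2 * τ)) := Real.exp_le_exp.2 (by linarith)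
    linarith
  calc _ ≤ Real.exp (-(x ^ 2 + d ^ 2) / (4 * τ)) * Real.exp (x * d / (2 * τ)) := by
        gcongr; exact h1.trans h2
    _ = Real.exp (-(x - d) ^ 2 / (4 * τ)) := by
        rw [← Real.exp_add]; congr 1; field_simp; ring
    _ ≤ 1 := by
        rw [Real.exp_le_one_iff]
        apply div_nonpos_of_nonpos_of_nonneg <;> nlinarith [sq_nonneg (x - d)]

lemma gk_nonneg {τ x d : ℝ} (hτ : 0 < τ) (hx : 0 < x) (hd : 0 ≤ d) : 0 ≤ gk τ x d := by
  rcases hd.eq_or_lt with rfl | hd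
  · simp [gk]
  exact (Real.exp_pos _).le.trans (gk_lower hτ hx hd)

lemma one_sub_gk {τ x d : ℝ} (hτ : 0 < τ) (hx : 0 < x) (hd : 0 < d) :
    1 - gk τ x d ≤ (x ^ 2 + d ^ 2) / (4 * τ) := by
  have h1 := gk_lower hτ hx hd
  have h2 := Real.add_one_le_exp (-(x ^ 2 + d ^ 2) / (4 * τ))
  have : -(x ^ 2 + d ^ 2) / (4 * τ) = -((x ^ 2 + d ^ 2) / (4 * τ)) := by ring
  linarith

lemma hk_diff {τ x : ℝ} (hτ : 0 < τ) (hx : 0 < x) (d : ℝ) :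
    hk τ (x - d) - hk τ (x + d) = x / (2 * √π) * ((1 / τ) ^ (3/2:ℝ) * (d * gk τ x d)) := by
  have e1 : (1 / τ) ^ (3/2:ℝ) = 1 / (τ * √τ) := by
    rw [show (3/2:ℝ) = 1 + 1/2 by norm_num, Real.rpow_add (by positivity), Real.rpow_one,
      ← Real.sqrt_eq_rpow, Real.sqrt_div (by norm_num)]
    simp; ring
  rcases eq_or_ne d 0 with rfl | hd
  · simp
  rw [e1]
  unfold hk gk
  rw [Real.sinh_eq]
  have e2 : Real.exp (-(x - d) ^ 2 / (4 * τ)) = Real.exp (-(x ^ 2 + d ^ 2) / (4 * τ)) * Real.exp (x * d / (2 * τ)) := by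
    rw [← Real.exp_add]; congr 1; field_simp; ring
  have e3 : Real.exp (-(x + d) ^ 2 / (4 * τ)) = Real.exp (-(x ^ 2 + d ^ 2) / (4 * τ)) * Real.exp (-(x * d / (2 * τ))) := by
    rw [← Real.exp_add]; congr 1; field_simp; ring
  rw [e2, e3, show 4 * π * τ = 2 ^ 2 * (π * τ) by ring, Real.sqrt_mul (by norm_num), Real.sqrt_sq (by norm_num),
    Real.sqrt_mul Real.pi_pos.le]
  have h1 : √π ≠ 0 := by positivity
  have h2 : √τ ≠ 0 := by positivity
  field_simp

variable {M : ℝ → ℝ} {w : ℝ → ℝ → ℝ≥0∞} {J : Measure ℝ}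

/-- initial mass -/
noncomputable def mu0 (w : ℝ → ℝ → ℝ≥0∞) : Measure ℝ := volume.withDensity (fun y => w y 0)

lemma AD.mu0_fin (h : AD M w J) : IsFiniteMeasure (mu0 w) := by
  unfold mu0
  exact isFiniteMeasure_withDensity h.integ

lemma AD.mu0_lint (h : AD M w J) {f : ℝ → ℝ≥0∞} (hf : Measurable f) :
    ∫⁻ y, f y ∂(mu0 w) = ∫⁻ y, f y * w y 0 := by
  unfold mu0
  rw [lintegral_withDensity_eq_lintegral_mul _ (h.meas 0) hf]
  apply lintegral_congr; intro y; simp [mul_comm]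

lemma AD.mu0_neg (h : AD M w J) : ∀ᵐ y ∂(mu0 w), M 0 < y := by
  rw [ae_iff]
  unfold mu0
  have hs : MeasurableSet {a | ¬ M 0 < a} := by simp only [not_lt]; exact measurableSet_Iic
  rw [withDensity_apply _ hs, setLIntegral_congr_fun (g := fun _ => 0) hs]
  · simp
  · intro y hy
    exact h.zero 0 le_rfl y (not_lt.1 hy)

/-- normalised solution near the boundary -/
noncomputable def Wn (M : ℝ → ℝ) (w : ℝ → ℝ → ℝ≥0∞) (x t : ℝ) : ℝ :=
  2 * √π * t ^ (3/2:ℝ) * (w (M t + x) t).toReal / x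

lemma toReal_lint {μ : Measure ℝ} {f : ℝ → ℝ} (hf : Measurable f) (h0 : ∀ x, 0 ≤ f x)
    (hfin : ∫⁻ x, ENNReal.ofReal (f x) ∂μ ≠ ∞) :
    Integrable f μ ∧ (∫⁻ x, ENNReal.ofReal (f x) ∂μ).toReal = ∫ x, f x ∂μ := by
  constructor
  · refine ⟨hf.aestronglyMeasurable, ?_⟩
    rw [hasFiniteIntegral_iff_ofReal (Eventually.of_forall h0)]
    exact lt_top_iff_ne_top.2 hfin
  · rw [integral_eq_lintegral_of_nonneg_ae (Eventually.of_forall h0) hf.aestronglyMeasurable]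

lemma AD.Fx (h : AD M w J) {t x : ℝ} (ht : 0 < t) (hx : 0 < x) :
    w (M t + x) t ≠ ∞ ∧
    Integrable (fun y => (y - M t) * gk t x (y - M t)) (mu0 w) ∧
    IntegrableOn (fun s => (t / (t - s)) ^ (3/2:ℝ) * ((M s - M t) * gk (t - s) x (M s - M t))) (Ioo 0 t) J ∧
    Wn M w x t = (∫ y, (y - M t) * gk t x (y - M t) ∂(mu0 w)) -
      ∫ s in Ioo 0 t, (t / (t - s)) ^ (3/2:ℝ) * ((M s - M t) * gk (t - s) x (M s - M t)) ∂J := by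
  have hMm := h.cont.measurable
  have hr : ∀ X, ∫⁻ y, ENNReal.ofReal (hk t (X - y)) * w y 0 ≠ ∞ := by
    intro X
    have : ∫⁻ y, ENNReal.ofReal (hk t (X - y)) * w y 0 ≤ ∫⁻ y, ENNReal.ofReal ((√(4 * π * t))⁻¹) * w y 0 := by
      apply lintegral_mono
      intro y
      simp only
      gcongr
      exact hk_le ht _
    rw [lintegral_const_mul _ (h.meas 0)] at this
    exact ne_top_of_le_ne_top (ENNReal.mul_ne_top (by simp) h.integ) this
  have i1 := h.ident 0 le_rfl t ht (M t + x) (by linarith)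
  have i2 := h.ident 0 le_rfl t ht (M t - x) (by linarith)
  rw [h.zero t ht.le (M t - x) (by linarith), zero_add] at i2
  rw [sub_zero] at i1 i2
  have r1 := hr (M t + x)
  have r2 := hr (M t - x)
  rw [← h.mu0_lint (hk_meas_right t _)] at i1 i2 r1 r2
  have a1 : ∫⁻ y, ENNReal.ofReal (hk t (M t + x - y)) ∂(mu0 w) =
      ∫⁻ y, ENNReal.ofReal (hk t (x - (y - M t))) ∂(mu0 w) := by
    apply lintegral_congr; intro y; congr 2; ring
  have a2 : ∫⁻ y, ENNReal.ofReal (hk t (M t - x - y)) ∂(mu0 w) =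
      ∫⁻ y, ENNReal.ofReal (hk t (x + (y - M t))) ∂(mu0 w) := by
    apply lintegral_congr; intro y; rw [← hk_neg]; congr 2; ring
  have a3 : ∫⁻ u in Ioo 0 t, ENNReal.ofReal (hk (t - u) (M t + x - M u)) ∂J =
      ∫⁻ u in Ioo 0 t, ENNReal.ofReal (hk (t - u) (x - (M u - M t))) ∂J := by
    apply lintegral_congr; intro y; congr 2; ring
  have a4 : ∫⁻ u in Ioo 0 t, ENNReal.ofReal (hk (t - u) (M t - x - M u)) ∂J =
      ∫⁻ u in Ioo 0 t, ENNReal.ofReal (hk (t - u) (x + (M u - M t))) ∂J := by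
    apply lintegral_congr; intro y; rw [← hk_neg]; congr 2; ring
  rw [a1] at i1 r1
  rw [a2] at i2 r2
  rw [a3] at i1
  rw [a4] at i2
  have hw1 : w (M t + x) t ≠ ∞ := ne_top_of_le_ne_top r1 (by rw [← i1]; exact le_self_add)
  have hj1 : ∫⁻ u in Ioo 0 t, ENNReal.ofReal (hk (t - u) (x - (M u - M t))) ∂J ≠ ∞ :=
    ne_top_of_le_ne_top r1 (by rw [← i1]; exact le_add_self)
  have hj2 : ∫⁻ u in Ioo 0 t, ENNReal.ofReal (hk (t - u) (x + (M u - M t))) ∂J ≠ ∞ := by rw [i2]; exact r2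
  have m1 : Measurable fun y => hk t (x - (y - M t)) := by unfold hk; fun_prop
  have m2 : Measurable fun y => hk t (x + (y - M t)) := by unfold hk; fun_prop
  have m3 : Measurable fun u => hk (t - u) (x - (M u - M t)) := by unfold hk; fun_prop
  have m4 : Measurable fun u => hk (t - u) (x + (M u - M t)) := by unfold hk; fun_prop
  obtain ⟨b1, c1⟩ := toReal_lint m1 (fun _ => hk_nonneg _ _) r1
  obtain ⟨b2, c2⟩ := toReal_lint m2 (fun _ => hk_nonneg _ _) r2
  obtain ⟨b3, c3⟩ := toReal_lint m3 (fun _ => hk_nonneg _ _) hj1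
  obtain ⟨b4, c4⟩ := toReal_lint m4 (fun _ => hk_nonneg _ _) hj2
  have j1 := congrArg ENNReal.toReal i1
  have j2 := congrArg ENNReal.toReal i2
  rw [ENNReal.toReal_add hw1 hj1, c1, c3] at j1
  rw [c2, c4] at j2
  have hpi : 0 < √π := by positivity
  have htp : 0 < t ^ (3/2:ℝ) := by positivity
  have key : (w (M t + x) t).toReal = (∫ y, (hk t (x - (y - M t)) - hk t (x + (y - M t))) ∂(mu0 w)) -
      ∫ s in Ioo 0 t, (hk (t - s) (x - (M s - M t)) - hk (t - s) (x + (M s - M t))) ∂J := by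
    rw [integral_sub b1 b2, integral_sub b3 b4]; linarith
  have e1 : ∀ y, (y - M t) * gk t x (y - M t) = (2 * √π * t ^ (3/2:ℝ) / x) *
      (hk t (x - (y - M t)) - hk t (x + (y - M t))) := by
    intro y
    rw [hk_diff ht hx, one_div, Real.inv_rpow ht.le]
    field_simp
  have e2 : ∀ s ∈ Ioo 0 t, (t / (t - s)) ^ (3/2:ℝ) * ((M s - M t) * gk (t - s) x (M s - M t)) =
      (2 * √π * t ^ (3/2:ℝ) / x) * (hk (t - s) (x - (M s - M t)) - hk (t - s) (x + (M s - M t))) := by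
    intro s hs
    have : 0 < t - s := by linarith [hs.2]
    rw [hk_diff this hx, one_div, Real.inv_rpow this.le, Real.div_rpow ht.le this.le]
    have : 0 < (t - s) ^ (3/2:ℝ) := by positivity
    field_simp
  have f2 : IntegrableOn (fun s => (t / (t - s)) ^ (3/2:ℝ) * ((M s - M t) * gk (t - s) x (M s - M t))) (Ioo 0 t) J :=
    IntegrableOn.congr_fun ((b3.sub b4).const_mul (2 * √π * t ^ (3/2:ℝ) / x)) (fun s hs => (e2 s hs).symm) measurableSet_Ioo
  refine ⟨hw1, ?_, f2, ?_⟩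
  · simp_rw [e1]
    exact (b1.sub b2).const_mul _
  · simp_rw [e1]
    rw [setIntegral_congr_fun measurableSet_Ioo e2, integral_const_mul, integral_const_mul, ← mul_sub, ← key]
    unfold Wn
    ring

end PartH

open MeasureTheory ProbabilityTheory Filter Real Set Asymptotics
open scoped NNReal ENNReal Topology
set_option linter.all false
set_option linter.deprecated false

section PartI
variable {M : ℝ → ℝ} {w : ℝ → ℝ → ℝ≥0∞} {J : Measure ℝ}

lemma Nf_upper2 : ∃ K ≥ 0, ∀ δ > 0, ∫⁻ x in Ioi 0, ENNReal.ofReal (x ^ 2) * Nf δ x ≤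
    ENNReal.ofReal (K * (δ * √δ)) := by
  set G := 2 * ((√(4 * π))⁻¹ * (4 ^ (((3:ℝ) + 1) / 2) * (1 / 2) * Real.Gamma ((3 + 1) / 2))) with hG
  have hGp : 0 ≤ G := by
    have := Real.Gamma_pos_of_pos (show 0 < ((3:ℝ) + 1) / 2 by norm_num)
    positivity
  refine ⟨G, hGp, ?_⟩
  intro δ hδ
  have hb : ∀ n : ℕ, ∫⁻ x in Ioc 0 (n:ℝ), ENNReal.ofReal (x^2) * Nf δ x ≤ ENNReal.ofReal (G * (δ * √δ)) := by
    intro n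
    have := lint_mul_Nf δ (fun x => ENNReal.ofReal (x^2)) (by fun_prop) 0 n
    simp only [add_zero, sub_zero] at this
    rw [this]
    calc _ ≤ ∫⁻ v in Ioi 0, ENNReal.ofReal (2 * (v ^ (3:ℝ) * hk δ v)) := by
          rw [← lintegral_indicator measurableSet_Ioi]
          apply lintegral_mono
          intro v
          simp only
          by_cases hv : 0 < v
          · rw [indicator_of_mem (show v ∈ Ioi 0 from hv)]
            have h1 : ∫⁻ x in Ioc 0 (min (n:ℝ) v), ENNReal.ofReal (x^2) ≤ ENNReal.ofReal (v^2 * v) := by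
              calc _ ≤ ∫⁻ x in Ioc 0 (min (n:ℝ) v), ENNReal.ofReal (v^2) := by
                    apply setLIntegral_mono' measurableSet_Ioc
                    intro x hx
                    apply ENNReal.ofReal_le_ofReal
                    have := hx.1; have := hx.2.trans (min_le_right _ _)
                    gcongr
                _ = ENNReal.ofReal (v^2) * ENNReal.ofReal (min (n:ℝ) v - 0) := by
                    rw [setLIntegral_const, Real.volume_Ioc]
                _ ≤ ENNReal.ofReal (v^2) * ENNReal.ofReal v := by
                    gcongr; simp
                _ = _ := by rw [← ENNReal.ofReal_mul (by positivity)]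
            calc _ ≤ ENNReal.ofReal (hk δ v) * (ENNReal.ofReal 2 * ENNReal.ofReal (v^2*v)) := by
                  gcongr; simp
              _ = _ := by
                  rw [← ENNReal.ofReal_mul (by norm_num), ← ENNReal.ofReal_mul (hk_nonneg _ _)]
                  congr 1
                  rw [show (3:ℝ) = ((3:ℕ):ℝ) by norm_num, Real.rpow_natCast]; ring
          · rw [indicator_of_notMem (by simpa using hv)]
            have : Ioc 0 (min (n:ℝ) v) = ∅ := Ioc_eq_empty (by
              push Not; exact (min_le_right _ _).trans (not_lt.1 hv))
            simp [this]
      _ = _ := by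
          rw [← ofReal_integral_eq_lintegral_ofReal ((hk_mom hδ (by norm_num)).1.const_mul 2), integral_const_mul,
            (hk_mom hδ (by norm_num)).2]
          · congr 1
            rw [hG, Real.mul_rpow (by norm_num) hδ.le, Real.sqrt_mul (by positivity),
              show ((3:ℝ) + 1)/2 = 2 by norm_num, Real.rpow_two δ]
            have h0 : √(4*π) ≠ 0 := by positivity
            have h1 : √δ ≠ 0 := by positivity
            have h2 : √δ * √δ = δ := Real.mul_self_sqrt hδ.le
            field_simp
            rw [pow_two √δ, h2]
          · filter_upwards [ae_restrict_mem measurableSet_Ioi] with x hx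
            exact mul_nonneg (by norm_num) (mul_nonneg (Real.rpow_nonneg (le_of_lt hx) _) (hk_nonneg _ _))
  have hun : Ioi (0:ℝ) = ⋃ n : ℕ, Ioc (0:ℝ) n := by
    ext u
    simp only [mem_Ioi, mem_iUnion, mem_Ioc]
    constructor
    · intro hu
      obtain ⟨n, hn⟩ := exists_nat_gt u
      exact ⟨n, hu, hn.le⟩
    · rintro ⟨n, h, -⟩; exact h
  rw [hun, setLIntegral_iUnion_of_directed]
  · exact iSup_le hb
  · apply directed_of_isDirected_le
    intro i j hij
    apply Ioc_subset_Ioc_right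
    exact_mod_cast hij

lemma AD.flux_up2 (h : AD M w J) {L : ℝ} (hL : 0 ≤ L) : ∃ K ≥ 0, ∀ t ≥ 0, ∀ D ≥ 0, ∀ E ≥ 0,
    (∀ s s', t ≤ s → s ≤ s' → 0 ≤ M s - M s' ∧ M s - M s' ≤ L * (s' - s)) →
    (∀ x > 0, w (M t + x) t ≤ ENNReal.ofReal (D * x + E * x ^ 2)) → ∀ δ > 0,
    J (Ioo t (t + δ)) ≤ ENNReal.ofReal (D * δ + E * (K * (δ * √δ))) +
      ENNReal.ofReal (L * √δ) * J (Ioo t (t + δ)) := by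
  obtain ⟨K, hK, hK2⟩ := Nf_upper2
  refine ⟨K, hK, ?_⟩
  intro t ht D hD E hE hM hw δ hδ
  have hf := h.flux ht (show t < t + δ by linarith)
  rw [show t + δ - t = δ by ring] at hf
  have hmN : Measurable (Nf δ) := (Nf_anti δ).measurable
  have hR : ∫⁻ y, Nf δ (y - M (t + δ)) * w y t ≤ ENNReal.ofReal (D * δ + E * (K * (δ * √δ))) := by
    calc _ = ∫⁻ x, Nf δ (x + M t - M (t + δ)) * w (x + M t) t := (lintegral_add_right_eq_self _ (M t)).symm
      _ ≤ ∫⁻ x in Ioi 0, (ENNReal.ofReal D * (ENNReal.ofReal x * Nf δ x) +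
            ENNReal.ofReal E * (ENNReal.ofReal (x^2) * Nf δ x)) := by
        rw [← lintegral_indicator measurableSet_Ioi]
        apply lintegral_mono
        intro x
        simp only
        by_cases hx : 0 < x
        · rw [indicator_of_mem (show x ∈ Ioi 0 from hx)]
          have h1 := hw x hx
          rw [ENNReal.ofReal_add (by positivity) (by positivity), ENNReal.ofReal_mul hD, ENNReal.ofReal_mul hE] at h1
          rw [← mul_assoc, ← mul_assoc, ← add_mul, mul_comm]
          refine mul_le_mul' ?_ ?_
          · rw [add_comm x]; exact h1
          · apply Nf_anti
            have := (hM t (t + δ) le_rfl (by linarith)).1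
            linarith
        · rw [h.zero t ht _ (by linarith)]; simp
      _ = ENNReal.ofReal D * (∫⁻ x in Ioi 0, ENNReal.ofReal x * Nf δ x) +
          ENNReal.ofReal E * ∫⁻ x in Ioi 0, ENNReal.ofReal (x^2) * Nf δ x := by
        rw [lintegral_add_left (by fun_prop), lintegral_const_mul' _ _ (by simp), lintegral_const_mul' _ _ (by simp)]
      _ ≤ _ := by
        rw [ENNReal.ofReal_add (by positivity) (by positivity), ENNReal.ofReal_mul hD, ENNReal.ofReal_mul hE]
        refine add_le_add (mul_le_mul' le_rfl (Nf_upper hδ)) (mul_le_mul' le_rfl (hK2 δ hδ))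
  rw [← hf] at hR
  calc J (Ioo t (t + δ)) = ∫⁻ u in Ioo t (t + δ), 1 ∂J := by simp
    _ ≤ ∫⁻ u in Ioo t (t + δ), (Nf (t + δ - u) (M u - M (t + δ)) + ENNReal.ofReal (L * √δ)) ∂J := by
      apply setLIntegral_mono' measurableSet_Ioo
      intro u hu
      have hτ : 0 < t + δ - u := by linarith [hu.2]
      obtain ⟨hm1, hm2⟩ := hM u (t + δ) hu.1.le hu.2.le
      refine (Nf_ge hτ hm1).trans ?_
      refine add_le_add le_rfl (ENNReal.ofReal_le_ofReal ?_)
      set τ := t + δ - u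
      have hτδ : τ ≤ δ := by simp only [τ]; linarith [hu.1]
      calc 2 * (M u - M (t + δ)) * (√(4 * π * τ))⁻¹ ≤ 2 * (L * τ) * (√(4 * τ))⁻¹ := by
            gcongr
            nlinarith [Real.pi_gt_three]
        _ = L * √τ := by
            rw [show (4:ℝ) * τ = 2^2 * τ by ring, Real.sqrt_mul (by norm_num), Real.sqrt_sq (by norm_num)]
            have h1 : √τ * √τ = τ := Real.mul_self_sqrt hτ.le
            have h2 : √τ ≠ 0 := by positivity
            field_simp
            rw [pow_two, h1]
        _ ≤ L * √δ := by gcongr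
    _ = _ := by
      rw [lintegral_add_right _ measurable_const, setLIntegral_const]
    _ ≤ _ := by gcongr

lemma density_of_lip {ν : Measure ℝ} [IsFiniteMeasure ν] {K : ℝ} (hK : 0 ≤ K)
    (h : ∀ a b, a ≤ b → ν (Ioc a b) ≤ ENNReal.ofReal (K * (b - a))) :
    ∃ j : ℝ → ℝ, Measurable j ∧ (∀ s, 0 ≤ j s) ∧ Integrable j ∧
      ν = volume.withDensity (fun s => ENNReal.ofReal (j s)) := by
  set F : ℝ → ℝ := fun x => (ν (Iic x)).toReal with hF
  have hFd : ∀ a b, a ≤ b → ν (Ioc a b) = ENNReal.ofReal (F b - F a) := by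
    intro a b hab
    have : Ioc a b = Iic b \ Iic a := by ext; simp [and_comm]
    rw [this, measure_diff (Iic_subset_Iic.2 hab) measurableSet_Iic.nullMeasurableSet (measure_ne_top _ _), hF,
      ENNReal.ofReal_sub _ ENNReal.toReal_nonneg, ENNReal.ofReal_toReal (measure_ne_top _ _),
      ENNReal.ofReal_toReal (measure_ne_top _ _)]
  have hFm : Monotone F := fun a b hab => ENNReal.toReal_mono (measure_ne_top _ _) (measure_mono (Iic_subset_Iic.2 hab))
  have hFl : ∀ a b, a ≤ b → F b - F a ≤ K * (b - a) := by
    intro a b hab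
    have := h a b hab
    rw [hFd a b hab] at this
    exact (ENNReal.ofReal_le_ofReal_iff (mul_nonneg hK (by linarith))).1 this
  have hFlip : LipschitzWith K.toNNReal F := by
    apply LipschitzWith.of_dist_le_mul
    intro a b
    rw [Real.coe_toNNReal _ hK, Real.dist_eq, Real.dist_eq]
    rcases le_total a b with hab | hab
    · rw [abs_sub_comm, abs_sub_comm a, abs_of_nonneg (by linarith [hFm hab]), abs_of_nonneg (by linarith)]
      exact hFl a b hab
    · rw [abs_of_nonneg (by linarith [hFm hab]), abs_of_nonneg (by linarith)]
      exact hFl b a hab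
  let g : StieltjesFunction ℝ :=
    { toFun := fun x => K * x - F x
      mono' := by
        intro a b hab
        have := hFl a b hab
        simp only
        nlinarith
      right_continuous' := by
        intro x
        exact ((continuous_const.mul continuous_id).sub hFlip.continuous).continuousWithinAt }
  have hsum : ν + g.measure = (ENNReal.ofReal K) • volume := by
    symm
    apply Measure.ext_of_Ioc'
    · intro a b hab
      rw [Measure.smul_apply, Real.volume_Ioc, smul_eq_mul]
      exact ENNReal.mul_ne_top (by simp) (by simp)
    intro a b hab
    symm
    rw [Measure.add_apply, hFd a b hab.le, StieltjesFunction.measure_Ioc, Measure.smul_apply, Real.volume_Ioc,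
      smul_eq_mul, ← ENNReal.ofReal_mul hK, ← ENNReal.ofReal_add]
    · congr 1
      show F b - F a + ((K * b - F b) - (K * a - F a)) = _
      ring
    · linarith [hFm hab.le]
    · show 0 ≤ (K * b - F b) - (K * a - F a)
      linarith [hFl a b hab.le]
  have hle : ν ≤ (ENNReal.ofReal K) • volume := by
    rw [← hsum]; exact Measure.le_add_right le_rfl
  have hac : ν ≪ volume := by
    refine (Measure.absolutelyContinuous_of_le hle).trans ?_
    exact Measure.smul_absolutelyContinuous
  have hfin := Measure.rnDeriv_lt_top ν volume
  refine ⟨fun s => (ν.rnDeriv volume s).toReal, (Measure.measurable_rnDeriv _ _).ennreal_toReal,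
    fun s => ENNReal.toReal_nonneg, Measure.integrable_toReal_rnDeriv, ?_⟩
  conv_lhs => rw [← Measure.withDensity_rnDeriv_eq ν volume hac]
  apply withDensity_congr_ae
  filter_upwards [hfin] with s hs
  rw [ENNReal.ofReal_toReal hs.ne]

lemma AD.density (h : AD M w J) {T L K : ℝ} (hT : 0 ≤ T) (hL : 0 ≤ L) (hK : 0 ≤ K)
    (hM : ∀ s s', T ≤ s → s ≤ s' → 0 ≤ M s - M s' ∧ M s - M s' ≤ L * (s' - s))
    (hw : ∀ t ≥ T, ∀ x > 0, w (M t + x) t ≤ ENNReal.ofReal (K * x)) :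
    ∃ j : ℝ → ℝ, Measurable j ∧ (∀ s, 0 ≤ j s) ∧ Integrable j ∧
      J.restrict (Ioi T) = volume.withDensity (fun s => ENNReal.ofReal (j s)) ∧
      ∀ᵐ t, T < t → (∀ D ≥ 0, ∀ E ≥ 0, (∀ x > 0, w (M t + x) t ≤ ENNReal.ofReal (D * x + E * x ^ 2)) → j t ≤ D) ∧
        (∀ D ≥ 0, (∀ x ∈ Ioc (0:ℝ) 1, ENNReal.ofReal (D * x) ≤ w (M t + x) t) → D ≤ j t) := by
  haveI := h.finite
  have hmono : ∀ t ≥ T, ∀ s s', t ≤ s → s ≤ s' → 0 ≤ M s - M s' ∧ M s - M s' ≤ L * (s' - s) :=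
    fun t ht s s' hs hs' => hM s s' (ht.trans hs) hs'
  -- small increments
  set δ0 : ℝ := (1 / (2 * (L + 1))) ^ 2 with hδ0
  have hδpos : 0 < δ0 := by positivity
  have hsm : ∀ δ, 0 < δ → δ ≤ δ0 → L * √δ ≤ 1 / 2 := by
    intro δ h1 h2
    have : √δ ≤ 1 / (2 * (L + 1)) := by
      rw [show 1 / (2 * (L + 1)) = √δ0 by rw [hδ0, Real.sqrt_sq (by positivity)]]
      exact Real.sqrt_le_sqrt h2
    calc L * √δ ≤ L * (1 / (2 * (L + 1))) := by gcongr
      _ ≤ 1 / 2 := by rw [mul_one_div, div_le_div_iff₀ (by positivity) (by positivity)]; nlinarith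
  have hoo : ∀ t ≥ T, ∀ δ, 0 < δ → δ ≤ δ0 → (J (Ioo t (t + δ))).toReal ≤ 2 * K * δ := by
    intro t ht δ h1 h2
    have := h.flux_up (hT.trans ht) hL hK (hmono t ht) (hw t ht) h1
    have hfin := measure_ne_top J (Ioo t (t + δ))
    have h3 := ENNReal.toReal_mono (by
      refine ENNReal.add_ne_top.2 ⟨by simp, ENNReal.mul_ne_top (by simp) hfin⟩) this
    rw [ENNReal.toReal_add (by simp) (ENNReal.mul_ne_top (by simp) hfin), ENNReal.toReal_mul,
      ENNReal.toReal_ofReal (by positivity), ENNReal.toReal_ofReal (by positivity)] at h3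
    have h4 := hsm δ h1 h2
    have h5 : 0 ≤ (J (Ioo t (t + δ))).toReal := ENNReal.toReal_nonneg
    nlinarith
  have hoc : ∀ t ≥ T, ∀ δ, 0 < δ → δ ≤ δ0 / 2 → (J (Ioc t (t + δ))).toReal ≤ 2 * K * δ := by
    intro t ht δ h1 h2
    have : ∀ᶠ δ' in 𝓝[>] δ, (J (Ioc t (t + δ))).toReal ≤ 2 * K * δ' := by
      have : Ioo δ (2 * δ) ∈ 𝓝[>] δ := Ioo_mem_nhdsGT (by linarith)
      filter_upwards [this] with δ' hδ'
      refine le_trans ?_ (hoo t ht δ' (by linarith [hδ'.1]) (by linarith [hδ'.2]))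
      apply ENNReal.toReal_mono (measure_ne_top _ _)
      apply measure_mono
      intro u hu
      exact ⟨hu.1, by linarith [hu.2, hδ'.1]⟩
    refine ge_of_tendsto ?_ this
    have : Tendsto (fun δ' : ℝ => 2 * K * δ') (𝓝 δ) (𝓝 (2 * K * δ)) := by
      apply Continuous.tendsto; fun_prop
    exact this.mono_left nhdsWithin_le_nhds
  set F : ℝ → ℝ := fun x => (J (Iic x)).toReal with hF
  have hFd : ∀ a b, a ≤ b → (J (Ioc a b)).toReal = F b - F a := by
    intro a b hab
    have : Ioc a b = Iic b \ Iic a := by ext; simp [and_comm]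
    rw [this, measure_diff (Iic_subset_Iic.2 hab) measurableSet_Iic.nullMeasurableSet (measure_ne_top _ _), hF,
      ENNReal.toReal_sub_of_le (measure_mono (Iic_subset_Iic.2 hab)) (measure_ne_top _ _)]
  have hbig : ∀ a b, T ≤ a → a ≤ b → (J (Ioc a b)).toReal ≤ 2 * K * (b - a) := by
    intro a b ha hab
    have := telescope (D := F) (F := fun s => 2 * K * s) hab (show 0 < δ0 / 2 by positivity) (by
      intro s δ hs hs' h1 h2
      have h3 := hoc s (ha.trans hs) δ h1 h2
      rw [← hFd s (s + δ) (by linarith), abs_of_nonneg ENNReal.toReal_nonneg]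
      linarith)
    rw [hFd a b hab]
    have := le_abs_self (F b - F a)
    linarith
  obtain ⟨j, hjm, hj0, hji, hjJ⟩ := density_of_lip (ν := J.restrict (Ioi T)) (K := 2 * K) (by positivity) (by
    intro a b hab
    rw [Measure.restrict_apply measurableSet_Ioc, Ioc_inter_Ioi]
    rcases le_or_gt (max a T) b with h1 | h1
    · rw [← ENNReal.ofReal_toReal (measure_ne_top J (Ioc (max a T) b))]
      apply ENNReal.ofReal_le_ofReal
      refine (hbig _ _ (le_max_right _ _) h1).trans ?_
      have := le_max_left a T
      gcongr
    · rw [Ioc_eq_empty (not_lt.2 h1.le)]; simp)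
  refine ⟨j, hjm, hj0, hji, hjJ, ?_⟩
  obtain ⟨K1, hK1, hup⟩ := h.flux_up2 hL
  obtain ⟨K2, hK2, hlow⟩ := h.flux_low hL
  have hae := LocallyIntegrable.ae_hasDerivAt_integral hji.locallyIntegrable
  filter_upwards [hae] with t htd htT
  have hdt : Tendsto (fun δ => δ⁻¹ * ∫ x in t..(t+δ), j x) (𝓝[>] 0) (𝓝 (j t)) := by
    have := (htd t).tendsto_slope_zero_right
    simpa using this
  have hJd : ∀ δ > 0, (J (Ioo t (t + δ))).toReal = ∫ x in t..(t+δ), j x := by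
    intro δ hδ
    have : J (Ioo t (t + δ)) = (J.restrict (Ioi T)) (Ioo t (t + δ)) := by
      rw [Measure.restrict_apply measurableSet_Ioo]
      congr 1
      symm
      apply inter_eq_left.2
      intro u hu
      exact htT.trans hu.1
    rw [this, hjJ, withDensity_apply _ measurableSet_Ioo, intervalIntegral.integral_of_le (by linarith),
      integral_Ioc_eq_integral_Ioo, integral_eq_lintegral_of_nonneg_ae (ae_of_all _ hj0) hjm.aestronglyMeasurable]
  have hsq : Tendsto (fun δ : ℝ => √δ) (𝓝[>] 0) (𝓝 0) := by
    have : Tendsto (fun δ : ℝ => √δ) (𝓝 0) (𝓝 (√0)) := Real.continuous_sqrt.tendsto 0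
    rw [Real.sqrt_zero] at this
    exact this.mono_left nhdsWithin_le_nhds
  constructor
  · intro D hD E hE hw2
    have hlim : Tendsto (fun δ => D + E * K1 * √δ + L * √δ * (δ⁻¹ * ∫ x in t..(t+δ), j x)) (𝓝[>] 0)
        (𝓝 (D + E * K1 * 0 + L * 0 * j t)) := by
      exact ((tendsto_const_nhds.add (hsq.const_mul _)).add ((hsq.const_mul _).mul hdt))
    have hle : j t ≤ D + E * K1 * 0 + L * 0 * j t := by
      apply le_of_tendsto_of_tendsto hdt hlim
      filter_upwards [self_mem_nhdsWithin] with δ hδ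
      have hδ : 0 < δ := hδ
      have := hup t (hT.trans htT.le) D hD E hE (hmono t htT.le) hw2 δ hδ
      have hfin := measure_ne_top J (Ioo t (t + δ))
      have h3 := ENNReal.toReal_mono (by
        refine ENNReal.add_ne_top.2 ⟨by simp, ENNReal.mul_ne_top (by simp) hfin⟩) this
      rw [ENNReal.toReal_add (by simp) (ENNReal.mul_ne_top (by simp) hfin), ENNReal.toReal_mul,
        ENNReal.toReal_ofReal (by positivity), ENNReal.toReal_ofReal (by positivity), hJd δ hδ] at h3
      calc _ ≤ δ⁻¹ * (D * δ + E * (K1 * (δ * √δ)) + L * √δ * ∫ (x : ℝ) in t..t + δ, j x) := by gcongr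
        _ = _ := by field_simp
    linarith
  · intro D hD hw2
    have hlim : Tendsto (fun δ => D * (1 - K2 * √δ)) (𝓝[>] 0) (𝓝 (D * (1 - K2 * 0))) :=
      (tendsto_const_nhds.sub (hsq.const_mul _)).const_mul _
    have hle : D * (1 - K2 * 0) ≤ j t := by
      apply le_of_tendsto_of_tendsto hlim hdt
      filter_upwards [Ioc_mem_nhdsGT (show (0:ℝ) < 1 by norm_num)] with δ hδ
      have hδ0 : 0 < δ := hδ.1
      have := hlow t (hT.trans htT.le) D hD (hmono t htT.le) hw2 δ hδ
      rw [ENNReal.ofReal_le_iff_le_toReal (measure_ne_top _ _), hJd δ hδ0] at this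
      calc D * (1 - K2 * √δ) = δ⁻¹ * (D * (δ - K2 * δ ^ (3/2:ℝ))) := by
            rw [show (3/2:ℝ) = 1 + 1/2 by norm_num, Real.rpow_add hδ0, Real.rpow_one, ← Real.sqrt_eq_rpow]
            field_simp
        _ ≤ _ := by gcongr
    linarith

end PartI

open MeasureTheory ProbabilityTheory Filter Real Set Asymptotics
open scoped NNReal ENNReal Topology
set_option linter.all false
set_option linter.deprecated false

section PartJ

structure MH (M : ℝ → ℝ) (θ C T : ℝ) : Prop where
  T1 : 1 ≤ T
  θ0 : 0 < θ
  θ1 : θ < 1/2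
  C0 : 0 ≤ C
  est : ∀ s t, T ≤ s → s ≤ t → |M s - M t - (3/2) * Real.log (t/s)| ≤ C * s ^ (-θ) * (1 - s/t)
  small : C * T ^ (-θ) ≤ 1/2
  neg : ∀ t, T ≤ t → M t ≤ 0
  mono : ∀ s t, 0 ≤ s → s ≤ t → T ≤ t → M t ≤ M s
  zero : M 0 = 0

lemma mvt_cmp {f G f' G' : ℝ → ℝ} {s t : ℝ} (hst : s ≤ t)
    (hf : ∀ x ∈ Icc s t, HasDerivAt f (f' x) x) (hG : ∀ x ∈ Icc s t, HasDerivAt G (G' x) x)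
    (hle : ∀ x ∈ Icc s t, |f' x| ≤ G' x) : |f t - f s| ≤ G t - G s := by
  have h1 : MonotoneOn (fun x => G x - f x) (Icc s t) := by
    apply monotoneOn_of_deriv_nonneg (convex_Icc s t)
    · intro x hx; exact ((hG x hx).continuousAt.sub (hf x hx).continuousAt).continuousWithinAt
    · intro x hx; rw [interior_Icc] at hx
      exact (((hG x (Ioo_subset_Icc_self hx)).sub (hf x (Ioo_subset_Icc_self hx))).differentiableAt).differentiableWithinAt
    · intro x hx; rw [interior_Icc] at hx
      have hx := Ioo_subset_Icc_self hx
      have := ((hG x hx).sub (hf x hx)).deriv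
      rw [show (fun x => G x - f x) = G - f from rfl, this]
      linarith [le_abs_self (f' x), hle x hx]
  have h2 : MonotoneOn (fun x => G x + f x) (Icc s t) := by
    apply monotoneOn_of_deriv_nonneg (convex_Icc s t)
    · intro x hx; exact ((hG x hx).continuousAt.add (hf x hx).continuousAt).continuousWithinAt
    · intro x hx; rw [interior_Icc] at hx
      exact (((hG x (Ioo_subset_Icc_self hx)).add (hf x (Ioo_subset_Icc_self hx))).differentiableAt).differentiableWithinAt
    · intro x hx; rw [interior_Icc] at hx
      have hx := Ioo_subset_Icc_self hx
      have := ((hG x hx).add (hf x hx)).deriv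
      rw [show (fun x => G x + f x) = G + f from rfl, this]
      linarith [neg_abs_le (f' x), hle x hx]
  have a1 := h1 (left_mem_Icc.2 hst) (right_mem_Icc.2 hst) hst
  have a2 := h2 (left_mem_Icc.2 hst) (right_mem_Icc.2 hst) hst
  simp only at a1 a2
  rw [abs_le]; constructor <;> linarith

lemma hasDeriv_rpow_neg {q : ℝ} (K : ℝ) {x : ℝ} (hx : 0 < x) (hq : q ≠ 0) :
    HasDerivAt (fun y => -(K / q) * y ^ (-q)) (K * x ^ (-1 - q)) x := by
  have := (Real.hasDerivAt_rpow_const (p := -q) (Or.inl hx.ne')).const_mul (-(K / q))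
  refine this.congr_deriv ?_
  rw [show -q - 1 = -1 - q by ring]
  field_simp

lemma r_bounds {r : ℝ → ℝ} {η θ : ℝ} (hη : 0 < η) (hθ : 0 < θ) (hθη : θ ≤ η) (hθ1 : θ < 1)
    (hr : ContDiffOn ℝ 2 r (Ioi 0)) (hrlim : Tendsto r atTop (nhds 0))
    (hr'' : (fun t => deriv (deriv r) t) =O[atTop] fun t => t ^ (-2 - η)) :
    ∃ C ≥ 0, ∃ T ≥ 1, ∀ s t, T ≤ s → s ≤ t → |r s - r t| ≤ C * s ^ (-θ) * (1 - s / t) := by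
  obtain ⟨K, hK⟩ := hr''.bound
  obtain ⟨T0, hT0⟩ := eventually_atTop.1 hK
  set T := max T0 1
  have hT1 : 1 ≤ T := le_max_right _ _
  have hK0 : ∀ s, T ≤ s → |deriv (deriv r) s| ≤ |K| * s ^ (-1 - (1 + η)) := by
    intro s hs
    have := hT0 s ((le_max_left _ _).trans hs)
    have hs0 : 0 ≤ s := by linarith
    rw [Real.norm_eq_abs, Real.norm_eq_abs, abs_of_nonneg (Real.rpow_nonneg hs0 _)] at this
    rw [show -1 - (1 + η) = -2 - η by ring]
    refine this.trans ?_
    gcongr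
    exact le_abs_self K
  have hd1 : ∀ s, T ≤ s → HasDerivAt r (deriv r s) s := by
    intro s hs
    exact ((hr.contDiffAt (Ioi_mem_nhds (by linarith))).differentiableAt (by norm_num)).hasDerivAt
  have hr1 : ContDiffOn ℝ 1 (deriv r) (Ioi 0) := hr.deriv_of_isOpen isOpen_Ioi (by norm_num)
  have hd2 : ∀ s, T ≤ s → HasDerivAt (deriv r) (deriv (deriv r) s) s := by
    intro s hs
    exact ((hr1.contDiffAt (Ioi_mem_nhds (by linarith))).differentiableAt (by norm_num)).hasDerivAt
  set K1 := |K| / (1 + η) with hK1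
  have hK1p : 0 ≤ K1 := by positivity
  have hdiff : ∀ s t, T ≤ s → s ≤ t → |deriv r t - deriv r s| ≤ K1 * s ^ (-(1 + η)) := by
    intro s t hs hst
    have := mvt_cmp hst (f := deriv r) (f' := deriv (deriv r)) (G := fun y => -(|K| / (1 + η)) * y ^ (-(1 + η)))
      (G' := fun y => |K| * y ^ (-1 - (1 + η))) (fun x hx => hd2 x (hs.trans hx.1))
      (fun x hx => hasDeriv_rpow_neg |K| (by linarith [hx.1]) (by positivity)) (fun x hx => hK0 x (hs.trans hx.1))
    refine this.trans ?_
    have : 0 ≤ |K| / (1 + η) * t ^ (-(1 + η)) := mul_nonneg (by positivity) (Real.rpow_nonneg (by linarith) _)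
    simp only [hK1]
    linarith
  have hr1 : ∀ s, T ≤ s → |deriv r s| ≤ K1 * s ^ (-(1 + η)) := by
    intro s hs
    have hlin : ∀ t, s < t → |r t - r s - deriv r s * (t - s)| ≤ K1 * s ^ (-(1 + η)) * (t - s) := by
      intro t hst
      have := mvt_cmp hst.le (f := fun y => r y - deriv r s * y) (f' := fun y => deriv r y - deriv r s)
        (G := fun y => K1 * s ^ (-(1 + η)) * y) (G' := fun y => K1 * s ^ (-(1 + η)))
        (fun x hx => ((hd1 x (hs.trans hx.1)).sub ((hasDerivAt_id x).const_mul (deriv r s))).congr_deriv (by simp))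
        (fun x hx => by simpa using (hasDerivAt_id x).const_mul (K1 * s ^ (-(1 + η))))
        (fun x hx => hdiff s x hs hx.1)
      rw [show r t - r s - deriv r s * (t - s) = r t - deriv r s * t - (r s - deriv r s * s) by ring]
      linarith
    have hlim : Tendsto (fun t => |(r t - r s) / (t - s) - deriv r s|) atTop (𝓝 |0 - deriv r s|) := by
      apply Tendsto.abs
      apply Tendsto.sub_const
      exact (hrlim.sub_const _).div_atTop (tendsto_atTop_add_const_right _ _ tendsto_id)
    rw [zero_sub, abs_neg] at hlim
    apply le_of_tendsto hlim
    filter_upwards [eventually_gt_atTop s] with t ht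
    have h0 : 0 < t - s := by linarith
    have := hlin t ht
    rw [show (r t - r s) / (t - s) - deriv r s = (r t - r s - deriv r s * (t - s)) / (t - s) by field_simp,
      abs_div, abs_of_pos h0, div_le_iff₀ h0]
    exact this
  refine ⟨K1 / θ, by positivity, T, hT1, ?_⟩
  intro s t hs hst
  have hs0 : 0 < s := by linarith
  have ht0 : 0 < t := by linarith
  have := mvt_cmp hst (f := r) (f' := deriv r) (G := fun y => -(K1 / θ) * y ^ (-θ))
      (G' := fun y => K1 * y ^ (-1 - θ)) (fun x hx => hd1 x (hs.trans hx.1))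
      (fun x hx => hasDeriv_rpow_neg K1 (by linarith [hx.1]) (by positivity)) (fun x hx => by
        refine (hr1 x (hs.trans hx.1)).trans ?_
        gcongr
        · linarith [hx.1]
        · linarith)
  rw [abs_sub_comm]
  refine this.trans ?_
  have hu : s / t ≤ 1 := by rw [div_le_one ht0]; exact hst
  have hu0 : 0 < s / t := by positivity
  have h1 : s / t ≤ (s / t) ^ θ := by
    conv_lhs => rw [← Real.rpow_one (s / t)]
    exact Real.rpow_le_rpow_of_exponent_ge hu0 hu hθ1.le
  have h2 : t ^ (-θ) = s ^ (-θ) * (s / t) ^ θ := by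
    rw [Real.div_rpow hs0.le ht0.le, Real.rpow_neg hs0.le, Real.rpow_neg ht0.le]
    field_simp
  rw [h2]
  have h3 : 0 ≤ s ^ (-θ) := Real.rpow_nonneg hs0.le _
  have h4 : 0 ≤ K1 / θ * s ^ (-θ) := by positivity
  nlinarith

lemma MH_of {m r : ℝ → ℝ} {a η θ : ℝ} (hη : 0 < η) (hθ : 0 < θ) (hθη : θ ≤ η) (hθ1 : θ < 1/2)
    (hmC2 : ContDiff ℝ 2 m)
    (hm_eq : ∀ t, m t = 2 * t - (3/2) * Real.log (t + 1) + a + r t)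
    (hr0 : r 0 = -a) (hrlim : Tendsto r atTop (nhds 0))
    (hr'' : (fun t => deriv (deriv r) t) =O[atTop] fun t => t ^ (-2 - η)) :
    ∃ C T, MH (fun t => m t - 2 * t) θ C T := by
  have hr : ContDiffOn ℝ 2 r (Ioi 0) := by
    have : r = fun t => m t - 2 * t + (3/2) * Real.log (t + 1) - a := by
      ext t; rw [hm_eq t]; ring
    rw [this]
    apply ContDiffOn.sub _ contDiffOn_const
    apply ContDiffOn.add
    · exact (hmC2.sub (contDiff_const.mul contDiff_id)).contDiffOn
    · apply contDiffOn_const.mul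
      apply ContDiffOn.log
      · exact (contDiff_id.add contDiff_const).contDiffOn
      · intro x hx; simp only [mem_Ioi] at hx; linarith
  obtain ⟨C1, hC1, T1, hT1, hest1⟩ := r_bounds hη hθ hθη (by linarith) hr hrlim hr''
  set C := C1 + 3/2 with hC
  set M : ℝ → ℝ := fun t => m t - 2 * t with hM
  have hMe : ∀ t, M t = -(3/2) * Real.log (t + 1) + a + r t := by
    intro t; simp only [hM, hm_eq t]; ring
  have hest : ∀ s t, T1 ≤ s → s ≤ t → |M s - M t - (3/2) * Real.log (t/s)| ≤ C * s ^ (-θ) * (1 - s/t) := by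
    intro s t hs hst
    have hs0 : 0 < s := by linarith
    have ht0 : 0 < t := by linarith
    have h1 := hest1 s t hs hst
    have h2 : Real.log (t + 1) - Real.log (s + 1) - Real.log (t / s) =
        -Real.log (1 + (t - s) / (s * (t + 1))) := by
      rw [Real.log_div ht0.ne' hs0.ne']
      rw [show 1 + (t - s) / (s * (t + 1)) = (t * (s + 1)) / (s * (t + 1)) by field_simp; ring]
      rw [Real.log_div (by positivity) (by positivity), Real.log_mul (by positivity) (by positivity),
        Real.log_mul (by positivity) (by positivity)]
      ring
    have h3 : 0 ≤ (t - s) / (s * (t + 1)) := by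
      apply div_nonneg (by linarith) (by positivity)
    have h4 : 0 ≤ Real.log (1 + (t - s) / (s * (t + 1))) := Real.log_nonneg (by linarith)
    have h5 : Real.log (1 + (t - s) / (s * (t + 1))) ≤ (t - s) / (s * (t + 1)) := by
      have := Real.log_le_sub_one_of_pos (show 0 < 1 + (t - s) / (s * (t + 1)) by linarith)
      linarith
    have h6 : (t - s) / (s * (t + 1)) ≤ s ^ (-θ) * (1 - s / t) := by
      calc (t - s) / (s * (t + 1)) ≤ (t - s) / (s * t) := by
            apply div_le_div_of_nonneg_left (by linarith) (by positivity)
            gcongr; linarith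
        _ = s ^ (-1:ℝ) * (1 - s / t) := by rw [Real.rpow_neg_one]; field_simp
        _ ≤ _ := by
            apply mul_le_mul_of_nonneg_right
            · apply Real.rpow_le_rpow_of_exponent_le (by linarith) (by linarith)
            · rw [sub_nonneg, div_le_one ht0]; exact hst
    rw [show M s - M t - (3/2) * Real.log (t/s) = (r s - r t) + 3/2 * (Real.log (t + 1) - Real.log (s + 1) - Real.log (t / s)) by
      rw [hMe, hMe]; ring, h2]
    refine (abs_add_le _ _).trans ?_
    rw [abs_mul, abs_neg, abs_of_nonneg h4, abs_of_pos (show (0:ℝ) < 3/2 by norm_num), hC]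
    nlinarith
  have hTlim : Tendsto (fun T : ℝ => C * T ^ (-θ)) atTop (𝓝 (C * 0)) := (tendsto_rpow_neg_atTop hθ).const_mul _
  rw [mul_zero] at hTlim
  obtain ⟨T2, hT2⟩ := eventually_atTop.1 (hTlim.eventually_le_const (show (0:ℝ) < 1/2 by norm_num))
  set T3 := max T1 T2
  have hT3 : T1 ≤ T3 := le_max_left _ _
  have hdec : ∀ s t, T3 ≤ s → s ≤ t → M t ≤ M s := by
    intro s t hs hst
    have hs0 : 0 < s := by linarith
    have ht0 : 0 < t := by linarith
    have h1 := neg_abs_le (M s - M t - (3/2) * Real.log (t/s))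
    have h2 := hest s t (hT3.trans hs) hst
    have h3 := hT2 s ((le_max_right _ _).trans hs)
    have hu : 0 ≤ 1 - s / t := by rw [sub_nonneg, div_le_one ht0]; exact hst
    have h4 : 1 - s / t ≤ Real.log (t / s) := by
      have := Real.one_sub_inv_le_log_of_pos (show 0 < t / s by positivity)
      rwa [inv_div] at this
    nlinarith
  have hMc : ContinuousOn M (Icc 0 T3) := by
    exact (hmC2.continuous.sub (continuous_const.mul continuous_id)).continuousOn
  obtain ⟨B, hB⟩ := (isCompact_Icc.image_of_continuousOn hMc).bddBelow
  have hMlim : Tendsto M atTop atBot := by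
    have h1 : Tendsto (fun t : ℝ => -(3/2) * Real.log (t + 1)) atTop atBot := by
      apply Tendsto.const_mul_atTop_of_neg (by norm_num)
      exact Real.tendsto_log_atTop.comp (tendsto_atTop_add_const_right _ _ tendsto_id)
    have h2 := (h1.atBot_add (tendsto_const_nhds (x := a))).atBot_add hrlim
    refine h2.congr ?_
    intro t; rw [hMe]
  obtain ⟨T4, hT4⟩ := eventually_atTop.1 (hMlim.eventually (eventually_le_atBot (min B 0)))
  refine ⟨C, max T3 T4, ?_⟩
  have hTT : T3 ≤ max T3 T4 := le_max_left _ _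
  have hB2 : ∀ s ∈ Icc 0 T3, B ≤ M s := fun s hs => hB (mem_image_of_mem M hs)
  refine ⟨by linarith, hθ, hθ1, by positivity, fun s t hs => hest s t (by linarith), ?_, ?_, ?_, ?_⟩
  · exact hT2 _ ((le_max_right _ _).trans hTT)
  · intro t ht
    exact (hT4 t ((le_max_right _ _).trans ht)).trans (min_le_right _ _)
  · intro s t hs hst ht
    rcases le_or_gt s T3 with h | h
    · exact ((hT4 t ((le_max_right _ _).trans ht)).trans (min_le_left _ _)).trans (hB2 s ⟨hs, h⟩)
    · exact hdec s t h.le hst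
  · simp only [hM]; rw [hm_eq, hr0]; simp

variable {M : ℝ → ℝ} {θ C T : ℝ}

lemma neg_log_le {u ε : ℝ} (hu : 0 < u) (hu1 : u ≤ 1) (hε : 0 < ε) (hε1 : ε ≤ 1) :
    -Real.log u ≤ (1 / ε) * ((1 - u) * u ^ (-ε)) := by
  have h1 : Real.log (u ^ (-ε)) ≤ u ^ (-ε) - 1 := Real.log_le_sub_one_of_pos (Real.rpow_pos_of_pos hu _)
  rw [Real.log_rpow hu] at h1
  have h2 : u ≤ u ^ ε := by
    conv_lhs => rw [← Real.rpow_one u]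
    exact Real.rpow_le_rpow_of_exponent_ge hu hu1 hε1
  have h3 : u ^ ε * u ^ (-ε) = 1 := by rw [← Real.rpow_add hu]; simp
  have h4 : 0 < u ^ (-ε) := Real.rpow_pos_of_pos hu _
  rw [one_div, ← div_eq_inv_mul, le_div_iff₀ hε]
  nlinarith

lemma MH.lip (h : MH M θ C T) {s t : ℝ} (hs : T ≤ s) (hst : s ≤ t) :
    0 ≤ M s - M t ∧ M s - M t ≤ 2 * (t - s) := by
  have hT := h.T1
  have hs0 : 0 < s := by linarith
  have ht0 : 0 < t := by linarith
  refine ⟨by linarith [h.mono s t (by linarith) hst (by linarith)], ?_⟩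
  have h1 := le_abs_self (M s - M t - (3/2) * Real.log (t/s))
  have h2 := h.est s t hs hst
  have h3 : C * s ^ (-θ) ≤ 1/2 := by
    refine le_trans ?_ h.small
    have := h.C0
    have := Real.rpow_le_rpow_of_nonpos (show 0 < T by linarith) hs (show -θ ≤ 0 by linarith [h.θ0])
    gcongr
  have hu : 0 ≤ 1 - s / t := by rw [sub_nonneg, div_le_one ht0]; exact hst
  have h4 : Real.log (t / s) ≤ t / s - 1 := Real.log_le_sub_one_of_pos (by positivity)
  have h5 : t / s - 1 ≤ t - s := by
    rw [div_sub_one hs0.ne', div_le_iff₀ hs0]; nlinarith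
  have h6 : 1 - s / t ≤ t - s := by
    rw [one_sub_div ht0.ne', div_le_iff₀ ht0]; nlinarith
  nlinarith

lemma MH.ub (h : MH M θ C T) {ε : ℝ} (hε : 0 < ε) (hε1 : ε ≤ 1) {s t : ℝ} (hs : T ≤ s) (hst : s ≤ t) :
    M s - M t ≤ (2 / ε) * ((1 - s/t) * (s/t) ^ (-ε)) := by
  have hT := h.T1
  have hs0 : 0 < s := by linarith
  have ht0 : 0 < t := by linarith
  have h1 := le_abs_self (M s - M t - (3/2) * Real.log (t/s))
  have h2 := h.est s t hs hst
  have h3 : C * s ^ (-θ) ≤ 1/2 := by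
    refine le_trans ?_ h.small
    have := h.C0
    have := Real.rpow_le_rpow_of_nonpos (show 0 < T by linarith) hs (show -θ ≤ 0 by linarith [h.θ0])
    gcongr
  have hu1 : s / t ≤ 1 := by rw [div_le_one ht0]; exact hst
  have hu0 : 0 < s / t := by positivity
  have h4 := neg_log_le hu0 hu1 hε hε1
  have h5 : Real.log (t / s) = -Real.log (s / t) := by rw [← Real.log_inv, inv_div]
  have h6 : 1 ≤ (s / t) ^ (-ε) := Real.one_le_rpow_of_pos_of_le_one_of_nonpos hu0 hu1 (by linarith)
  have h7 : 1 ≤ 1 / ε := by rw [le_div_iff₀ hε]; linarith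
  have h8 : (1 - s / t) ≤ (1/ε) * ((1 - s/t) * (s/t) ^ (-ε)) := by
    have : 0 ≤ 1 - s / t := by linarith
    have := mul_le_mul_of_nonneg_left h6 this
    nlinarith
  rw [show (2 / ε) = 2 * (1 / ε) by ring]
  nlinarith

lemma MH.negM (h : MH M θ C T) {ε : ℝ} (hε : 0 < ε) (hε1 : ε ≤ 1) :
    ∃ K ≥ 1, ∀ t, T ≤ t → -M t ≤ K * t ^ ε := by
  refine ⟨2/ε + |M T| + 1, by have : 0 ≤ 2/ε := by positivity
                              linarith [abs_nonneg (M T)], ?_⟩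
  intro t ht
  have hT := h.T1
  have ht0 : 0 < t := by linarith
  have h1 := h.ub hε hε1 le_rfl ht
  have hTε : (T/t) ^ (-ε) ≤ t ^ ε := by
    rw [Real.rpow_neg (by positivity), ← Real.inv_rpow (by positivity), inv_div]
    apply Real.rpow_le_rpow (by positivity) _ hε.le
    exact div_le_self ht0.le hT
  have h2 : 1 ≤ t ^ ε := Real.one_le_rpow (by linarith) hε.le
  have h3 : (1 - T/t) * (T/t) ^ (-ε) ≤ t ^ ε := by
    have h4 : 0 ≤ T / t := by positivity
    have h5 : 0 ≤ (T/t) ^ (-ε) := Real.rpow_nonneg h4 _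
    nlinarith
  have h6 : 2 / ε * ((1 - T/t) * (T/t) ^ (-ε)) ≤ 2/ε * t^ε := by gcongr
  have := neg_abs_le (M T)
  have := abs_nonneg (M T)
  nlinarith

end PartJ

open MeasureTheory ProbabilityTheory Filter Real Set Asymptotics
open scoped NNReal ENNReal Topology
set_option linter.all false
set_option linter.deprecated false

section PartK
variable {M : ℝ → ℝ} {w : ℝ → ℝ → ℝ≥0∞} {J : Measure ℝ} {θ C T ε : ℝ}

structure SD (M : ℝ → ℝ) (w : ℝ → ℝ → ℝ≥0∞) (J : Measure ℝ) (θ C T ε : ℝ) (j : ℝ → ℝ) (K : ℝ) : Prop where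
  ad : AD M w J
  mh : MH M θ C T
  ε0 : 0 < ε
  εθ : θ + 16 * ε ≤ 1/2
  y1 : Integrable (fun y => y) (mu0 w)
  K1 : 1 ≤ K
  jm : Measurable j
  j0 : ∀ s, 0 ≤ j s
  ji : Integrable j
  jJ : J.restrict (Ioi T) = volume.withDensity (fun s => ENNReal.ofReal (j s))
  jub : ∀ᵐ t, T < t → j t ≤ K * t ^ (-3/2 + ε)
  jcmp : ∀ᵐ t, T < t → (∀ D ≥ 0, ∀ E ≥ 0, (∀ x > 0, w (M t + x) t ≤ ENNReal.ofReal (D * x + E * x ^ 2)) → j t ≤ D) ∧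
        (∀ D ≥ 0, (∀ x ∈ Ioc (0:ℝ) 1, ENNReal.ofReal (D * x) ≤ w (M t + x) t) → D ≤ j t)
  negM : ∀ t, T ≤ t → -M t ≤ K * t ^ ε
  mass : J.real univ = (mu0 w).real univ
  wub : ∀ t, T ≤ t → ∀ x > 0, Wn M w x t ≤ K * t ^ ε
  dub : ∀ s t, T ≤ s → s ≤ t → M s - M t ≤ K * ((1 - s/t) * (s/t) ^ (-ε))

lemma stepA (h : AD M w J) (hM : MH M θ C T) (hy : Integrable (fun y => y) (mu0 w)) {t x : ℝ} (ht : T ≤ t)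
    (hx : 0 < x) : Wn M w x t ≤ (∫ y, y ∂mu0 w) + (-M t) * (mu0 w).real univ := by
  have hT := hM.T1
  have ht0 : 0 < t := by linarith
  haveI := h.mu0_fin
  obtain ⟨h1, h2, h3, h4⟩ := h.Fx ht0 hx
  rw [h4]
  have h5 : 0 ≤ ∫ s in Ioo 0 t, (t/(t-s))^(3/2:ℝ)*((M s-M t)*gk (t-s) x (M s-M t)) ∂J := by
    apply setIntegral_nonneg measurableSet_Ioo
    intro s hs
    have hd : 0 ≤ M s - M t := by linarith [hM.mono s t hs.1.le hs.2.le ht]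
    have hτ : 0 < t - s := by linarith [hs.2]
    have := gk_nonneg hτ hx hd
    positivity
  have h6 : ∫ y, (y-M t)*gk t x (y-M t) ∂mu0 w ≤ ∫ y, (y + (-M t)) ∂mu0 w := by
    apply integral_mono_ae h2 (hy.add (integrable_const _))
    filter_upwards [h.mu0_neg] with y hy
    rw [hM.zero] at hy
    have hd : 0 ≤ y - M t := by linarith [hM.neg t ht]
    have := gk_le_one ht0 hx hd
    show (y - M t) * gk t x (y - M t) ≤ y + (-M t)
    nlinarith
  rw [integral_add hy (integrable_const _), integral_const, smul_eq_mul, mul_comm] at h6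
  linarith

lemma w_of_Wn {x t B : ℝ} (ht : 0 < t) (hx : 0 < x) (hw : w (M t + x) t ≠ ∞) (hW : Wn M w x t ≤ B) :
    w (M t + x) t ≤ ENNReal.ofReal (B / (2 * √π) * t ^ (-3/2:ℝ) * x) := by
  rw [← ENNReal.ofReal_toReal hw]
  apply ENNReal.ofReal_le_ofReal
  unfold Wn at hW
  have h1 : t ^ (3/2:ℝ) * t ^ (-3/2:ℝ) = 1 := by rw [← Real.rpow_add ht]; norm_num
  have h2 : 0 < t ^ (-3/2:ℝ) := Real.rpow_pos_of_pos ht _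
  rw [div_le_iff₀ hx] at hW
  have h3 : (0:ℝ) < √π := by positivity
  calc (w (M t + x) t).toReal = (2 * √π * t ^ (3/2:ℝ) * (w (M t + x) t).toReal) * (t ^ (-3/2:ℝ) / (2 * √π)) := by
        rw [show (2 * √π * t ^ (3/2:ℝ) * (w (M t + x) t).toReal) * (t ^ (-3/2:ℝ) / (2 * √π)) =
          (w (M t + x) t).toReal * (t ^ (3/2:ℝ) * t ^ (-3/2:ℝ)) * (√π / √π) by ring, h1, div_self h3.ne']
        ring
    _ ≤ (B * x) * (t ^ (-3/2:ℝ) / (2 * √π)) := by gcongr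
    _ = _ := by ring

lemma w_of_Wn' {x t B : ℝ} (ht : 0 < t) (hx : 0 < x) (hw : w (M t + x) t ≠ ∞) (hW : B ≤ Wn M w x t) :
    ENNReal.ofReal (B / (2 * √π) * t ^ (-3/2:ℝ) * x) ≤ w (M t + x) t := by
  have h1 : t ^ (3/2:ℝ) * t ^ (-3/2:ℝ) = 1 := by rw [← Real.rpow_add ht]; norm_num
  rw [← ENNReal.ofReal_toReal hw]
  apply ENNReal.ofReal_le_ofReal
  unfold Wn at hW
  have h2 : 0 < t ^ (-3/2:ℝ) := Real.rpow_pos_of_pos ht _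
  rw [le_div_iff₀ hx] at hW
  have h3 : (0:ℝ) < √π := by positivity
  calc B / (2 * √π) * t ^ (-3/2:ℝ) * x = (B * x) * (t ^ (-3/2:ℝ) / (2 * √π)) := by ring
    _ ≤ (2 * √π * t ^ (3/2:ℝ) * (w (M t + x) t).toReal) * (t ^ (-3/2:ℝ) / (2 * √π)) := by gcongr
    _ = _ := by
        rw [show (2 * √π * t ^ (3/2:ℝ) * (w (M t + x) t).toReal) * (t ^ (-3/2:ℝ) / (2 * √π)) =
          (w (M t + x) t).toReal * (t ^ (3/2:ℝ) * t ^ (-3/2:ℝ)) * (√π / √π) by ring, h1, div_self h3.ne']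
        ring

lemma stepMass (h : AD M w J) (hM : MH M θ C T) (hy : Integrable (fun y => y) (mu0 w)) {K ε : ℝ} (hε : ε < 1/2)
    (hK : ∀ t, T ≤ t → -M t ≤ K * t ^ ε) (hε0 : 0 < ε) (hK0 : 0 ≤ K) : J.real univ = (mu0 w).real univ := by
  haveI := h.mu0_fin
  haveI := h.finite
  have hT := hM.T1
  have hm0 : mu0 w univ = ∫⁻ x, w x 0 := by
    have := h.mu0_lint (f := fun _ => 1) measurable_const
    simpa using this
  apply le_antisymm
  · apply ENNReal.toReal_mono (measure_ne_top _ _)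
    rw [hm0]; exact h.Jfin
  · set I := ∫ y, y ∂mu0 w
    have hb : ∀ t, T ≤ t → (mu0 w).real univ ≤ J.real univ + (I + K * t ^ ε * (mu0 w).real univ) * (√t)⁻¹ := by
      intro t ht
      have ht0 : 0 < t := by linarith
      have hI : ∫⁻ y, ENNReal.ofReal (2 * (y - M t) * (√(4 * π * t))⁻¹) ∂mu0 w ≤
          ENNReal.ofReal ((I + K * t ^ ε * (mu0 w).real univ) * (√t)⁻¹) := by
        rw [← ofReal_integral_eq_lintegral_ofReal]
        · apply ENNReal.ofReal_le_ofReal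
          rw [integral_mul_const, integral_const_mul, integral_sub hy (integrable_const _), integral_const, smul_eq_mul]
          have h1 : (√(4 * π * t))⁻¹ ≤ (1/2) * (√t)⁻¹ := by
            rw [show (1/2) * (√t)⁻¹ = (√(4 * t))⁻¹ by
              rw [show (4:ℝ) * t = 2^2 * t by ring, Real.sqrt_mul (by norm_num), Real.sqrt_sq (by norm_num)]; field_simp]
            gcongr
            nlinarith [Real.pi_gt_three]
          have h2 : 0 ≤ I - (mu0 w).real univ * M t := by
            have : 0 ≤ I := by
              apply integral_nonneg_of_ae
              filter_upwards [h.mu0_neg] with y hy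
              rw [hM.zero] at hy
              exact hy.le
            have := hM.neg t ht
            have h3 : 0 ≤ (mu0 w).real univ := measureReal_nonneg
            nlinarith
          calc 2 * (I - (mu0 w).real univ * M t) * (√(4 * π * t))⁻¹ ≤
              2 * (I - (mu0 w).real univ * M t) * ((1/2) * (√t)⁻¹) := by gcongr
            _ = (I + (-M t) * (mu0 w).real univ) * (√t)⁻¹ := by ring
            _ ≤ _ := by
              gcongr
              exact hK t ht
        · exact ((hy.sub (integrable_const _)).const_mul 2).mul_const _
        · filter_upwards [h.mu0_neg] with y hy
          rw [hM.zero] at hy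
          have := hM.neg t ht
          have : 0 ≤ y - M t := by linarith
          simp only [Pi.zero_apply]
          positivity
      have h1 : mu0 w univ ≤ J univ + ENNReal.ofReal ((I + K * t ^ ε * (mu0 w).real univ) * (√t)⁻¹) := by
        calc mu0 w univ = ∫⁻ y, 1 ∂mu0 w := by simp
          _ ≤ ∫⁻ y, (Nf t (y - M t) + ENNReal.ofReal (2 * (y - M t) * (√(4 * π * t))⁻¹)) ∂mu0 w := by
            apply lintegral_mono_ae
            filter_upwards [h.mu0_neg] with y hy
            rw [hM.zero] at hy
            exact Nf_ge ht0 (by linarith [hM.neg t ht])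
          _ = (∫⁻ y, Nf t (y - M t) ∂mu0 w) + ∫⁻ y, ENNReal.ofReal (2 * (y - M t) * (√(4 * π * t))⁻¹) ∂mu0 w := by
            rw [lintegral_add_right _ (by fun_prop)]
          _ ≤ _ := by
            refine add_le_add ?_ hI
            rw [h.mu0_lint (f := fun y => Nf t (y - M t)) (((Nf_anti t).measurable).comp (by fun_prop))]
            have := h.flux le_rfl ht0
            rw [sub_zero] at this
            rw [← this]
            calc _ ≤ ∫⁻ u in Ioo 0 t, 1 ∂J := by
                  apply setLIntegral_mono' measurableSet_Ioo
                  intro u hu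
                  exact Nf_le_one (by linarith [hu.2]) (by linarith [hM.mono u t hu.1.le hu.2.le ht])
              _ = J (Ioo 0 t) := by simp
              _ ≤ _ := measure_mono (subset_univ _)
      have h2 := ENNReal.toReal_mono (ENNReal.add_ne_top.2 ⟨measure_ne_top _ _, by simp⟩) h1
      rw [ENNReal.toReal_add (measure_ne_top _ _) (by simp), ENNReal.toReal_ofReal] at h2
      · exact h2
      · have : 0 ≤ I := by
          apply integral_nonneg_of_ae
          filter_upwards [h.mu0_neg] with y hy
          rw [hM.zero] at hy
          exact hy.le
        positivity
    have hlim : Tendsto (fun t : ℝ => J.real univ + (I * (√t)⁻¹ + K * (mu0 w).real univ * t ^ (-(1/2 - ε)))) atTop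
        (𝓝 (J.real univ + (I * 0 + K * (mu0 w).real univ * 0))) := by
      refine tendsto_const_nhds.add (Tendsto.add ?_ ?_)
      · exact (tendsto_inv_atTop_zero.comp Real.tendsto_sqrt_atTop).const_mul _
      · exact (tendsto_rpow_neg_atTop (by linarith)).const_mul _
    have := ge_of_tendsto hlim (b := (mu0 w).real univ) (by
      filter_upwards [eventually_ge_atTop T] with t ht
      refine (hb t ht).trans (le_of_eq ?_)
      have ht0 : 0 < t := by linarith
      rw [show -(1/2 - ε) = ε + -(1/2) by ring, Real.rpow_add ht0, Real.rpow_neg ht0.le (1/2), ← Real.sqrt_eq_rpow]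
      ring)
    simpa using this

lemma SD_exists (h : AD M w J) (hM : MH M θ C T) (hy : Integrable (fun y => y) (mu0 w)) (hε : 0 < ε)
    (hεθ : θ + 16 * ε ≤ 1/2) : ∃ j K, SD M w J θ C T ε j K := by
  haveI := h.mu0_fin
  have hT := hM.T1
  have hθ0 := hM.θ0
  have hε1 : ε ≤ 1 := by linarith
  obtain ⟨K1, hK1, hneg⟩ := hM.negM hε hε1
  set I := ∫ y, y ∂mu0 w
  have hI0 : 0 ≤ I := by
    apply integral_nonneg_of_ae
    filter_upwards [h.mu0_neg] with y hy
    rw [hM.zero] at hy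
    exact hy.le
  have hm0 : 0 ≤ (mu0 w).real univ := measureReal_nonneg
  set K2 := I + K1 * (mu0 w).real univ with hK2
  have hK20 : 0 ≤ K2 := by positivity
  have hW : ∀ t, T ≤ t → ∀ x > 0, Wn M w x t ≤ K2 * t ^ ε := by
    intro t ht x hx
    refine (stepA h hM hy ht hx).trans ?_
    have h1 := hneg t ht
    have h2 : 1 ≤ t ^ ε := Real.one_le_rpow (by linarith) hε.le
    rw [hK2]
    nlinarith
  have hpi : 1 ≤ 2 * √π := by
    have : 1 ≤ √π := by rw [Real.one_le_sqrt]; linarith [Real.pi_gt_three]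
    linarith
  have hww : ∀ t, T ≤ t → ∀ x > 0, w (M t + x) t ≤ ENNReal.ofReal (K2 * t ^ (-3/2 + ε) * x) := by
    intro t ht x hx
    have ht0 : 0 < t := by linarith
    refine (w_of_Wn ht0 hx (h.Fx ht0 hx).1 (hW t ht x hx)).trans ?_
    apply ENNReal.ofReal_le_ofReal
    rw [Real.rpow_add ht0]
    have h2 : 0 < t ^ (-3/2:ℝ) := Real.rpow_pos_of_pos ht0 _
    have h3 : 0 < t ^ ε := Real.rpow_pos_of_pos ht0 _
    have : K2 * t ^ ε / (2 * √π) ≤ K2 * t ^ ε := div_le_self (by positivity) hpi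
    calc _ ≤ K2 * t ^ ε * t ^ (-3/2:ℝ) * x := by gcongr
      _ = _ := by ring
  obtain ⟨j, hjm, hj0, hji, hjJ, hjae⟩ := h.density (T := T) (L := 2) (K := K2) (by linarith) (by norm_num) hK20
    (fun s s' hs hs' => hM.lip hs hs') (by
      intro t ht x hx
      have ht0 : 0 < t := by linarith
      refine (hww t ht x hx).trans ?_
      apply ENNReal.ofReal_le_ofReal
      have : t ^ (-3/2 + ε) ≤ 1 := Real.rpow_le_one_of_one_le_of_nonpos (by linarith) (by linarith)
      have : K2 * t ^ (-3/2 + ε) ≤ K2 * 1 := by gcongr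
      gcongr
      linarith)
  set K := K1 + K2 + 2 / ε with hK
  have h2e : 0 ≤ 2/ε := by positivity
  refine ⟨j, K, h, hM, hε, hεθ, hy, by linarith, hjm, hj0, hji, hjJ, ?_, hjae, ?_, ?_, ?_, ?_⟩
  · filter_upwards [hjae] with t ht htT
    have ht0 : 0 < t := by linarith
    have h3 : 0 ≤ t ^ (-3/2 + ε) := Real.rpow_nonneg ht0.le _
    have := (ht htT).1 (K2 * t ^ (-3/2 + ε)) (by positivity) 0 le_rfl (by
      intro x hx
      have := hww t htT.le x hx
      simpa using this)
    refine this.trans ?_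
    gcongr
    linarith
  · intro t ht
    refine (hneg t ht).trans ?_
    have : 0 ≤ t := by linarith
    gcongr
    linarith
  · exact stepMass h hM hy (by linarith) hneg hε (by linarith)
  · intro t ht x hx
    refine (hW t ht x hx).trans ?_
    have : 0 ≤ t := by linarith
    gcongr
    linarith
  · intro s t hs hst
    refine (hM.ub hε hε1 hs hst).trans ?_
    have hu1 : s / t ≤ 1 := by rw [div_le_one (by linarith)]; exact hst
    have hu0 : 0 ≤ s / t := by apply div_nonneg <;> linarith
    have : 0 ≤ 1 - s/t := by linarith
    gcongr
    linarith

end PartK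

open MeasureTheory ProbabilityTheory Filter Real Set Asymptotics
open scoped NNReal ENNReal Topology
set_option linter.all false
set_option linter.deprecated false

section PartL

noncomputable def bt (p q u : ℝ) : ℝ := u ^ (p - 1) * (1 - u) ^ (q - 1)

lemma bt_int {p q : ℝ} (hp : 0 < p) (hq : 0 < q) : IntegrableOn (bt p q) (Ioo 0 1) := by
  have hp1 : IntegrableOn (fun u : ℝ => u ^ (p - 1)) (Ioo 0 1) :=
    (intervalIntegral.integrableOn_Ioo_rpow_iff one_pos).2 (by linarith)
  have hq1 : IntegrableOn (fun u : ℝ => (1 - u) ^ (q - 1)) (Ioo 0 1) := by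
    have h1 : IntervalIntegrable (fun u : ℝ => u ^ (q - 1)) volume 0 1 :=
      intervalIntegral.intervalIntegrable_rpow' (by linarith)
    have := h1.comp_sub_left 1
    simp only [sub_zero, sub_self] at this
    have := this.symm
    rw [intervalIntegrable_iff_integrableOn_Ioo_of_le (by norm_num)] at this
    exact this
  have hpq : ∀ {a : ℝ}, ∃ K, ∀ v ∈ Icc (1/2:ℝ) 1, v ^ (a - 1) ≤ K := by
    intro a
    refine ⟨(1/2:ℝ) ^ (a - 1) + 1, ?_⟩
    intro v hv
    have h0 : 0 < (1/2:ℝ) ^ (a - 1) := by positivity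
    rcases le_or_gt 1 a with h | h
    · have := Real.rpow_le_one (by linarith [hv.1]) hv.2 (show 0 ≤ a - 1 by linarith)
      linarith
    · have := Real.rpow_le_rpow_of_nonpos (show (0:ℝ) < 1/2 by norm_num) hv.1 (show a - 1 ≤ 0 by linarith)
      linarith
  obtain ⟨K1, hK1⟩ := @hpq p
  obtain ⟨K2, hK2⟩ := @hpq q
  have hg := (hp1.const_mul K2).add (hq1.const_mul K1)
  refine Integrable.mono' hg ?_ ?_
  · apply Measurable.aestronglyMeasurable
    unfold bt
    fun_prop
  · filter_upwards [ae_restrict_mem measurableSet_Ioo] with u hu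
    have h1 : 0 ≤ u ^ (p - 1) := Real.rpow_nonneg hu.1.le _
    have h2 : 0 ≤ (1 - u) ^ (q - 1) := Real.rpow_nonneg (by linarith [hu.2]) _
    have hK10 : 0 ≤ K1 := le_trans (by simp) (hK1 1 ⟨by norm_num, le_rfl⟩)
    have hK20 : 0 ≤ K2 := le_trans (by simp) (hK2 1 ⟨by norm_num, le_rfl⟩)
    simp only [Pi.add_apply]
    unfold bt
    rw [Real.norm_eq_abs, abs_of_nonneg (by positivity)]
    rcases le_or_gt u (1/2) with h | h
    · have := hK2 (1 - u) ⟨by linarith, by linarith [hu.1]⟩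
      nlinarith
    · have := hK1 u ⟨h.le, hu.2.le⟩
      nlinarith

noncomputable def Bt (p q : ℝ) : ℝ := ∫ u in Ioo (0:ℝ) 1, bt p q u

lemma bt_nonneg {p q u : ℝ} (hu : u ∈ Icc (0:ℝ) 1) : 0 ≤ bt p q u :=
  mul_nonneg (Real.rpow_nonneg hu.1 _) (Real.rpow_nonneg (by linarith [hu.2]) _)

lemma Bt_nonneg (p q : ℝ) : 0 ≤ Bt p q :=
  setIntegral_nonneg measurableSet_Ioo fun u hu => bt_nonneg ⟨hu.1.le, hu.2.le⟩

lemma bt_scale {p q t : ℝ} (hp : 0 < p) (hq : 0 < q) (ht : 0 < t) :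
    IntegrableOn (fun s => bt p q (s / t)) (Ioo 0 t) ∧ ∫ s in Ioo 0 t, bt p q (s / t) = t * Bt p q := by
  have h1 : IntervalIntegrable (bt p q) volume 0 1 :=
    (intervalIntegrable_iff_integrableOn_Ioo_of_le (by norm_num)).2 (bt_int hp hq)
  constructor
  · have := h1.comp_mul_left (c := t⁻¹)
    simp only [zero_div, one_div, inv_inv] at this
    rw [intervalIntegrable_iff_integrableOn_Ioo_of_le ht.le] at this
    refine this.congr_fun (fun s _ => ?_) measurableSet_Ioo
    simp only [div_eq_inv_mul]
  · rw [← integral_Ioc_eq_integral_Ioo, ← intervalIntegral.integral_of_le ht.le,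
      intervalIntegral.integral_comp_div (fun u => bt p q u) ht.ne', zero_div, div_self ht.ne', smul_eq_mul,
      intervalIntegral.integral_of_le (by norm_num), integral_Ioc_eq_integral_Ioo, Bt]

lemma scale_bound {f : ℝ → ℝ} {p q t T P : ℝ} (hp : 0 < p) (hq : 0 < q) (hT : 0 ≤ T) (ht : 0 < t) (hP : 0 ≤ P)
    (hfm : AEStronglyMeasurable f (volume.restrict (Ioo T t)))
    (hf : ∀ᵐ s, s ∈ Ioo T t → |f s| ≤ P * bt p q (s / t)) :
    IntegrableOn f (Ioo T t) ∧ |∫ s in Ioo T t, f s| ≤ P * Bt p q * t := by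
  obtain ⟨h1, h2⟩ := bt_scale hp hq ht
  have hsub : Ioo T t ⊆ Ioo 0 t := Ioo_subset_Ioo_left hT
  have hf' : ∀ᵐ s ∂(volume.restrict (Ioo T t)), ‖f s‖ ≤ P * bt p q (s / t) := by
    rw [ae_restrict_iff' measurableSet_Ioo]
    exact hf
  have hg : IntegrableOn (fun s => P * bt p q (s / t)) (Ioo T t) := (h1.mono_set hsub).const_mul P
  refine ⟨Integrable.mono' hg hfm hf', ?_⟩
  rw [← Real.norm_eq_abs]
  refine (norm_integral_le_of_norm_le hg hf').trans ?_
  rw [integral_const_mul]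
  have : ∫ s in Ioo T t, bt p q (s / t) ≤ ∫ s in Ioo 0 t, bt p q (s / t) := by
    apply setIntegral_mono_set h1 _ hsub.eventuallyLE
    filter_upwards [ae_restrict_mem measurableSet_Ioo] with s hs
    exact bt_nonneg ⟨by have := hs.1; positivity, by rw [div_le_one ht]; exact hs.2.le⟩
  rw [h2] at this
  nlinarith

lemma min_tau {s t θ : ℝ} (hs : 1 ≤ s) (hst : s < t) (hθ0 : 0 ≤ θ) (hθ1 : θ ≤ 1) :
    min 1 (1 / (t - s)) ≤ 2 * ((t - s) ^ (-θ) * (s / t) ^ (1 - θ)) := by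
  have hτ : 0 < t - s := by linarith
  set τ := t - s with hτd
  have ht : 0 < t := by linarith
  set m := max 1 τ
  have hm1 : 1 ≤ m := le_max_left _ _
  have hmt : τ ≤ m := le_max_right _ _
  have h1 : t / s ≤ 2 * m := by
    rw [div_le_iff₀ (by linarith)]
    have : t = s + τ := by rw [hτd]; ring
    nlinarith
  have h2 : (t / s) ^ (1 - θ) ≤ 2 * m ^ (1 - θ) := by
    calc (t / s) ^ (1 - θ) ≤ (2 * m) ^ (1 - θ) := by
          apply Real.rpow_le_rpow (by positivity) h1 (by linarith)
      _ = 2 ^ (1 - θ) * m ^ (1 - θ) := Real.mul_rpow (by norm_num) (by linarith)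
      _ ≤ 2 ^ (1:ℝ) * m ^ (1 - θ) := by
          gcongr
          · norm_num
          · linarith
      _ = _ := by rw [Real.rpow_one]
  have h3 : τ ^ θ ≤ m ^ θ := Real.rpow_le_rpow hτ.le hmt hθ0
  have h4 : τ ^ θ * (t / s) ^ (1 - θ) ≤ 2 * m := by
    calc _ ≤ m ^ θ * (2 * m ^ (1 - θ)) := by gcongr
      _ = 2 * (m ^ θ * m ^ (1 - θ)) := by ring
      _ = _ := by rw [← Real.rpow_add (by linarith)]; simp
  have h5 : min 1 (1 / τ) ≤ 1 / m := by
    rcases le_total 1 τ with h | h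
    · simp only [m, max_eq_right h]; exact min_le_right _ _
    · simp only [m, max_eq_left h]; exact (min_le_left _ _).trans (by norm_num)
  have e : (τ ^ (-θ) * (s / t) ^ (1 - θ)) = (τ ^ θ * (t / s) ^ (1 - θ))⁻¹ := by
    rw [mul_inv, Real.rpow_neg hτ.le, ← Real.inv_rpow (show 0 ≤ t / s by positivity), inv_div]
  rw [e]
  refine h5.trans ?_
  have h6 : 0 < τ ^ θ * (t / s) ^ (1 - θ) := by positivity
  rw [← div_eq_mul_inv, div_le_div_iff₀ (by linarith) h6]
  linarith

lemma phi_bound {u : ℝ} (hu : 0 ≤ u) (hu1 : u < 1) :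
    0 ≤ (1 - u) ^ (-3/2:ℝ) - 1 ∧ (1 - u) ^ (-3/2:ℝ) - 1 ≤ 2 * u * (1 - u) ^ (-3/2:ℝ) := by
  have h0 : 0 < 1 - u := by linarith
  constructor
  · have := Real.one_le_rpow_of_pos_of_le_one_of_nonpos h0 (by linarith) (show (-3/2:ℝ) ≤ 0 by norm_num)
    linarith
  · have h1 : (1 - u) ^ (2:ℝ) ≤ (1 - u) ^ (3/2:ℝ) :=
      Real.rpow_le_rpow_of_exponent_ge h0 (by linarith) (by norm_num)
    rw [Real.rpow_two] at h1
    have h2 : (1 - u) ^ (3/2:ℝ) * (1 - u) ^ (-3/2:ℝ) = 1 := by rw [← Real.rpow_add h0]; norm_num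
    have h3 : 0 < (1 - u) ^ (-3/2:ℝ) := Real.rpow_pos_of_pos h0 _
    have h4 : 1 - 2 * u ≤ (1 - u) ^ (3/2:ℝ) := by nlinarith
    have h5 := mul_le_mul_of_nonneg_right h4 h3.le
    rw [h2] at h5
    linarith

end PartL

open MeasureTheory ProbabilityTheory Filter Real Set Asymptotics
open scoped NNReal ENNReal Topology
set_option linter.all false
set_option linter.deprecated false

section PartM
variable {M : ℝ → ℝ} {w : ℝ → ℝ → ℝ≥0∞} {J : Measure ℝ} {θ C T ε K : ℝ} {j : ℝ → ℝ}

lemma SD.conv (h : SD M w J θ C T ε j K) {S : Set ℝ} (hS : MeasurableSet S) (hST : S ⊆ Ioi T) (f : ℝ → ℝ) :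
    (IntegrableOn f S J ↔ IntegrableOn (fun s => f s * j s) S) ∧ ∫ s in S, f s ∂J = ∫ s in S, f s * j s := by
  have h1 : J.restrict S = (volume.restrict S).withDensity (fun s => ENNReal.ofReal (j s)) := by
    rw [← Measure.restrict_restrict_of_subset hST, h.jJ, restrict_withDensity hS]
  have hm : Measurable (fun s => ENNReal.ofReal (j s)) := h.jm.ennreal_ofReal
  have e : ∀ s, (ENNReal.ofReal (j s)).toReal • f s = f s * j s := by
    intro s; rw [ENNReal.toReal_ofReal (h.j0 s), smul_eq_mul, mul_comm]
  constructor
  · unfold IntegrableOn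
    rw [h1, integrable_withDensity_iff_integrable_smul' hm (by simp)]
    simp_rw [e]
  · rw [h1, integral_withDensity_eq_integral_toReal_smul hm (by simp)]
    simp_rw [e]

lemma tail_bound {f : ℝ → ℝ} {t P a : ℝ} (ht : 0 < t) (ha : a < -1)
    (hfm : AEStronglyMeasurable f (volume.restrict (Ioi t)))
    (hf : ∀ᵐ s, t < s → |f s| ≤ P * s ^ a) :
    IntegrableOn f (Ioi t) ∧ |∫ s in Ioi t, f s| ≤ P * (t ^ (a + 1) / (-(a + 1))) := by
  have hf' : ∀ᵐ s ∂(volume.restrict (Ioi t)), ‖f s‖ ≤ P * s ^ a := by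
    rw [ae_restrict_iff' measurableSet_Ioi]
    exact hf
  have hg : IntegrableOn (fun s : ℝ => P * s ^ a) (Ioi t) := (integrableOn_Ioi_rpow_of_lt ha ht).const_mul P
  refine ⟨Integrable.mono' hg hfm hf', ?_⟩
  rw [← Real.norm_eq_abs]
  refine (norm_integral_le_of_norm_le hg hf').trans ?_
  rw [integral_const_mul, integral_Ioi_rpow_of_lt ha ht, neg_div, div_neg]

lemma SD.T0 (h : SD M w J θ C T ε j K) : 0 < T := by linarith [h.mh.T1]

lemma SD.cont (h : SD M w J θ C T ε j K) : Continuous M := h.ad.cont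

lemma SD.M_int (h : SD M w J θ C T ε j K) : Integrable M J := by
  haveI := h.ad.finite
  have hT := h.mh.T1
  have hε := h.ε0
  have hεθ := h.εθ
  have hθ := h.mh.θ0
  have h1 : IntegrableOn M (Ioi T) J := by
    rw [(h.conv measurableSet_Ioi le_rfl M).1]
    refine (tail_bound (P := K * K) (a := -3/2 + 2 * ε) h.T0 (by linarith)
      ((h.cont.measurable.mul h.jm).aestronglyMeasurable) ?_).1
    filter_upwards [h.jub] with s hs hsT
    have hs0 : 0 < s := by linarith
    show |M s * j s| ≤ K * K * s ^ (-3/2 + 2 * ε)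
    rw [abs_mul, abs_of_nonneg (h.j0 s), abs_of_nonpos (h.mh.neg s hsT.le)]
    have h2 := h.negM s hsT.le
    have h3 := hs hsT
    have h4 : 0 ≤ -M s := by linarith [h.mh.neg s hsT.le]
    calc -M s * j s ≤ (K * s ^ ε) * (K * s ^ (-3/2 + ε)) := by
          have := h.j0 s
          have := h.K1
          have : 0 ≤ K * s ^ ε := by positivity
          gcongr
      _ = K * K * (s ^ ε * s ^ (-3/2 + ε)) := by ring
      _ = _ := by rw [← Real.rpow_add hs0]; congr 2; ring
  have h2 : IntegrableOn M (Icc 0 T) J := h.cont.continuousOn.integrableOn_compact isCompact_Icc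
  have h3 : IntegrableOn M (Iic 0) J := by
    unfold IntegrableOn
    rw [Measure.restrict_eq_zero.2 h.ad.Jneg]
    exact integrable_zero_measure
  have h4 := (h3.union h2).union h1
  have : Iic 0 ∪ Icc 0 T ∪ Ioi T = univ := by
    ext s
    simp only [mem_union, mem_Iic, mem_Icc, mem_Ioi, mem_univ, iff_true]
    rcases le_total s 0 with h5 | h5
    · exact Or.inl (Or.inl h5)
    · rcases le_or_gt s T with h6 | h6
      · exact Or.inl (Or.inr ⟨h5, h6⟩)
      · exact Or.inr h6
  rw [this] at h4
  exact integrableOn_univ.1 h4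

/-- the constant -/
noncomputable def cc (M : ℝ → ℝ) (w : ℝ → ℝ → ℝ≥0∞) (J : Measure ℝ) : ℝ := (∫ y, y ∂mu0 w) - ∫ s, M s ∂J

noncomputable def I1p (M : ℝ → ℝ) (w : ℝ → ℝ → ℝ≥0∞) (x t : ℝ) : ℝ :=
  ∫ y, (y - M t) * (1 - gk t x (y - M t)) ∂mu0 w

noncomputable def I3 (M : ℝ → ℝ) (j : ℝ → ℝ) (t : ℝ) : ℝ := ∫ s in Ioi t, (M t - M s) * j s

noncomputable def I2e (M : ℝ → ℝ) (J : Measure ℝ) (T x t : ℝ) : ℝ :=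
  ∫ s in Ioc 0 T, ((t/(t-s))^(3/2:ℝ)*((M s-M t)*gk (t-s) x (M s-M t)) - (M s - M t)) ∂J

noncomputable def I2p (M : ℝ → ℝ) (j : ℝ → ℝ) (T t : ℝ) : ℝ :=
  ∫ s in Ioo T t, ((1 - s/t) ^ (-3/2:ℝ) - 1) * ((M s - M t) * j s)

noncomputable def E2 (M : ℝ → ℝ) (j : ℝ → ℝ) (T x t : ℝ) : ℝ :=
  ∫ s in Ioo T t, (1 - s/t) ^ (-3/2:ℝ) * ((M s - M t) * (1 - gk (t-s) x (M s - M t))) * j s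

lemma phi_gen {f : ℝ → ℝ} {T t P ε β : ℝ} (hT : 0 ≤ T) (ht : T < t) (hP : 0 ≤ P) (hεβ : ε + β < 1/2)
    (hfm : Measurable f)
    (hf : ∀ᵐ s, s ∈ Ioo T t → |f s| ≤ P * ((1 - s/t) * (s/t) ^ (-ε) * s ^ (-3/2 - β))) :
    IntegrableOn (fun s => ((1 - s/t) ^ (-3/2:ℝ) - 1) * f s) (Ioo T t) ∧
    |∫ s in Ioo T t, ((1 - s/t) ^ (-3/2:ℝ) - 1) * f s| ≤ 2 * P * Bt (1/2 - ε - β) (1/2) * t ^ (-1/2 - β) := by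
  have ht0 : 0 < t := by linarith
  have := scale_bound (f := fun s => ((1 - s/t) ^ (-3/2:ℝ) - 1) * f s) (p := 1/2 - ε - β) (q := 1/2) (t := t) (T := T)
    (P := 2 * P * t ^ (-3/2 - β)) (by linarith) (by norm_num) hT ht0 (by positivity)
    (Measurable.aestronglyMeasurable (by fun_prop)) (by
      filter_upwards [hf] with s hs hsm
      have h1 := hs hsm
      have hs0 : 0 < s := hT.trans_lt hsm.1
      set u := s / t with hu
      have hu0 : 0 < u := by positivity
      have hu1 : u < 1 := by rw [hu, div_lt_one ht0]; exact hsm.2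
      obtain ⟨hp0, hp1⟩ := phi_bound hu0.le hu1
      have hv : 0 < 1 - u := by linarith
      rw [abs_mul, abs_of_nonneg hp0]
      have hsu : s = t * u := by rw [hu]; field_simp
      have e1 : u * u ^ (-ε) * u ^ (-3/2 - β) = u ^ ((1/2 - ε - β) - 1) := by
        nth_rewrite 1 [← Real.rpow_one u]
        rw [← Real.rpow_add hu0, ← Real.rpow_add hu0]; congr 1; ring
      have e2 : (1 - u) ^ (-3/2:ℝ) * (1 - u) = (1 - u) ^ ((1/2:ℝ) - 1) := by
        nth_rewrite 2 [← Real.rpow_one (1 - u)]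
        rw [← Real.rpow_add hv]; congr 1; norm_num
      have e3 : s ^ (-3/2 - β) = t ^ (-3/2 - β) * u ^ (-3/2 - β) := by
        rw [hsu, Real.mul_rpow ht0.le hu0.le]
      calc _ ≤ (2 * u * (1 - u) ^ (-3/2:ℝ)) * (P * ((1 - u) * u ^ (-ε) * s ^ (-3/2 - β))) := by
            have : 0 < (1 - u) ^ (-3/2:ℝ) := Real.rpow_pos_of_pos hv _
            gcongr
        _ = 2 * P * t ^ (-3/2 - β) * ((u * u ^ (-ε) * u ^ (-3/2 - β)) * ((1 - u) ^ (-3/2:ℝ) * (1 - u))) := by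
            rw [e3]; ring
        _ = _ := by rw [e1, e2]; rfl)
  refine ⟨this.1, this.2.trans (le_of_eq ?_)⟩
  rw [show (-1/2 - β) = (-3/2 - β) + 1 by ring, Real.rpow_add ht0, Real.rpow_one]
  ring

lemma SD.dj_bound (h : SD M w J θ C T ε j K) {t : ℝ} (ht : T < t) : ∀ᵐ s, s ∈ Ioo T t →
    |(M s - M t) * j s| ≤ (K * K) * ((1 - s/t) * (s/t) ^ (-ε) * s ^ (-3/2 - (-ε))) := by
  have hT := h.T0
  filter_upwards [h.jub] with s hs hsm
  have h1 := hs hsm.1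
  have h2 := h.dub s t hsm.1.le hsm.2.le
  have h3 := (h.mh.lip hsm.1.le hsm.2.le).1
  have hs0 : 0 < s := hT.trans hsm.1
  have hK := h.K1
  rw [abs_of_nonneg (mul_nonneg h3 (h.j0 s)), sub_neg_eq_add]
  calc _ ≤ (K * ((1 - s/t) * (s/t) ^ (-ε))) * (K * s ^ (-3/2 + ε)) := by
        have := h.j0 s
        gcongr
        linarith
    _ = _ := by ring

lemma SD.I2p_bound (h : SD M w J θ C T ε j K) {t : ℝ} (ht : T < t) :
    IntegrableOn (fun s => ((1 - s/t) ^ (-3/2:ℝ) - 1) * ((M s - M t) * j s)) (Ioo T t) ∧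
    |I2p M j T t| ≤ 2 * (K * K) * Bt (1/2) (1/2) * t ^ (-1/2 + ε) := by
  have hε := h.ε0
  have hK := h.K1
  have := phi_gen (f := fun s => (M s - M t) * j s) (P := K * K) (ε := ε) (β := -ε) h.T0.le ht (by positivity) (by linarith)
    ((h.cont.measurable.sub_const _).mul h.jm) (h.dj_bound ht)
  simp only [sub_neg_eq_add, show (1/2 - ε + ε : ℝ) = 1/2 by ring] at this
  exact this

lemma SD.I3_bound (h : SD M w J θ C T ε j K) {t : ℝ} (ht : T ≤ t) :
    IntegrableOn (fun s => (M t - M s) * j s) (Ioi t) ∧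
    |I3 M j t| ≤ (4 * (K * K)) * t ^ (-1/2 + ε) := by
  have hT := h.T0
  have hε := h.ε0
  have hεθ := h.εθ
  have hθ := h.mh.θ0
  have hK := h.K1
  have ht0 : 0 < t := by linarith
  have := tail_bound (f := fun s => (M t - M s) * j s) (P := K * K * t ^ (-ε)) (a := -3/2 + 2 * ε) ht0 (by linarith)
      (((h.cont.measurable.const_sub _).mul h.jm).aestronglyMeasurable) (by
    filter_upwards [h.jub] with s hs hst
    have hs0 : 0 < s := by linarith
    have h1 := hs (by linarith)
    have h2 := h.dub t s ht hst.le
    have h3 := (h.mh.lip ht hst.le).1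
    rw [abs_of_nonneg (mul_nonneg h3 (h.j0 s))]
    have h4 : (1 - t/s) * (t/s) ^ (-ε) ≤ t ^ (-ε) * s ^ ε := by
      rw [Real.div_rpow ht0.le hs0.le, Real.rpow_neg hs0.le, div_inv_eq_mul]
      have : 0 ≤ t / s := by positivity
      have : 0 ≤ t ^ (-ε) * s ^ ε := by positivity
      nlinarith
    calc _ ≤ (K * (t ^ (-ε) * s ^ ε)) * (K * s ^ (-3/2 + ε)) := by
          have := h.j0 s
          gcongr
          exact h2.trans (by gcongr)
      _ = K * K * t ^ (-ε) * (s ^ ε * s ^ (-3/2 + ε)) := by ring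
      _ = _ := by rw [← Real.rpow_add hs0]; congr 2; ring)
  refine ⟨this.1, this.2.trans ?_⟩
  have e1 : t ^ (-ε) * t ^ (-3/2 + 2 * ε + 1) = t ^ (-1/2 + ε) := by
    rw [← Real.rpow_add ht0]; congr 1; ring
  have h5 : 1 / (-(-3/2 + 2 * ε + 1)) ≤ 4 := by
    rw [div_le_iff₀ (by linarith)]; linarith
  calc K * K * t ^ (-ε) * (t ^ (-3 / 2 + 2 * ε + 1) / -(-3 / 2 + 2 * ε + 1)) =
      K * K * (t ^ (-ε) * t ^ (-3/2 + 2 * ε + 1)) * (1 / (-(-3/2 + 2 * ε + 1))) := by ring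
    _ ≤ K * K * (t ^ (-ε) * t ^ (-3/2 + 2 * ε + 1)) * 4 := by gcongr
    _ = _ := by rw [e1]; ring

lemma gk_meas (τ : ℝ → ℝ) (hτ : Measurable τ) (x : ℝ) (d : ℝ → ℝ) (hd : Measurable d) :
    Measurable (fun s => gk (τ s) x (d s)) := by
  unfold gk
  fun_prop

set_option maxHeartbeats 1000000 in
lemma SD.E2_bound (h : SD M w J θ C T ε j K) {t x X : ℝ} (ht : T < t) (hx : 0 < x) (hxX : x ≤ X) :
    IntegrableOn (fun s => (1 - s/t) ^ (-3/2:ℝ) * ((M s - M t) * (1 - gk (t-s) x (M s - M t))) * j s) (Ioo T t) ∧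
    |E2 M j T x t| ≤ (2 * (X^2 + K^2) * K^2 * Bt (1/2 - θ - 3 * ε) (1/2 - θ - ε)) * t ^ (-1/2 - θ) := by
  have hT := h.T0
  have hT1 := h.mh.T1
  have hε := h.ε0
  have hεθ := h.εθ
  have hθ := h.mh.θ0
  have hK := h.K1
  have ht0 : 0 < t := by linarith
  have := scale_bound (f := fun s => (1 - s/t) ^ (-3/2:ℝ) * ((M s - M t) * (1 - gk (t-s) x (M s - M t))) * j s)
    (p := 1/2 - θ - 3 * ε) (q := 1/2 - θ - ε) (t := t) (T := T)
    (P := 2 * (X^2 + K^2) * K^2 * t ^ (-3/2 - θ)) (by linarith) (by linarith) hT.le ht0 (by positivity)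
    (Measurable.aestronglyMeasurable (by
      have h1 := h.cont.measurable
      have h2 := h.jm
      have h3 := gk_meas (fun s => t - s) (by fun_prop) x (fun s => M s - M t) (by fun_prop)
      fun_prop)) (by
    filter_upwards [h.jub] with s hs hsm
    have h1 := hs hsm.1
    have h2 := h.dub s t hsm.1.le hsm.2.le
    have h3 := (h.mh.lip hsm.1.le hsm.2.le).1
    have hs0 : 0 < s := hT.trans hsm.1
    have hτ : 0 < t - s := by linarith [hsm.2]
    have hmt := min_tau (θ := θ + ε) (show 1 ≤ s by linarith [hsm.1]) hsm.2 (by linarith) (by linarith)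
    have hg1 := gk_le_one hτ hx h3
    set d := M s - M t with hd
    set g := gk (t - s) x d with hg
    have hsu : s = t * (s / t) := by field_simp
    have hts : t - s = t * (1 - s / t) := by field_simp
    set u := s / t with hu
    have hu0 : 0 < u := by positivity
    have hu1 : u < 1 := by rw [hu, div_lt_one ht0]; exact hsm.2
    have hv : 0 < 1 - u := by linarith
    have hv32 : 0 < (1 - u) ^ (-3/2:ℝ) := Real.rpow_pos_of_pos hv _
    have hue : 1 ≤ u ^ (-2*ε) := Real.one_le_rpow_of_pos_of_le_one_of_nonpos hu0 hu1.le (by linarith)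
    have hd2 : d ^ 2 ≤ K^2 * u ^ (-2*ε) := by
      have h4 : d ≤ K * u ^ (-ε) := by
        refine h2.trans ?_
        have : 0 < u ^ (-ε) := Real.rpow_pos_of_pos hu0 _
        gcongr
        nlinarith
      calc d ^ 2 ≤ (K * u ^ (-ε)) ^ 2 := by gcongr
        _ = K^2 * (u ^ (-ε) * u ^ (-ε)) := by ring
        _ = _ := by rw [← Real.rpow_add hu0]; congr 2; ring
    have hx2 : x ^ 2 ≤ X ^ 2 * u ^ (-2*ε) := by
      have : x ^ 2 ≤ X ^ 2 := by gcongr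
      nlinarith [sq_nonneg X]
    set A := X^2 + K^2 with hA
    have hA1 : 1 ≤ A := by nlinarith [sq_nonneg X]
    have hAu : 1 ≤ A * u ^ (-2*ε) := by nlinarith
    have hdg : d * (1 - g) ≤ (K * ((1 - u) * u ^ (-ε))) * (A * u ^ (-2*ε) * (2 * ((t - s) ^ (-(θ + ε)) * u ^ (1 - (θ + ε))))) := by
      rcases h3.eq_or_lt with h0 | h0
      · rw [← h0, zero_mul]
        positivity
      · have h5 : 1 - g ≤ A * u ^ (-2*ε) * min 1 (1 / (t - s)) := by
          rw [mul_min_of_nonneg _ _ (by positivity)]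
          apply le_min
          · have := gk_nonneg hτ hx h3
            rw [mul_one]; linarith
          · refine (one_sub_gk hτ hx h0).trans ?_
            rw [mul_one_div, div_le_div_iff₀ (by positivity) hτ, hA]
            have h6 : x ^ 2 + d ^ 2 ≤ (X^2 + K^2) * u ^ (-2*ε) := by nlinarith
            have h7 : 0 ≤ (X^2 + K^2) * u ^ (-2*ε) := by positivity
            nlinarith
        have h6 : 0 ≤ 1 - g := by linarith
        gcongr
        exact h5.trans (by gcongr)
    have hdg0 : 0 ≤ d * (1 - g) := mul_nonneg h3 (by linarith)
    rw [abs_of_nonneg (by have := h.j0 s; positivity)]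
    have e1 : (u ^ (-ε) * u ^ (-2 * ε) * u ^ (1 - (θ + ε)) * u ^ (-3/2 + ε)) = u ^ (1/2 - θ - 3 * ε - 1) := by
      rw [← Real.rpow_add hu0, ← Real.rpow_add hu0, ← Real.rpow_add hu0]; congr 1; ring
    have e2 : ((1 - u) ^ (-3/2:ℝ) * (1 - u) * (1 - u) ^ (-(θ + ε))) = (1 - u) ^ (1/2 - θ - ε - 1) := by
      nth_rewrite 2 [← Real.rpow_one (1 - u)]
      rw [← Real.rpow_add hv, ← Real.rpow_add hv]; congr 1; ring
    have e3 : t ^ (-(θ + ε)) * t ^ (-3/2 + ε) = t ^ (-3/2 - θ) := by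
      rw [← Real.rpow_add ht0]; congr 1; ring
    calc _ ≤ (1 - u) ^ (-3/2:ℝ) * ((K * ((1 - u) * u ^ (-ε))) * (A * u ^ (-2*ε) *
          (2 * ((t - s) ^ (-(θ + ε)) * u ^ (1 - (θ + ε)))))) * (K * s ^ (-3/2 + ε)) := by
          have := h.j0 s
          gcongr
      _ = 2 * A * K^2 * (t ^ (-(θ + ε)) * t ^ (-3/2 + ε)) *
          ((u ^ (-ε) * u ^ (-2 * ε) * u ^ (1 - (θ + ε)) * u ^ (-3/2 + ε)) *
          ((1 - u) ^ (-3/2:ℝ) * (1 - u) * (1 - u) ^ (-(θ + ε)))) := by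
          rw [hts, Real.mul_rpow ht0.le hv.le]
          have e4 : s ^ (-3/2 + ε) = t ^ (-3/2 + ε) * u ^ (-3/2 + ε) := by
            conv_lhs => rw [hsu]
            rw [Real.mul_rpow ht0.le hu0.le]
          rw [e4]; ring
      _ = _ := by rw [e1, e2, e3]; rfl)
  refine ⟨this.1, this.2.trans (le_of_eq ?_)⟩
  rw [show (-1/2 - θ) = (-3/2 - θ) + 1 by ring, Real.rpow_add ht0, Real.rpow_one]
  ring

end PartM

open MeasureTheory ProbabilityTheory Filter Real Set Asymptotics
open scoped NNReal ENNReal Topology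
set_option linter.all false
set_option linter.deprecated false

section PartN
variable {M : ℝ → ℝ} {w : ℝ → ℝ → ℝ≥0∞} {J : Measure ℝ} {θ C T ε K : ℝ} {j : ℝ → ℝ}

lemma half_rpow_le {u : ℝ} (hu : u ≤ 1/2) : (1 - u) ^ (-3/2:ℝ) ≤ 4 := by
  have h1 : (1 - u) ^ (-3/2:ℝ) ≤ (1/2:ℝ) ^ (-3/2:ℝ) :=
    Real.rpow_le_rpow_of_nonpos (by norm_num) (by linarith) (by norm_num)
  have h2 : (1/2:ℝ) ^ (-3/2:ℝ) ≤ (1/2:ℝ) ^ (-2:ℝ) :=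
    Real.rpow_le_rpow_of_exponent_ge (by norm_num) (by norm_num) (by norm_num)
  have h3 : (1/2:ℝ) ^ (-2:ℝ) = 4 := by
    rw [show (-2:ℝ) = ((-2:ℤ):ℝ) by norm_num, Real.rpow_intCast]; norm_num
  linarith

lemma SD.I2e_bound (h : SD M w J θ C T ε j K) (X : ℝ) : ∃ C', 0 ≤ C' ∧ ∀ t x, 2 * T ≤ t → 0 < x → x ≤ X →
    |I2e M J T x t| ≤ C' * t ^ (-1/2 - θ) := by
  have hT := h.T0
  have hT1 := h.mh.T1
  have hε := h.ε0
  have hεθ := h.εθ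
  have hθ := h.mh.θ0
  have hK := h.K1
  haveI := h.ad.finite
  obtain ⟨B0, hB0⟩ := (isCompact_Icc (a := (0:ℝ)) (b := T)).exists_bound_of_continuousOn h.cont.continuousOn
  have hB00 : 0 ≤ B0 := (norm_nonneg _).trans (hB0 0 ⟨le_rfl, hT.le⟩)
  set D := B0 + K with hD
  have hD0 : 0 ≤ D := by positivity
  refine ⟨(8 * T * D + D * (X^2 + D^2)) * J.real (Ioc 0 T), by positivity, ?_⟩
  intro t x ht hx hxX
  have ht1 : 1 ≤ t := by linarith
  have ht0 : 0 < t := by linarith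
  have hte : 1 ≤ t ^ ε := Real.one_le_rpow ht1 hε.le
  have hkey : ∀ s ∈ Ioc 0 T, ‖(t/(t-s))^(3/2:ℝ)*((M s-M t)*gk (t-s) x (M s-M t)) - (M s - M t)‖ ≤
      (8 * T * D + D * (X^2 + D^2)) * t ^ (-1/2 - θ) := by
    intro s hs
    have hd : 0 ≤ M s - M t := by linarith [h.mh.mono s t hs.1.le (by linarith [hs.2]) (by linarith)]
    have hτ : 0 < t - s := by linarith [hs.2]
    have hdD : M s - M t ≤ D * t ^ ε := by
      have h1 := hB0 s ⟨hs.1.le, hs.2⟩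
      rw [Real.norm_eq_abs] at h1
      have h2 := h.negM t (by linarith)
      have h3 := le_abs_self (M s)
      rw [hD]; nlinarith
    have e1 : (t/(t-s))^(3/2:ℝ) = (1 - s/t) ^ (-3/2:ℝ) := by
      have : 1 - s/t = (t - s)/t := by field_simp
      rw [this, show (-3/2:ℝ) = -(3/2) by norm_num, Real.rpow_neg (by positivity), ← Real.inv_rpow (by positivity), inv_div]
    rw [e1]
    have hu : s / t ≤ 1/2 := by rw [div_le_div_iff₀ ht0 (by norm_num)]; linarith [hs.2]
    have hu0 : 0 ≤ s / t := by have := hs.1; positivity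
    obtain ⟨hp0, hp1⟩ := phi_bound hu0 (by linarith)
    have h4 := half_rpow_le hu
    have hg1 := gk_le_one hτ hx hd
    have hg0 := gk_nonneg hτ hx hd
    have hg2 : (M s - M t) * (1 - gk (t - s) x (M s - M t)) ≤ (D * t ^ ε) * ((X^2 + D^2) * (t ^ ε * t ^ ε) * (1/t)) := by
      rcases hd.eq_or_lt with h0 | h0
      · rw [← h0, zero_mul]; positivity
      · have h5 := one_sub_gk hτ hx h0
        have h6 : (x^2 + (M s - M t)^2) / (4 * (t - s)) ≤ (X^2 + D^2) * (t ^ ε * t ^ ε) * (1/t) := by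
          rw [mul_one_div, div_le_div_iff₀ (by positivity) ht0]
          have h7 : x^2 ≤ X^2 := by gcongr
          have h8 : (M s - M t)^2 ≤ (D * t ^ ε)^2 := by gcongr
          have h9 : 1 ≤ t ^ ε * t ^ ε := by nlinarith
          have h10 : x^2 + (M s - M t)^2 ≤ (X^2 + D^2) * (t ^ ε * t ^ ε) := by nlinarith [sq_nonneg X]
          have h11 : t ≤ 4 * (t - s) := by linarith [hs.2]
          calc _ ≤ ((X^2 + D^2) * (t ^ ε * t ^ ε)) * (4 * (t - s)) := by gcongr
            _ = _ := by ring
        have : 0 ≤ 1 - gk (t - s) x (M s - M t) := by linarith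
        gcongr
        exact h5.trans h6
    have e2 : (1 - s/t) ^ (-3/2:ℝ) * ((M s-M t)*gk (t-s) x (M s-M t)) - (M s - M t) =
      ((1 - s/t) ^ (-3/2:ℝ) - 1) * ((M s-M t)*gk (t-s) x (M s-M t)) - (M s - M t) * (1 - gk (t-s) x (M s-M t)) := by ring
    rw [e2, Real.norm_eq_abs]
    have hA0 : 0 ≤ ((1 - s/t) ^ (-3/2:ℝ) - 1) * ((M s-M t)*gk (t-s) x (M s-M t)) := by positivity
    have hB0' : 0 ≤ (M s - M t) * (1 - gk (t-s) x (M s-M t)) := mul_nonneg hd (by linarith)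
    have hA1 : ((1 - s/t) ^ (-3/2:ℝ) - 1) * ((M s-M t)*gk (t-s) x (M s-M t)) ≤ (8 * T * (1/t)) * (D * t ^ ε) := by
      have h5 : (1 - s/t) ^ (-3/2:ℝ) - 1 ≤ 8 * T * (1/t) := by
        refine hp1.trans ?_
        have h6 : s / t ≤ T * (1/t) := by rw [mul_one_div]; gcongr; exact hs.2
        calc _ ≤ 2 * (T * (1/t)) * 4 := by
              have : 0 ≤ (1 - s/t) ^ (-3/2:ℝ) := by linarith
              gcongr
          _ = _ := by ring
      have h6 : (M s-M t)*gk (t-s) x (M s-M t) ≤ D * t ^ ε := by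
        calc _ ≤ (M s - M t) * 1 := by gcongr
          _ ≤ _ := by linarith
      gcongr
    have e3 : t ^ ε * t ^ ε * t ^ ε * (1/t) = t ^ (3 * ε - 1) := by
      rw [one_div, ← Real.rpow_neg_one, ← Real.rpow_add ht0, ← Real.rpow_add ht0, ← Real.rpow_add ht0]; congr 1; ring
    have e4 : t ^ ε * (1/t) ≤ t ^ (3 * ε - 1) := by
      rw [← e3]; gcongr
      nlinarith
    have e5 : t ^ (3 * ε - 1) ≤ t ^ (-1/2 - θ) := Real.rpow_le_rpow_of_exponent_le ht1 (by linarith)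
    calc _ ≤ (8 * T * (1/t)) * (D * t ^ ε) + (D * t ^ ε) * ((X^2 + D^2) * (t ^ ε * t ^ ε) * (1/t)) := by
          rw [abs_le]; constructor <;> linarith
      _ = 8 * T * D * (t ^ ε * (1/t)) + D * (X^2 + D^2) * (t ^ ε * t ^ ε * t ^ ε * (1/t)) := by ring
      _ ≤ 8 * T * D * t ^ (-1/2 - θ) + D * (X^2 + D^2) * t ^ (-1/2 - θ) := by
          gcongr
          · exact e4.trans e5
          · rw [e3]; exact e5
      _ = _ := by ring
  unfold I2e
  rw [← Real.norm_eq_abs]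
  refine (norm_setIntegral_le_of_norm_le_const (measure_lt_top _ _) hkey).trans (le_of_eq ?_)
  ring

lemma one_sub_gk_rpow {τ x d X κ : ℝ} (hτ : 0 < τ) (hx : 0 < x) (hxX : x ≤ X) (hd : 0 < d) (hκ : 0 ≤ κ) (hκ1 : κ ≤ 1) :
    1 - gk τ x d ≤ (1 + X^2) * ((1 + d) ^ (2 * κ) * τ ^ (-κ)) := by
  have h1 := one_sub_gk hτ hx hd
  have hg := gk_nonneg hτ hx hd.le
  have hg1 := gk_le_one hτ hx hd.le
  set z := (1 + d)^2 / τ with hz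
  have hz0 : 0 < z := by positivity
  have h2 : 1 - gk τ x d ≤ (1 + X^2) * z := by
    refine h1.trans ?_
    rw [hz, ← mul_div_assoc, div_le_div_iff₀ (by positivity) hτ]
    have h7 : x^2 ≤ X^2 := by gcongr
    have h8 : x^2 + d^2 ≤ (1 + X^2) * (1 + d)^2 := by nlinarith [sq_nonneg X, mul_nonneg (sq_nonneg X) hd.le]
    have h9 : 0 ≤ (1 + X^2) * (1 + d)^2 := by positivity
    nlinarith
  have e : (1 + d) ^ (2 * κ) * τ ^ (-κ) = z ^ κ := by
    rw [hz, Real.div_rpow (by positivity) hτ.le, Real.rpow_neg hτ.le, div_eq_mul_inv, Real.rpow_mul (by positivity)]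
    norm_num
  rw [e]
  rcases le_total z 1 with h3 | h3
  · have : z ≤ z ^ κ := by
      nth_rewrite 1 [← Real.rpow_one z]
      exact Real.rpow_le_rpow_of_exponent_ge hz0 h3 hκ1
    exact h2.trans (by gcongr)
  · have : 1 ≤ z ^ κ := Real.one_le_rpow h3 hκ
    nlinarith [sq_nonneg X]

lemma SD.I1p_bound (h : SD M w J θ C T ε j K)
    (hmom : Integrable (fun y => (1 + |y|) ^ (1 + 2 * (θ + 2 * ε))) (mu0 w)) (X : ℝ) : ∃ C', 0 ≤ C' ∧ ∀ t x, T ≤ t → 0 < x → x ≤ X →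
    Integrable (fun y => (y - M t) * (1 - gk t x (y - M t))) (mu0 w) ∧ 0 ≤ I1p M w x t ∧ I1p M w x t ≤ C' * t ^ (-θ) := by
  have hT := h.T0
  have hT1 := h.mh.T1
  have hε := h.ε0
  have hεθ := h.εθ
  have hθ := h.mh.θ0
  have hK := h.K1
  haveI := h.ad.mu0_fin
  set κ := θ + 2 * ε with hκ
  set D := 1 + K with hD
  set m1 := ∫ y, (1 + |y|) ^ (1 + 2 * κ) ∂mu0 w with hm1
  have hm10 : 0 ≤ m1 := integral_nonneg (fun y => by positivity)
  refine ⟨(1 + X^2) * D ^ (1 + 2 * κ) * m1, by positivity, ?_⟩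
  intro t x ht hx hxX
  have ht1 : 1 ≤ t := by linarith
  have ht0 : 0 < t := by linarith
  have hte : 1 ≤ t ^ ε := Real.one_le_rpow ht1 hε.le
  have hkey : ∀ᵐ y ∂mu0 w, 0 ≤ (y - M t) * (1 - gk t x (y - M t)) ∧ (y - M t) * (1 - gk t x (y - M t)) ≤
      ((1 + X^2) * D ^ (1 + 2 * κ) * t ^ (-θ)) * (1 + |y|) ^ (1 + 2 * κ) := by
    filter_upwards [h.ad.mu0_neg] with y hy
    rw [h.mh.zero] at hy
    have hM0 := h.mh.neg t ht
    have hd : 0 < y - M t := by linarith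
    have hg1 := gk_le_one ht0 hx hd.le
    refine ⟨mul_nonneg hd.le (by linarith), ?_⟩
    have h1 := one_sub_gk_rpow ht0 hx hxX hd (show 0 ≤ κ by positivity) (by linarith)
    have h2 : 1 + (y - M t) ≤ D * t ^ ε * (1 + |y|) := by
      rw [abs_of_pos hy, hD]
      have := h.negM t ht
      have : 0 ≤ K * t ^ ε := by positivity
      nlinarith
    calc (y - M t) * (1 - gk t x (y - M t)) ≤ (1 + (y - M t)) * ((1 + X^2) * ((1 + (y - M t)) ^ (2 * κ) * t ^ (-κ))) := by
          have : 0 ≤ 1 - gk t x (y - M t) := by linarith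
          gcongr
          linarith
      _ = (1 + X^2) * t ^ (-κ) * (1 + (y - M t)) ^ (1 + 2 * κ) := by
          rw [Real.rpow_add (by linarith), Real.rpow_one]; ring
      _ ≤ (1 + X^2) * t ^ (-κ) * (D * t ^ ε * (1 + |y|)) ^ (1 + 2 * κ) := by
          gcongr
      _ = (1 + X^2) * D ^ (1 + 2 * κ) * (t ^ (-κ) * (t ^ ε) ^ (1 + 2 * κ)) * (1 + |y|) ^ (1 + 2 * κ) := by
          rw [Real.mul_rpow (by positivity) (by positivity), Real.mul_rpow (by positivity) (by positivity)]; ring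
      _ ≤ _ := by
          gcongr
          rw [← Real.rpow_mul ht0.le, ← Real.rpow_add ht0]
          apply Real.rpow_le_rpow_of_exponent_le ht1
          rw [hκ]; nlinarith
  have hi : Integrable (fun y => (y - M t) * (1 - gk t x (y - M t))) (mu0 w) := by
    refine Integrable.mono' (hmom.const_mul ((1 + X^2) * D ^ (1 + 2 * κ) * t ^ (-θ))) ?_ ?_
    · have := gk_meas (fun _ => t) measurable_const x (fun y => y - M t) (by fun_prop)
      exact Measurable.aestronglyMeasurable (by fun_prop)
    · filter_upwards [hkey] with y hy
      rw [Real.norm_eq_abs, abs_of_nonneg hy.1]; exact hy.2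
  refine ⟨hi, integral_nonneg_of_ae (hkey.mono fun y hy => hy.1), ?_⟩
  unfold I1p
  calc _ ≤ ∫ y, ((1 + X^2) * D ^ (1 + 2 * κ) * t ^ (-θ)) * (1 + |y|) ^ (1 + 2 * κ) ∂mu0 w :=
        integral_mono_ae hi (hmom.const_mul _) (hkey.mono fun y hy => hy.2)
    _ = _ := by rw [integral_const_mul, ← hm1]; ring

lemma SD.decomp (h : SD M w J θ C T ε j K) {t x : ℝ} (ht : T < t) (hx : 0 < x)
    (hi : Integrable (fun y => (y - M t) * (1 - gk t x (y - M t))) (mu0 w)) :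
    Wn M w x t = cc M w J - I1p M w x t - I3 M j t - I2e M J T x t - I2p M j T t + E2 M j T x t := by
  have hT := h.T0
  have ht0 : 0 < t := by linarith
  haveI := h.ad.mu0_fin
  haveI := h.ad.finite
  obtain ⟨-, h2, h3, h4⟩ := h.ad.Fx ht0 hx
  rw [h4]
  set F : ℝ → ℝ := fun s => (t/(t-s))^(3/2:ℝ)*((M s-M t)*gk (t-s) x (M s-M t)) with hF
  have a1 : (∫ y, (y - M t) * gk t x (y - M t) ∂mu0 w) = (∫ y, y ∂mu0 w) - M t * (mu0 w).real univ - I1p M w x t := by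
    have e : ∀ y, (y - M t) * gk t x (y - M t) = (y - M t) - (y - M t) * (1 - gk t x (y - M t)) := by intro y; ring
    simp only [e]
    have hyi : Integrable (fun y => y - M t) (mu0 w) := h.y1.sub (integrable_const _)
    rw [integral_sub hyi hi, integral_sub h.y1 (integrable_const _), integral_const, smul_eq_mul]
    unfold I1p; ring
  have hMi := h.M_int
  have hG : Integrable (fun s => M s - M t) J := hMi.sub (integrable_const _)
  have a2 : ∫ s, (M s - M t) ∂J = (∫ s, M s ∂J) - M t * (mu0 w).real univ := by
    rw [integral_sub hMi (integrable_const _), integral_const, smul_eq_mul, h.mass]; ring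
  have a3 : ∫ s, (M s - M t) ∂J = (∫ s in Ioc 0 T, (M s - M t) ∂J) + (∫ s in Ioo T t, (M s - M t) ∂J) - I3 M j t := by
    have hu : ∫ s, (M s - M t) ∂J = (∫ s in Ioi 0, (M s - M t) ∂J) := by
      rw [← integral_add_compl (measurableSet_Ioi (a := (0:ℝ))) hG, compl_Ioi, Measure.restrict_eq_zero.2 h.ad.Jneg]
      simp
    have hv : Ioi (0:ℝ) = Ioc 0 T ∪ Ioi T := (Ioc_union_Ioi_eq_Ioi hT.le).symm
    have hw : Ioi T = Ioc T t ∪ Ioi t := (Ioc_union_Ioi_eq_Ioi ht.le).symm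
    have hz : ∫ s in Ioi t, (M s - M t) ∂J = - I3 M j t := by
      rw [(h.conv measurableSet_Ioi (Ioi_subset_Ioi ht.le) _).2]
      unfold I3
      rw [← integral_neg]
      congr 1; ext s; ring
    have hy : ∫ s in Ioc T t, (M s - M t) ∂J = ∫ s in Ioo T t, (M s - M t) ∂J := by
      rw [(h.conv measurableSet_Ioc Ioc_subset_Ioi_self _).2, (h.conv measurableSet_Ioo Ioo_subset_Ioi_self _).2,
        integral_Ioc_eq_integral_Ioo]
    rw [hu, hv, setIntegral_union (Ioc_disjoint_Ioi le_rfl) measurableSet_Ioi hG.integrableOn hG.integrableOn, hw,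
      setIntegral_union (Ioc_disjoint_Ioi le_rfl) measurableSet_Ioi hG.integrableOn hG.integrableOn, hz, hy]
    ring
  have hsp : Ioo (0:ℝ) t = Ioc 0 T ∪ Ioo T t := (Ioc_union_Ioo_eq_Ioo hT.le ht).symm
  have hF1 : IntegrableOn F (Ioc 0 T) J := h3.mono_set (by rw [hsp]; exact subset_union_left)
  have hF2 : IntegrableOn F (Ioo T t) J := h3.mono_set (by rw [hsp]; exact subset_union_right)
  have a4 : ∫ s in Ioo 0 t, F s ∂J = (∫ s in Ioc 0 T, F s ∂J) + ∫ s in Ioo T t, F s ∂J := by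
    rw [hsp, setIntegral_union _ measurableSet_Ioo hF1 hF2]
    exact Set.disjoint_left.2 fun s hs hs' => absurd hs.2 (not_le.2 hs'.1)
  have a5 : ∫ s in Ioc 0 T, F s ∂J = I2e M J T x t + ∫ s in Ioc 0 T, (M s - M t) ∂J := by
    unfold I2e
    rw [integral_sub hF1 hG.integrableOn]; ring
  have a6 : ∫ s in Ioo T t, F s ∂J = I2p M j T t - E2 M j T x t + ∫ s in Ioo T t, (M s - M t) ∂J := by
    have hG' : IntegrableOn (fun s => (M s - M t) * j s) (Ioo T t) :=
      ((h.conv measurableSet_Ioo Ioo_subset_Ioi_self _).1).1 hG.integrableOn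
    rw [(h.conv measurableSet_Ioo Ioo_subset_Ioi_self _).2, (h.conv measurableSet_Ioo Ioo_subset_Ioi_self _).2]
    unfold I2p E2
    have hsub : IntegrableOn (fun s => ((1 - s/t) ^ (-3/2:ℝ) - 1) * ((M s - M t) * j s) -
        (1 - s/t) ^ (-3/2:ℝ) * ((M s - M t) * (1 - gk (t-s) x (M s - M t))) * j s) (Ioo T t) :=
      Integrable.sub (h.I2p_bound ht).1 (h.E2_bound ht hx le_rfl).1
    rw [← integral_sub (h.I2p_bound ht).1 (h.E2_bound ht hx le_rfl).1, ← integral_add hsub hG']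
    apply setIntegral_congr_fun measurableSet_Ioo
    intro s hs
    have hτ : 0 < t - s := by linarith [hs.2]
    have e1 : (t/(t-s))^(3/2:ℝ) = (1 - s/t) ^ (-3/2:ℝ) := by
      have : 1 - s/t = (t - s)/t := by field_simp
      rw [this, show (-3/2:ℝ) = -(3/2) by norm_num, Real.rpow_neg (by positivity), ← Real.inv_rpow (by positivity), inv_div]
    simp only [hF]
    rw [e1]; ring
  rw [a1, a4, a5, a6]
  unfold cc
  linarith
end PartN

open MeasureTheory ProbabilityTheory Filter Real Set Asymptotics
open scoped NNReal ENNReal Topology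
set_option linter.all false
set_option linter.deprecated false

section PartO
variable {M : ℝ → ℝ} {w : ℝ → ℝ → ℝ≥0∞} {J : Measure ℝ} {θ C T ε K : ℝ} {j : ℝ → ℝ}

lemma SD.stepC (h : SD M w J θ C T ε j K)
    (hmom : Integrable (fun y => (1 + |y|) ^ (1 + 2 * (θ + 2 * ε))) (mu0 w)) : ∃ C', 0 ≤ C' ∧ ∀ t x, 2 * T ≤ t → 0 < x → x ≤ 1 →
    |Wn M w x t - cc M w J| ≤ C' * t ^ (-θ) := by
  have hT := h.T0
  have hT1 := h.mh.T1
  have hε := h.ε0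
  have hεθ := h.εθ
  have hθ := h.mh.θ0
  have hK := h.K1
  obtain ⟨C1, hC1, h1⟩ := h.I1p_bound hmom 1
  obtain ⟨C2, hC2, h2⟩ := h.I2e_bound 1
  set C3 := 2 * (K * K) * Bt (1/2) (1/2) with hC3
  set C4 := (2 * (1^2 + K^2) * K^2 * Bt (1/2 - θ - 3 * ε) (1/2 - θ - ε)) with hC4
  have hC30 : 0 ≤ C3 := by have := Bt_nonneg (1/2) (1/2); positivity
  have hC40 : 0 ≤ C4 := by have := Bt_nonneg (1/2 - θ - 3 * ε) (1/2 - θ - ε); positivity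
  refine ⟨C1 + 4 * (K * K) + C2 + C3 + C4, by positivity, ?_⟩
  intro t x ht hx hx1
  have ht1 : 1 ≤ t := by linarith
  obtain ⟨a1, a2, a3⟩ := h1 t x (by linarith) hx hx1
  have a4 := h2 t x ht hx hx1
  have a5 := (h.I3_bound (t := t) (by linarith)).2
  have a6 := (h.I2p_bound (t := t) (by linarith)).2
  have a7 := (h.E2_bound (t := t) (by linarith) hx hx1).2
  rw [← hC3] at a6
  rw [← hC4] at a7
  rw [h.decomp (by linarith) hx a1]
  have e1 : t ^ (-1/2 + ε) ≤ t ^ (-θ) := Real.rpow_le_rpow_of_exponent_le ht1 (by linarith)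
  have e2 : t ^ (-1/2 - θ) ≤ t ^ (-θ) := Real.rpow_le_rpow_of_exponent_le ht1 (by linarith)
  have b4 := a4.trans (mul_le_mul_of_nonneg_left e2 hC2)
  have b5 := a5.trans (mul_le_mul_of_nonneg_left e1 (by positivity))
  have b6 := a6.trans (mul_le_mul_of_nonneg_left e1 hC30)
  have b7 := a7.trans (mul_le_mul_of_nonneg_left e2 hC40)
  rw [abs_le] at *
  have : 0 ≤ t ^ (-θ) := by positivity
  constructor <;> nlinarith

lemma Wn_nonneg {x t : ℝ} (ht : 0 ≤ t) (hx : 0 < x) : 0 ≤ Wn M w x t := by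
  unfold Wn
  have : 0 ≤ (w (M t + x) t).toReal := ENNReal.toReal_nonneg
  positivity

lemma SD.stepD (h : SD M w J θ C T ε j K)
    (hmom : Integrable (fun y => (1 + |y|) ^ (1 + 2 * (θ + 2 * ε))) (mu0 w)) : ∃ C', 0 ≤ C' ∧ ∀ᵐ s, T < s →
    |j s - cc M w J / (2 * √π) * s ^ (-3/2:ℝ)| ≤ C' * s ^ (-3/2 - θ) := by
  have hT := h.T0
  have hT1 := h.mh.T1
  have hε := h.ε0
  have hεθ := h.εθ
  have hθ := h.mh.θ0
  have hK := h.K1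
  obtain ⟨C1, hC1, h1⟩ := h.stepC hmom
  set c := cc M w J with hc
  set q := 2 * √π with hq
  have hq0 : 0 < q := by positivity
  refine ⟨C1 / q + (K + |c| / q) * (2 * T), by positivity, ?_⟩
  filter_upwards [h.jub, h.jcmp] with s hs1 hs2 hsT
  have hs0 : 0 < s := by linarith
  have hs11 : 1 ≤ s := by linarith
  have hj0 := h.j0 s
  have e0 : s ^ (-3/2 - θ) = s ^ (-3/2:ℝ) * s ^ (-θ) := by rw [← Real.rpow_add hs0]; rfl
  have p0 : 0 < s ^ (-3/2:ℝ) := Real.rpow_pos_of_pos hs0 _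
  have pt : 0 < s ^ (-θ) := Real.rpow_pos_of_pos hs0 _
  rcases lt_or_ge s (2 * T) with h2T | h2T
  · have a1 := hs1 hsT
    have e1 : s ^ (-3/2 + ε) ≤ s ^ (-3/2 - θ) * (2 * T) := by
      rw [show -3/2 + ε = (-3/2 - θ) + (θ + ε) by ring, Real.rpow_add hs0]
      gcongr
      calc s ^ (θ + ε) ≤ s ^ (1:ℝ) := Real.rpow_le_rpow_of_exponent_le hs11 (by linarith)
        _ ≤ _ := by rw [Real.rpow_one]; linarith
    have e2 : s ^ (-3/2:ℝ) ≤ s ^ (-3/2 - θ) * (2 * T) := by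
      refine le_trans ?_ e1
      exact Real.rpow_le_rpow_of_exponent_le hs11 (by linarith)
    calc _ ≤ |j s| + |c / q * s ^ (-3/2:ℝ)| := abs_sub _ _
      _ = j s + |c| / q * s ^ (-3/2:ℝ) := by
          rw [abs_of_nonneg hj0, abs_mul, abs_div, abs_of_pos hq0, abs_of_pos p0]
      _ ≤ K * (s ^ (-3/2 - θ) * (2 * T)) + |c| / q * (s ^ (-3/2 - θ) * (2 * T)) := by
          gcongr
          exact a1.trans (by gcongr)
      _ = ((K + |c| / q) * (2 * T)) * s ^ (-3/2 - θ) := by ring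
      _ ≤ _ := by
          gcongr
          have : 0 ≤ C1 / q := by positivity
          linarith
  · have hwf : ∀ x > 0, w (M s + x) s ≠ ∞ := fun x hx => (h.ad.Fx hs0 hx).1
    obtain ⟨hup, hlo⟩ := hs2 hsT
    have hup1 : j s ≤ (c + C1 * s ^ (-θ)) / q * s ^ (-3/2:ℝ) := by
      have hb : 0 ≤ c + C1 * s ^ (-θ) := by
        have a1 := h1 s 1 h2T one_pos le_rfl
        have a2 := Wn_nonneg (M := M) (w := w) hs0.le one_pos
        rw [abs_le] at a1; linarith
      apply hup _ (by positivity) (K * s ^ ε / q * s ^ (-3/2:ℝ)) (by positivity)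
      intro x hx
      rcases le_or_gt x 1 with hx1 | hx1
      · have a1 := h1 s x h2T hx hx1
        rw [abs_le] at a1
        refine (w_of_Wn hs0 hx (hwf x hx) (B := c + C1 * s ^ (-θ)) (by linarith)).trans (ENNReal.ofReal_le_ofReal ?_)
        have : 0 ≤ K * s ^ ε / q * s ^ (-3/2:ℝ) * x ^ 2 := by positivity
        linarith
      · refine (w_of_Wn hs0 hx (hwf x hx) (h.wub s hsT.le x hx)).trans (ENNReal.ofReal_le_ofReal ?_)
        have a1 : 0 ≤ K * s ^ ε / q * s ^ (-3/2:ℝ) := by positivity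
        have a2 : 0 ≤ (c + C1 * s ^ (-θ)) / q * s ^ (-3/2:ℝ) * x := by positivity
        have a3 : x ≤ x ^ 2 := by nlinarith
        have a4 := mul_le_mul_of_nonneg_left a3 a1
        linarith
    have hlo1 : (c - C1 * s ^ (-θ)) / q * s ^ (-3/2:ℝ) ≤ j s := by
      rcases le_or_gt 0 (c - C1 * s ^ (-θ)) with hb | hb
      · apply hlo _ (by positivity)
        intro x hx
        have a1 := h1 s x h2T hx.1 hx.2
        rw [abs_le] at a1
        exact w_of_Wn' hs0 hx.1 (hwf x hx.1) (by linarith)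
      · refine le_trans ?_ hj0
        apply mul_nonpos_of_nonpos_of_nonneg _ p0.le
        exact div_nonpos_of_nonpos_of_nonneg hb.le hq0.le
    calc _ ≤ C1 / q * s ^ (-3/2 - θ) := by
          rw [abs_le, e0]
          have e5 : (c + C1 * s ^ (-θ)) / q * s ^ (-3/2:ℝ) = c / q * s ^ (-3/2:ℝ) + C1 / q * (s ^ (-3/2:ℝ) * s ^ (-θ)) := by ring
          have e6 : (c - C1 * s ^ (-θ)) / q * s ^ (-3/2:ℝ) = c / q * s ^ (-3/2:ℝ) - C1 / q * (s ^ (-3/2:ℝ) * s ^ (-θ)) := by ring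
          constructor <;> linarith
      _ ≤ _ := by
          gcongr
          have : 0 ≤ (K + |c| / q) * (2 * T) := by positivity
          linarith

lemma logint {t : ℝ} (ht : 0 < t) : IntegrableOn (fun s => Real.log (s/t) * s ^ (-3/2:ℝ)) (Ioi t) ∧
    ∫ s in Ioi t, Real.log (s/t) * s ^ (-3/2:ℝ) = 4 * t ^ (-1/2:ℝ) := by
  set f : ℝ → ℝ := fun s => -2 * (Real.log (s/t) * s ^ (-1/2:ℝ)) - 4 * s ^ (-1/2:ℝ) with hf
  have hd : ∀ s, 0 < s → HasDerivAt f (Real.log (s/t) * s ^ (-3/2:ℝ)) s := by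
    intro s hs
    have h1 : HasDerivAt (fun s => Real.log (s/t)) ((1/t)/(s/t)) s :=
      ((hasDerivAt_id s).div_const t).log (by positivity)
    have h2 : HasDerivAt (fun s : ℝ => s ^ (-1/2:ℝ)) ((-1/2) * s ^ ((-1/2:ℝ) - 1)) s :=
      Real.hasDerivAt_rpow_const (Or.inl hs.ne')
    have h3 := ((h1.mul h2).const_mul (-2)).sub (h2.const_mul 4)
    refine h3.congr_deriv ?_
    have e : s ^ (-1/2:ℝ) = s * s ^ (-3/2:ℝ) := by
      nth_rewrite 2 [← Real.rpow_one s]; rw [← Real.rpow_add hs]; norm_num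
    rw [show ((-1/2:ℝ) - 1) = -3/2 by norm_num, e]
    field_simp
    ring
  have hlim : Tendsto f atTop (𝓝 0) := by
    have h1 : Tendsto (fun s : ℝ => s ^ (-1/2:ℝ)) atTop (𝓝 0) := by
      have := tendsto_rpow_neg_atTop (show (0:ℝ) < 1/2 by norm_num)
      simpa [neg_div] using this
    have h2 : Tendsto (fun s : ℝ => Real.log s / s ^ (1/2:ℝ)) atTop (𝓝 0) :=
      (isLittleO_log_rpow_atTop (show (0:ℝ) < 1/2 by norm_num)).tendsto_div_nhds_zero
    have h3 : Tendsto (fun s : ℝ => -2 * (Real.log s / s ^ (1/2:ℝ) - Real.log t * s ^ (-1/2:ℝ)) - 4 * s ^ (-1/2:ℝ)) atTop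
        (𝓝 (-2 * (0 - Real.log t * 0) - 4 * 0)) := ((h2.sub (h1.const_mul _)).const_mul _).sub (h1.const_mul _)
    simp only [mul_zero, sub_zero] at h3
    refine h3.congr' ?_
    filter_upwards [eventually_gt_atTop 0] with s hs
    simp only [hf]
    rw [Real.log_div hs.ne' ht.ne', neg_div, Real.rpow_neg hs.le, div_eq_mul_inv]
    ring
  have hc : ContinuousWithinAt f (Ici t) t := (hd t ht).continuousAt.continuousWithinAt
  have hnn : ∀ s ∈ Ioi t, 0 ≤ Real.log (s/t) * s ^ (-3/2:ℝ) := by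
    intro s hs
    have hs0 : 0 < s := ht.trans hs
    have : 0 ≤ Real.log (s/t) := Real.log_nonneg (by rw [le_div_iff₀ ht]; linarith [show t < s from hs])
    positivity
  refine ⟨integrableOn_Ioi_deriv_of_nonneg hc (fun s hs => hd s (ht.trans hs)) hnn hlim, ?_⟩
  rw [integral_Ioi_of_hasDerivAt_of_nonneg hc (fun s hs => hd s (ht.trans hs)) hnn hlim]
  simp only [hf, div_self ht.ne', Real.log_one]
  ring

lemma SD.I3_asym (h : SD M w J θ C T ε j K) {c' C' : ℝ} (hC' : 0 ≤ C')
    (hj : ∀ᵐ s, T < s → |j s - c' * s ^ (-3/2:ℝ)| ≤ C' * s ^ (-3/2 - θ)) :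
    ∃ D, 0 ≤ D ∧ ∀ t, T ≤ t → |I3 M j t - 6 * c' * t ^ (-1/2:ℝ)| ≤ D * t ^ (-1/2 - θ) := by
  have hT := h.T0
  have hT1 := h.mh.T1
  have hε := h.ε0
  have hεθ := h.εθ
  have hθ := h.mh.θ0
  have hK := h.K1
  have hC0 := h.mh.C0
  refine ⟨4 * (K * C' + C * |c'|), by positivity, ?_⟩
  intro t ht
  have ht0 : 0 < t := by linarith
  obtain ⟨l1, l2⟩ := logint ht0
  have l1' := l1.const_mul (3/2 * c')
  have e : I3 M j t - 6 * c' * t ^ (-1/2:ℝ) =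
      ∫ s in Ioi t, ((M t - M s) * j s - 3/2 * c' * (Real.log (s/t) * s ^ (-3/2:ℝ))) := by
    rw [integral_sub (h.I3_bound ht).1 l1', integral_const_mul, l2]
    unfold I3; ring
  rw [e]
  have := (tail_bound (f := fun s => (M t - M s) * j s - 3/2 * c' * (Real.log (s/t) * s ^ (-3/2:ℝ)))
      (P := (K * C' + C * |c'|) * t ^ (-θ - ε)) (a := -3/2 + ε) ht0 (by linarith)
      ((h.I3_bound ht).1.sub l1').aestronglyMeasurable (by
    filter_upwards [hj] with s hs hst
    have hs0 : 0 < s := by linarith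
    have h1 := hs (by linarith)
    have h2 := h.dub t s ht hst.le
    have h3 := (h.mh.lip ht hst.le).1
    have h6 := h.mh.est t s ht hst.le
    have p1 : 0 < s ^ (-3/2:ℝ) := Real.rpow_pos_of_pos hs0 _
    have hts : 0 ≤ t / s := by positivity
    have hts1 : t / s ≤ 1 := by rw [div_le_one hs0]; exact hst.le
    have h5 : 1 ≤ t ^ (-ε) * s ^ ε := by
      rw [Real.rpow_neg ht0.le, ← div_eq_inv_mul, one_le_div (by positivity)]
      gcongr
    have h4 : (1 - t/s) * (t/s) ^ (-ε) ≤ t ^ (-ε) * s ^ ε := by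
      rw [Real.div_rpow ht0.le hs0.le, Real.rpow_neg hs0.le, div_inv_eq_mul]
      nlinarith
    have e1 : (M t - M s) * j s - 3/2 * c' * (Real.log (s/t) * s ^ (-3/2:ℝ)) =
      (M t - M s) * (j s - c' * s ^ (-3/2:ℝ)) + (M t - M s - 3/2 * Real.log (s/t)) * (c' * s ^ (-3/2:ℝ)) := by ring
    have e2 : s ^ (-3/2 - θ) ≤ s ^ (-3/2:ℝ) * t ^ (-θ) := by
      rw [sub_eq_add_neg, Real.rpow_add hs0]
      gcongr ?_ * ?_
      exact Real.rpow_le_rpow_of_nonpos ht0 hst.le (by linarith)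
    rw [e1]
    calc _ ≤ |M t - M s| * |j s - c' * s ^ (-3/2:ℝ)| + |M t - M s - 3/2 * Real.log (s/t)| * |c' * s ^ (-3/2:ℝ)| := by
          rw [← abs_mul, ← abs_mul]; exact abs_add_le _ _
      _ ≤ (K * (t ^ (-ε) * s ^ ε)) * (C' * (s ^ (-3/2:ℝ) * t ^ (-θ))) + (C * t ^ (-θ) * (t ^ (-ε) * s ^ ε)) * (|c'| * s ^ (-3/2:ℝ)) := by
          rw [abs_mul c', abs_of_pos p1, abs_of_nonneg h3]
          gcongr
          · exact h2.trans (by gcongr)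
          · exact h1.trans (by gcongr)
          · refine h6.trans ?_
            gcongr
            linarith
      _ = (K * C' + C * |c'|) * (t ^ (-θ) * t ^ (-ε)) * (s ^ (-3/2:ℝ) * s ^ ε) := by ring
      _ = _ := by rw [← Real.rpow_add ht0, ← Real.rpow_add hs0]; rfl)).2
  refine this.trans ?_
  have h7 : 1 / (-(-3/2 + ε + 1)) ≤ 4 := by
    rw [div_le_iff₀ (by linarith)]; linarith
  have e1 : t ^ (-θ - ε) * t ^ (-3/2 + ε + 1) = t ^ (-1/2 - θ) := by
    rw [← Real.rpow_add ht0]; congr 1; ring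
  calc _ = (K * C' + C * |c'|) * (t ^ (-θ - ε) * t ^ (-3/2 + ε + 1)) * (1 / (-(-3/2 + ε + 1))) := by ring
    _ ≤ (K * C' + C * |c'|) * (t ^ (-θ - ε) * t ^ (-3/2 + ε + 1)) * 4 := by gcongr
    _ = _ := by rw [e1]; ring

end PartO

open MeasureTheory ProbabilityTheory Filter Real Set Asymptotics
open scoped NNReal ENNReal Topology
set_option linter.all false
set_option linter.deprecated false

section PartP
variable {M : ℝ → ℝ} {w : ℝ → ℝ → ℝ≥0∞} {J : Measure ℝ} {θ C T ε K : ℝ} {j : ℝ → ℝ}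

noncomputable def Qf (u : ℝ) : ℝ := -(Real.log u * (2 * √u / √(1-u) - 2 * √(1-u) / √u + 2 / √u)) +
  8 * Real.arcsin (√u) + (4 * √(1-u) / √u - 4 / √u)

lemma rpow_neg_three_half {v : ℝ} (hv : 0 < v) : v ^ (-3/2:ℝ) = 1 / (√v)^3 := by
  rw [Real.sqrt_eq_rpow, ← Real.rpow_natCast, ← Real.rpow_mul hv.le, one_div, ← Real.rpow_neg hv.le]
  norm_num

lemma Qf_deriv {u : ℝ} (hu : u ∈ Ioo (0:ℝ) 1) :
    HasDerivAt Qf (((1-u)^(-3/2:ℝ) - 1) * (-Real.log u * u ^ (-3/2:ℝ))) u := by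
  have h0 := hu.1
  have h1 : 0 < 1 - u := by linarith [hu.2]
  rw [rpow_neg_three_half h0, rpow_neg_three_half h1]
  have hρ : HasDerivAt (fun u => √u) (1 / (2 * √u)) u := Real.hasDerivAt_sqrt h0.ne'
  have hσ : HasDerivAt (fun u => √(1-u)) (-1 / (2 * √(1-u))) u := by
    exact ((hasDerivAt_id u).const_sub 1).sqrt h1.ne'
  have hl := Real.hasDerivAt_log h0.ne'
  have hs1 : √u < 1 := by rw [Real.sqrt_lt' one_pos]; simpa using hu.2
  have hρ0 : 0 < √u := Real.sqrt_pos.2 h0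
  have hσ0 : 0 < √(1-u) := Real.sqrt_pos.2 h1
  have ha : HasDerivAt (fun u => Real.arcsin (√u)) (1 / √(1 - (√u)^2) * (1 / (2 * √u))) u :=
    (Real.hasDerivAt_arcsin (by linarith) (by linarith)).comp u hρ
  have hP := (((hρ.const_mul 2).div hσ hσ0.ne').sub ((hσ.const_mul 2).div hρ hρ0.ne')).add
    ((hasDerivAt_const u (2:ℝ)).div hρ hρ0.ne')
  have hR := ((hσ.const_mul 4).div hρ hρ0.ne').sub ((hasDerivAt_const u (4:ℝ)).div hρ hρ0.ne')
  have := ((hl.mul hP).neg.add (ha.const_mul 8)).add hR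
  refine this.congr_deriv ?_
  simp only [Pi.add_apply, Pi.sub_apply, Pi.div_apply, Pi.mul_apply]
  rw [Real.sq_sqrt h0.le]
  have e0 : (√u)^2 = u := Real.sq_sqrt h0.le
  have e1 : (√(1-u))^2 = 1 - u := Real.sq_sqrt h1.le
  have e2 : (√(1-u))^2 + (√u)^2 = 1 := by rw [e0, e1]; ring
  have e3 : u⁻¹ = 1 / (√u)^2 := by rw [e0, one_div]
  rw [e3]
  set ρ := √u
  set σ := √(1-u)
  set L := Real.log u
  have e5 : ρ^2 = 1 - σ^2 := by linarith
  have e6 : u = 1 - σ^2 := by linarith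
  clear_value ρ σ L
  field_simp
  rw [e5, e6]
  ring

lemma Qf_zero : Tendsto Qf (𝓝[>] 0) (𝓝 0) := by
  have hev : ∀ᶠ u in 𝓝[>] (0:ℝ), u ∈ Ioo (0:ℝ) 1 := Ioo_mem_nhdsGT one_pos
  have h1 : Tendsto (fun u : ℝ => Real.log u * √u) (𝓝[>] 0) (𝓝 0) := by
    have := tendsto_log_mul_rpow_nhdsGT_zero (show (0:ℝ) < 1/2 by norm_num)
    refine this.congr' ?_
    filter_upwards [hev] with u hu
    rw [Real.sqrt_eq_rpow]
  have h2 : Tendsto (fun u : ℝ => (2 / √(1-u) + 2 / (1 + √(1-u)))) (𝓝[>] 0) (𝓝 (2 / √(1-0) + 2 / (1 + √(1-0)))) := by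
    apply Tendsto.mono_left _ nhdsWithin_le_nhds
    have : ContinuousAt (fun u : ℝ => (2 / √(1-u) + 2 / (1 + √(1-u)))) 0 := by
      apply ContinuousAt.add
      · apply ContinuousAt.div (by fun_prop) (by fun_prop) (by norm_num)
      · apply ContinuousAt.div (by fun_prop) (by fun_prop) (by positivity)
    exact this
  have h3 : Tendsto (fun u : ℝ => 8 * Real.arcsin (√u) - 4 * √u / (1 + √(1-u))) (𝓝[>] 0) (𝓝 (8 * Real.arcsin (√0) - 4 * √0 / (1 + √(1-0)))) := by
    apply Tendsto.mono_left _ nhdsWithin_le_nhds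
    have : ContinuousAt (fun u : ℝ => 8 * Real.arcsin (√u) - 4 * √u / (1 + √(1-u))) 0 := by
      apply ContinuousAt.sub
      · exact (Real.continuous_arcsin.comp Real.continuous_sqrt).continuousAt.const_mul 8 
      · apply ContinuousAt.div (by fun_prop) (by fun_prop) (by positivity)
    exact this
  have h4 := (h1.mul h2).neg.add h3
  have e : -(0 * (2 / √(1-0) + 2 / (1 + √(1-0)))) + (8 * Real.arcsin (√0) - 4 * √0 / (1 + √(1-0))) = 0 := by simp
  rw [e] at h4
  refine h4.congr' ?_
  filter_upwards [hev] with u hu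
  have h0 := hu.1
  have h1 : 0 < 1 - u := by linarith [hu.2]
  have hρ0 : 0 < √u := Real.sqrt_pos.2 h0
  have hσ0 : 0 < √(1-u) := Real.sqrt_pos.2 h1
  unfold Qf
  have e0 : (√u)^2 = u := Real.sq_sqrt h0.le
  have e1 : (√(1-u))^2 = 1 - u := Real.sq_sqrt h1.le
  have e3 : (1 - √(1-u)) / √u = √u / (1 + √(1-u)) := by
    rw [div_eq_div_iff hρ0.ne' (by positivity)]; nlinarith
  have e4 : 2 * √u / √(1-u) - 2 * √(1-u) / √u + 2 / √u = √u * (2 / √(1-u)) + 2 * ((1 - √(1-u)) / √u) := by ring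
  have e5 : 4 * √(1-u) / √u - 4 / √u = -4 * ((1 - √(1-u)) / √u) := by ring
  rw [e4, e5, e3]; ring

lemma Qf_one : Tendsto Qf (𝓝[<] 1) (𝓝 (4 * π - 4)) := by
  have hev : ∀ᶠ u in 𝓝[<] (1:ℝ), u ∈ Ioo (0:ℝ) 1 := Ioo_mem_nhdsLT one_pos
  have h1 : Tendsto (fun u : ℝ => Real.log u / √(1-u)) (𝓝[<] 1) (𝓝 0) := by
    have hb : Tendsto (fun u : ℝ => -(√(1-u) / u)) (𝓝[<] 1) (𝓝 (-(√(1-1) / 1))) := by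
      apply Tendsto.mono_left _ nhdsWithin_le_nhds
      have : ContinuousAt (fun u : ℝ => -(√(1-u) / u)) 1 := by
        apply ContinuousAt.neg
        apply ContinuousAt.div (by fun_prop) (by fun_prop) (by norm_num)
      exact this
    simp only [sub_self, Real.sqrt_zero, zero_div, neg_zero] at hb
    refine tendsto_of_tendsto_of_tendsto_of_le_of_le' hb tendsto_const_nhds ?_ ?_
    · filter_upwards [hev] with u hu
      have h0 := hu.1
      have h1 : 0 < 1 - u := by linarith [hu.2]
      have hσ0 : 0 < √(1-u) := Real.sqrt_pos.2 h1
      have h2 := Real.one_sub_inv_le_log_of_pos h0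
      rw [le_div_iff₀ hσ0]
      have e1 : √(1-u) * √(1-u) = 1 - u := Real.mul_self_sqrt h1.le
      have : -(√(1-u)/u) * √(1-u) = 1 - u⁻¹ := by
        have : -(√(1-u)/u) * √(1-u) = -(√(1-u) * √(1-u))/u := by ring
        rw [this, e1]; field_simp; ring
      linarith
    · filter_upwards [hev] with u hu
      exact div_nonpos_of_nonpos_of_nonneg (Real.log_nonpos hu.1.le hu.2.le) (Real.sqrt_nonneg _)
  have h2 : Tendsto (fun u : ℝ => √u * (2 + 2 * √(1-u) / (1 + √(1-u)))) (𝓝[<] 1) (𝓝 (√1 * (2 + 2 * √(1-1) / (1 + √(1-1))))) := by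
    apply Tendsto.mono_left _ nhdsWithin_le_nhds
    have : ContinuousAt (fun u : ℝ => √u * (2 + 2 * √(1-u) / (1 + √(1-u)))) 1 := by
      apply ContinuousAt.mul (by fun_prop)
      apply ContinuousAt.add (by fun_prop)
      apply ContinuousAt.div (by fun_prop) (by fun_prop) (by positivity)
    exact this
  have h3 : Tendsto (fun u : ℝ => 8 * Real.arcsin (√u) - 4 * √u / (1 + √(1-u))) (𝓝[<] 1) (𝓝 (8 * Real.arcsin (√1) - 4 * √1 / (1 + √(1-1)))) := by
    apply Tendsto.mono_left _ nhdsWithin_le_nhds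
    have : ContinuousAt (fun u : ℝ => 8 * Real.arcsin (√u) - 4 * √u / (1 + √(1-u))) 1 := by
      apply ContinuousAt.sub
      · exact (Real.continuous_arcsin.comp Real.continuous_sqrt).continuousAt.const_mul 8 
      · apply ContinuousAt.div (by fun_prop) (by fun_prop) (by positivity)
    exact this
  have h4 := (h1.mul h2).neg.add h3
  have e : -(0 * (√1 * (2 + 2 * √(1-1) / (1 + √(1-1))))) + (8 * Real.arcsin (√1) - 4 * √1 / (1 + √(1-1))) = 4 * π - 4 := by
    simp; ring
  rw [e] at h4
  refine h4.congr' ?_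
  filter_upwards [hev] with u hu
  have h0 := hu.1
  have h1 : 0 < 1 - u := by linarith [hu.2]
  have hρ0 : 0 < √u := Real.sqrt_pos.2 h0
  have hσ0 : 0 < √(1-u) := Real.sqrt_pos.2 h1
  unfold Qf
  have e0 : (√u)^2 = u := Real.sq_sqrt h0.le
  have e1 : (√(1-u))^2 = 1 - u := Real.sq_sqrt h1.le
  have e3 : (1 - √(1-u)) / √u = √u / (1 + √(1-u)) := by
    rw [div_eq_div_iff hρ0.ne' (by positivity)]; nlinarith
  have e4 : 2 * √u / √(1-u) - 2 * √(1-u) / √u + 2 / √u = √u * (2 / √(1-u)) + 2 * ((1 - √(1-u)) / √u) := by ring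
  have e5 : 4 * √(1-u) / √u - 4 / √u = -4 * ((1 - √(1-u)) / √u) := by ring
  rw [e4, e5, e3]
  field_simp
  ring

/-- integrand of the main term of `I2p` -/
noncomputable def psi (t s : ℝ) : ℝ := ((1 - s/t) ^ (-3/2:ℝ) - 1) * (-Real.log (s/t) * s ^ (-3/2:ℝ))

lemma psi_int {t : ℝ} (ht : 0 < t) : IntegrableOn (psi t) (Ioo 0 t) := by
  unfold psi
  refine (phi_gen (f := fun s => -Real.log (s/t) * s ^ (-3/2:ℝ)) (T := 0) (t := t) (P := 4) (ε := 1/4) (β := 0) le_rfl ht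
    (by norm_num) (by norm_num) (by fun_prop) (Filter.Eventually.of_forall ?_)).1
  intro s hs
  have hs0 : 0 < s := hs.1
  have h0 : 0 < s / t := by positivity
  have h1 : s / t ≤ 1 := by rw [div_le_one ht]; exact hs.2.le
  have h2 := neg_log_le h0 h1 (show (0:ℝ) < 1/4 by norm_num) (by norm_num)
  have h3 : 0 ≤ -Real.log (s/t) := by linarith [Real.log_nonpos h0.le h1]
  have h4 : 0 < s ^ (-3/2:ℝ) := Real.rpow_pos_of_pos hs0 _
  rw [abs_of_nonneg (by positivity), sub_zero]
  have h5 := mul_le_mul_of_nonneg_right h2 h4.le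
  norm_num at h5 ⊢
  linarith

lemma psi_val {t : ℝ} (ht : 0 < t) : ∫ s in Ioo 0 t, psi t s = (4 * π - 4) * t ^ (-1/2:ℝ) := by
  have h1 : IntervalIntegrable (fun u => ((1-u)^(-3/2:ℝ) - 1) * (-Real.log u * u ^ (-3/2:ℝ))) volume 0 1 := by
    rw [intervalIntegrable_iff_integrableOn_Ioo_of_le zero_le_one]
    have := psi_int one_pos
    unfold psi at this
    simpa using this
  have h2 := intervalIntegral.integral_eq_sub_of_hasDerivAt_of_tendsto one_pos (fun u hu => Qf_deriv hu) h1 Qf_zero Qf_one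
  have h3 := intervalIntegral.integral_comp_div (a := 0) (b := t) (fun u : ℝ => ((1-u)^(-3/2:ℝ) - 1) * (-Real.log u * u ^ (-3/2:ℝ))) ht.ne'
  rw [zero_div, div_self ht.ne', h2, smul_eq_mul, intervalIntegral.integral_of_le ht.le, integral_Ioc_eq_integral_Ioo] at h3
  have h4 : ∀ s ∈ Ioo 0 t, psi t s = t ^ (-3/2:ℝ) * (((1-s/t)^(-3/2:ℝ) - 1) * (-Real.log (s/t) * (s/t) ^ (-3/2:ℝ))) := by
    intro s hs
    unfold psi
    rw [Real.div_rpow hs.1.le ht.le]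
    have : t ^ (-3/2:ℝ) ≠ 0 := (Real.rpow_pos_of_pos ht _).ne'
    field_simp
  rw [setIntegral_congr_fun measurableSet_Ioo h4, integral_const_mul, h3]
  rw [show (-1/2:ℝ) = -3/2 + 1 by norm_num, Real.rpow_add ht, Real.rpow_one]
  ring

lemma psi_small {t T ε : ℝ} (hT : 0 < T) (ht : 2 * T ≤ t) (hε : 0 < ε) (hε1 : ε < 1/2) :
    |∫ s in Ioc 0 T, psi t s| ≤ (8 / ε * (T ^ (1/2 - ε) / (1/2 - ε))) * t ^ (-1 + ε) := by
  have ht0 : 0 < t := by linarith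
  have hgi : IntervalIntegrable (fun s : ℝ => s ^ (-1/2 - ε)) volume 0 T :=
    intervalIntegral.intervalIntegrable_rpow' (by linarith)
  have hg : IntegrableOn (fun s : ℝ => 8 / ε * t ^ (-1 + ε) * s ^ (-1/2 - ε)) (Ioc 0 T) := by
    apply Integrable.const_mul
    exact (intervalIntegrable_iff_integrableOn_Ioc_of_le hT.le).1 hgi
  have hb : ∀ᵐ s ∂(volume.restrict (Ioc 0 T)), ‖psi t s‖ ≤ 8 / ε * t ^ (-1 + ε) * s ^ (-1/2 - ε) := by
    rw [ae_restrict_iff' measurableSet_Ioc]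
    refine Filter.Eventually.of_forall fun s hs => ?_
    have hs0 : 0 < s := hs.1
    have h0 : 0 < s / t := by positivity
    have hu : s / t ≤ 1/2 := by rw [div_le_div_iff₀ ht0 (by norm_num)]; linarith [hs.2]
    have h1 : s / t ≤ 1 := by linarith
    have h2 := neg_log_le h0 h1 hε (by linarith)
    have h3 : 0 ≤ -Real.log (s/t) := by linarith [Real.log_nonpos h0.le h1]
    have h4 : 0 < s ^ (-3/2:ℝ) := Real.rpow_pos_of_pos hs0 _
    obtain ⟨hp0, hp1⟩ := phi_bound h0.le (by linarith)
    have h5 := half_rpow_le hu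
    unfold psi
    rw [Real.norm_eq_abs, abs_of_nonneg (by positivity)]
    have h6 : -Real.log (s/t) ≤ (1/ε) * (s/t) ^ (-ε) := by
      refine h2.trans ?_
      gcongr
      have : 0 < (s/t) ^ (-ε) := Real.rpow_pos_of_pos h0 _
      nlinarith
    have h7 : (1 - s/t) ^ (-3/2:ℝ) - 1 ≤ 8 * (s/t) := by
      refine hp1.trans ?_
      nlinarith
    have e1 : (s/t) * (s/t) ^ (-ε) = s * s ^ (-ε) * (t ^ (-1 + ε)) := by
      rw [Real.div_rpow hs0.le ht0.le, Real.rpow_add ht0, Real.rpow_neg_one, Real.rpow_neg ht0.le]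
      field_simp
    have e2 : s * s ^ (-ε) * s ^ (-3/2:ℝ) = s ^ (-1/2 - ε) := by
      nth_rewrite 1 [← Real.rpow_one s]
      rw [← Real.rpow_add hs0, ← Real.rpow_add hs0]; congr 1; ring
    calc _ ≤ (8 * (s/t)) * (((1/ε) * (s/t) ^ (-ε)) * s ^ (-3/2:ℝ)) := by gcongr
      _ = 8 / ε * ((s/t) * (s/t) ^ (-ε)) * s ^ (-3/2:ℝ) := by ring
      _ = 8 / ε * t ^ (-1 + ε) * (s * s ^ (-ε) * s ^ (-3/2:ℝ)) := by rw [e1]; ring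
      _ = _ := by rw [e2]
  rw [← Real.norm_eq_abs]
  refine (norm_integral_le_of_norm_le hg hb).trans (le_of_eq ?_)
  rw [integral_const_mul, ← intervalIntegral.integral_of_le hT.le, integral_rpow (Or.inl (by linarith)),
    Real.zero_rpow (by linarith)]
  rw [show (-1/2 - ε + 1) = 1/2 - ε by ring]
  ring

lemma SD.I2p_asym (h : SD M w J θ C T ε j K) {c' C' : ℝ} (hC' : 0 ≤ C')
    (hj : ∀ᵐ s, T < s → |j s - c' * s ^ (-3/2:ℝ)| ≤ C' * s ^ (-3/2 - θ)) :
    ∃ D, 0 ≤ D ∧ ∀ t, 2 * T ≤ t → |I2p M j T t - 6 * (π - 1) * c' * t ^ (-1/2:ℝ)| ≤ D * t ^ (-1/2 - θ) := by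
  have hT := h.T0
  have hT1 := h.mh.T1
  have hε := h.ε0
  have hεθ := h.εθ
  have hθ := h.mh.θ0
  have hK := h.K1
  have hC0 := h.mh.C0
  set P := K * C' + C * |c'| with hP
  have hP0 : 0 ≤ P := by positivity
  set S := 8 / ε * (T ^ (1/2 - ε) / (1/2 - ε)) with hS
  have hS0 : 0 ≤ S := by
    have : 0 < 1/2 - ε := by linarith
    positivity
  set B1 := 2 * P * Bt (1/2 - ε - θ) (1/2) with hB1
  have hB10 : 0 ≤ B1 := by have := Bt_nonneg (1/2 - ε - θ) (1/2); positivity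
  refine ⟨B1 + 3/2 * |c'| * S, by positivity, ?_⟩
  intro t ht
  have ht0 : 0 < t := by linarith
  have ht1 : 1 ≤ t := by linarith
  have hTt : T < t := by linarith
  have hpi := psi_int ht0
  have hps := psi_small (ε := ε) hT ht hε (by linarith)
  rw [← hS] at hps
  have hpv := psi_val ht0
  have hsp : Ioo (0:ℝ) t = Ioc 0 T ∪ Ioo T t := (Ioc_union_Ioo_eq_Ioo hT.le hTt).symm
  have hp2 : IntegrableOn (psi t) (Ioo T t) := hpi.mono_set (by rw [hsp]; exact subset_union_right)
  rw [hsp, setIntegral_union (Set.disjoint_left.2 fun s hs hs' => absurd hs.2 (not_le.2 hs'.1)) measurableSet_Ioo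
    (hpi.mono_set (by rw [hsp]; exact subset_union_left)) hp2] at hpv
  have hp2' := hp2.const_mul (3/2 * c')
  have hph := phi_gen (f := fun s => (M s - M t) * j s - 3/2 * c' * (-Real.log (s/t) * s ^ (-3/2:ℝ))) (P := P) (ε := ε)
    (β := θ) hT.le hTt hP0 (by linarith) (by
      have h1 := h.cont.measurable
      have h2 := h.jm
      fun_prop) (by
    filter_upwards [hj] with s hs hsm
    have hs0 : 0 < s := hT.trans hsm.1
    have h1 := hs hsm.1
    have h2 := h.dub s t hsm.1.le hsm.2.le
    have h3 := (h.mh.lip hsm.1.le hsm.2.le).1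
    have h6 := h.mh.est s t hsm.1.le hsm.2.le
    have p1 : 0 < s ^ (-3/2:ℝ) := Real.rpow_pos_of_pos hs0 _
    have h0 : 0 < s / t := by positivity
    have hu1 : s / t ≤ 1 := by rw [div_le_one ht0]; exact hsm.2.le
    have hue : 1 ≤ (s/t) ^ (-ε) := Real.one_le_rpow_of_pos_of_le_one_of_nonpos h0 hu1 (by linarith)
    have el : Real.log (t/s) = -Real.log (s/t) := by rw [← Real.log_inv, inv_div]
    rw [el] at h6
    have e1 : (M s - M t) * j s - 3/2 * c' * (-Real.log (s/t) * s ^ (-3/2:ℝ)) =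
      (M s - M t) * (j s - c' * s ^ (-3/2:ℝ)) + (M s - M t - 3/2 * -Real.log (s/t)) * (c' * s ^ (-3/2:ℝ)) := by ring
    have e2 : s ^ (-3/2 - θ) = s ^ (-3/2:ℝ) * s ^ (-θ) := by
      rw [sub_eq_add_neg, Real.rpow_add hs0]
    rw [e1]
    have hv : 0 ≤ 1 - s/t := by linarith
    calc _ ≤ |M s - M t| * |j s - c' * s ^ (-3/2:ℝ)| + |M s - M t - 3/2 * -Real.log (s/t)| * |c' * s ^ (-3/2:ℝ)| := by
          rw [← abs_mul, ← abs_mul]; exact abs_add_le _ _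
      _ ≤ (K * ((1 - s/t) * (s/t) ^ (-ε))) * (C' * s ^ (-3/2 - θ)) + (C * s ^ (-θ) * ((1 - s/t) * (s/t) ^ (-ε))) * (|c'| * s ^ (-3/2:ℝ)) := by
          rw [abs_mul c', abs_of_pos p1, abs_of_nonneg h3]
          gcongr
          refine h6.trans ?_
          gcongr
          nlinarith
      _ = _ := by rw [e2, hP]; ring)
  rw [← hB1] at hph
  have e : ∫ s in Ioo T t, ((1 - s/t) ^ (-3/2:ℝ) - 1) * ((M s - M t) * j s - 3/2 * c' * (-Real.log (s/t) * s ^ (-3/2:ℝ))) =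
      I2p M j T t - 3/2 * c' * ∫ s in Ioo T t, psi t s := by
    unfold I2p
    rw [← integral_const_mul, ← integral_sub (h.I2p_bound hTt).1 hp2']
    congr 1; ext s; unfold psi; ring
  rw [e] at hph
  have hexp : t ^ (-1 + ε) ≤ t ^ (-1/2 - θ) := Real.rpow_le_rpow_of_exponent_le ht1 (by linarith)
  have e3 : I2p M j T t - 6 * (π - 1) * c' * t ^ (-1/2:ℝ) =
      (I2p M j T t - 3/2 * c' * ∫ s in Ioo T t, psi t s) - 3/2 * c' * ∫ s in Ioc 0 T, psi t s := by
    linear_combination (3/2 * c') * hpv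
  rw [e3]
  calc _ ≤ |I2p M j T t - 3/2 * c' * ∫ s in Ioo T t, psi t s| + |3/2 * c' * ∫ s in Ioc 0 T, psi t s| := abs_sub _ _
    _ ≤ B1 * t ^ (-1/2 - θ) + 3/2 * |c'| * (S * t ^ (-1/2 - θ)) := by
        gcongr
        · exact hph.2
        · rw [abs_mul, abs_mul, abs_of_pos (show (0:ℝ) < 3/2 by norm_num)]
          gcongr
          exact hps.trans (by gcongr)
    _ = _ := by ring

end PartP

open MeasureTheory ProbabilityTheory Filter Real Set Asymptotics
open scoped NNReal ENNReal Topology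
set_option linter.all false
set_option linter.deprecated false

section PartQ

lemma minint {ν : ℝ} (h1 : -4 < ν) (h2 : ν ≤ -3) : IntegrableOn (fun z : ℝ => z ^ (ν+1) * min 1 (z^2)) (Ioi 0) := by
  rw [← Ioc_union_Ioi_eq_Ioi zero_le_one]
  apply IntegrableOn.union
  · have h3 : IntegrableOn (fun z : ℝ => z ^ (ν+3)) (Ioc 0 1) :=
      (intervalIntegrable_iff_integrableOn_Ioc_of_le zero_le_one).1 (intervalIntegral.intervalIntegrable_rpow' (by linarith))
    refine Integrable.mono' h3 (Measurable.aestronglyMeasurable (by fun_prop)) ?_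
    rw [ae_restrict_iff' measurableSet_Ioc]
    refine Filter.Eventually.of_forall fun z hz => ?_
    have hz0 := hz.1
    rw [Real.norm_eq_abs, abs_of_nonneg (by positivity)]
    calc _ ≤ z ^ (ν+1) * z^2 := by gcongr; exact min_le_right _ _
      _ = _ := by
        rw [← Real.rpow_natCast, ← Real.rpow_add hz0]; congr 1; push_cast; ring
  · have h3 : IntegrableOn (fun z : ℝ => z ^ (ν+1)) (Ioi 1) := integrableOn_Ioi_rpow_of_lt (by linarith) one_pos
    refine Integrable.mono' h3 (Measurable.aestronglyMeasurable (by fun_prop)) ?_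
    rw [ae_restrict_iff' measurableSet_Ioi]
    refine Filter.Eventually.of_forall fun z hz => ?_
    have hz0 : 0 < z := one_pos.trans hz
    rw [Real.norm_eq_abs, abs_of_nonneg (by positivity)]
    calc _ ≤ z ^ (ν+1) * 1 := by gcongr; exact min_le_left _ _
      _ = _ := by ring

lemma one_sub_exp_bd (z : ℝ) : 0 ≤ 1 - Real.exp (-(1/4) * z^2) ∧ 1 - Real.exp (-(1/4) * z^2) ≤ min 1 (z^2) := by
  have h1 : Real.exp (-(1/4) * z^2) ≤ 1 := Real.exp_le_one_iff.2 (by nlinarith [sq_nonneg z])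
  have h2 := Real.add_one_le_exp (-(1/4) * z^2)
  refine ⟨by linarith, le_min (by linarith [Real.exp_pos (-(1/4) * z^2)]) (by nlinarith [sq_nonneg z])⟩

lemma gamma_int {ν : ℝ} (h1 : -4 < ν) (h2 : ν ≤ -3) :
    ∫ z in Ioi (0:ℝ), z ^ (ν+1) * (1 - Real.exp (-(1/4) * z^2)) = -(2 ^ (ν+1) * Real.Gamma (ν/2 + 1)) := by
  set a := ν + 2 with ha
  have ha0 : a < 0 := by linarith
  have ha2 : 0 < a + 2 := by linarith
  set F : ℝ → ℝ := fun z => z ^ a * (1 - Real.exp (-(1/4) * z^2)) with hF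
  have hi1 : IntegrableOn (fun z : ℝ => z ^ (ν+1) * (1 - Real.exp (-(1/4) * z^2))) (Ioi 0) := by
    refine Integrable.mono' (minint h1 h2) (Measurable.aestronglyMeasurable (by fun_prop)) ?_
    rw [ae_restrict_iff' measurableSet_Ioi]
    refine Filter.Eventually.of_forall fun z hz => ?_
    have hz0 : 0 < z := hz
    obtain ⟨b1, b2⟩ := one_sub_exp_bd z
    rw [Real.norm_eq_abs, abs_of_nonneg (by positivity)]
    gcongr
  have hi2 : IntegrableOn (fun z : ℝ => z ^ (a+1) * Real.exp (-(1/4) * z^2)) (Ioi 0) :=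
    integrableOn_rpow_mul_exp_neg_mul_sq (by norm_num) (by linarith)
  have hd : ∀ z ∈ Ioi (0:ℝ), HasDerivAt F (a * (z ^ (ν+1) * (1 - Real.exp (-(1/4) * z^2))) +
      (1/2) * (z ^ (a+1) * Real.exp (-(1/4) * z^2))) z := by
    intro z hz
    have hz0 : 0 < z := hz
    have d1 : HasDerivAt (fun z : ℝ => z ^ a) (a * z ^ (a-1)) z := Real.hasDerivAt_rpow_const (Or.inl hz0.ne')
    have d2 : HasDerivAt (fun z : ℝ => -(1/4) * z^2) (-(1/4) * (2 * z)) z := by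
      have := (hasDerivAt_pow 2 z).const_mul (-(1/4:ℝ))
      simpa using this
    have d3 := d1.mul (d2.exp.const_sub 1)
    refine d3.congr_deriv ?_
    rw [show a - 1 = ν + 1 by rw [ha]; ring, Real.rpow_add hz0 a 1, Real.rpow_one]
    ring
  have hbd : ∀ z, 0 ≤ z → |F z| ≤ z ^ (a + 2) := by
    intro z hz
    rcases hz.eq_or_lt with rfl | hz0
    · simp only [hF]; rw [Real.zero_rpow ha0.ne, Real.zero_rpow ha2.ne']; simp
    · obtain ⟨b1, b2⟩ := one_sub_exp_bd z
      simp only [hF]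
      rw [abs_of_nonneg (by positivity)]
      have : z ^ (a+2) = z ^ a * z^2 := by
        rw [Real.rpow_add hz0]; norm_num
      rw [this]
      gcongr
      exact b2.trans (min_le_right _ _)
  have hF0 : F 0 = 0 := by simp only [hF]; rw [Real.zero_rpow ha0.ne, zero_mul]
  have hc : ContinuousWithinAt F (Ici 0) 0 := by
    show Tendsto F (𝓝[Ici 0] 0) (𝓝 (F 0))
    rw [hF0]
    have h3 : Tendsto (fun z : ℝ => z ^ (a+2)) (𝓝[Ici 0] 0) (𝓝 0) := by
      have : ContinuousAt (fun z : ℝ => z ^ (a+2)) 0 := Real.continuousAt_rpow_const _ _ (Or.inr ha2.le)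
      have h4 := this.tendsto
      rw [Real.zero_rpow ha2.ne'] at h4
      exact h4.mono_left nhdsWithin_le_nhds
    refine squeeze_zero_norm' ?_ h3
    filter_upwards [self_mem_nhdsWithin] with z hz
    exact hbd z hz
  have hlim : Tendsto F atTop (𝓝 0) := by
    have h3 : Tendsto (fun z : ℝ => z ^ a) atTop (𝓝 0) := by
      have := tendsto_rpow_neg_atTop (show 0 < -a by linarith)
      simpa using this
    refine squeeze_zero_norm' ?_ h3
    filter_upwards [eventually_gt_atTop 0] with z hz
    obtain ⟨b1, b2⟩ := one_sub_exp_bd z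
    simp only [hF]
    rw [Real.norm_eq_abs, abs_of_nonneg (by positivity)]
    have : 1 - Real.exp (-(1/4) * z^2) ≤ 1 := b2.trans (min_le_left _ _)
    have h5 : 0 < z ^ a := by positivity
    nlinarith
  have hi1' := hi1.const_mul a
  have hi2' := hi2.const_mul (1/2)
  have h6 := integral_Ioi_of_hasDerivAt_of_tendsto hc hd (hi1'.add hi2') hlim
  rw [integral_add hi1' hi2', integral_const_mul, integral_const_mul, hF0] at h6
  have h7 := integral_rpow_mul_exp_neg_mul_rpow (p := 2) (q := a + 1) (b := 1/4) (by norm_num) (by linarith) (by norm_num)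
  have h8 : ∫ z in Ioi (0:ℝ), z ^ (a+1) * Real.exp (-(1/4) * z^2) = ∫ z in Ioi (0:ℝ), z ^ (a+1) * Real.exp (-(1/4) * z ^ (2:ℝ)) := by
    norm_num
  rw [h8, h7] at h6
  have h9 : Real.Gamma ((a + 1 + 1)/2) = (a/2) * Real.Gamma (ν/2 + 1) := by
    rw [show (a+1+1)/2 = a/2 + 1 by ring, Real.Gamma_add_one (by linarith), show ν/2 + 1 = a/2 by rw [ha]; ring]
  have h10 : (1/4:ℝ) ^ (-(a+1+1)/2) = 8 * 2 ^ (ν+1) := by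
    rw [show (1/4:ℝ) = (2:ℝ) ^ (-2:ℝ) by rw [Real.rpow_neg (by norm_num)]; norm_num, ← Real.rpow_mul (by norm_num),
      show -2 * (-(a+1+1)/2) = (ν + 1) + 2 + 1 by rw [ha]; ring]
    rw [Real.rpow_add (by norm_num), Real.rpow_add (by norm_num)]
    norm_num
    ring
  rw [h9, h10] at h6
  have : a * ((∫ z in Ioi (0:ℝ), z ^ (ν+1) * (1 - Real.exp (-(1/4) * z^2))) + (2 ^ (ν+1) * Real.Gamma (ν/2 + 1))) = 0 := by
    linarith
  rcases mul_eq_zero.1 this with h | h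
  · exact absurd h ha0.ne
  · linarith

lemma gamma_neg {ν : ℝ} (h1 : -4 < ν) (h2 : ν ≤ -3) : Real.Gamma (ν/2 + 1) < 0 := by
  have h3 := Real.Gamma_add_one (s := ν/2 + 1) (by linarith)
  have h4 : 0 < Real.Gamma (ν/2 + 1 + 1) := Real.Gamma_pos_of_pos (by linarith)
  rw [h3] at h4
  by_contra hcon
  push Not at hcon
  nlinarith

lemma gk_lim {x z : ℝ} (hx : 0 < x) (hz : 0 < z) {d : ℝ → ℝ} (hd : Tendsto (fun t => d t / √t) atTop (𝓝 z))
    (hd0 : ∀ᶠ t in atTop, 0 < d t) : Tendsto (fun t => gk t x (d t)) atTop (𝓝 (Real.exp (-(1/4) * z^2))) := by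
  have hi : Tendsto (fun t : ℝ => x^2 / t) atTop (𝓝 0) := tendsto_const_nhds.div_atTop tendsto_id
  have l1 : Tendsto (fun t => Real.exp (-(1/4) * (x^2/t) - 1/4 * (d t / √t)^2)) atTop (𝓝 (Real.exp (-(1/4) * 0 - 1/4 * z^2))) :=
    (Real.continuous_exp.tendsto _).comp ((hi.const_mul _).sub ((hd.pow 2).const_mul _))
  have l2 : Tendsto (fun t => Real.exp (-(1/4 * (d t / √t)^2) * (1 - 1/2 * (x^2/t)))) atTop (𝓝 (Real.exp (-(1/4 * z^2) * (1 - 1/2 * 0)))) :=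
    (Real.continuous_exp.tendsto _).comp (((hd.pow 2).const_mul _).neg.mul ((hi.const_mul _).const_sub _))
  rw [show -(1/4) * 0 - 1/4 * z^2 = -(1/4) * z^2 by ring] at l1
  rw [show -(1/4 * z^2) * (1 - 1/2 * 0) = -(1/4) * z^2 by ring] at l2
  refine tendsto_of_tendsto_of_tendsto_of_le_of_le' l1 l2 ?_ ?_
  · filter_upwards [hd0, eventually_gt_atTop 0] with t h1 ht
    refine le_trans (le_of_eq ?_) (gk_lower ht hx h1)
    rw [div_pow, Real.sq_sqrt ht.le]
    congr 1; field_simp; ring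
  · filter_upwards [hd0, eventually_gt_atTop 0] with t h1 ht
    refine (gk_upper ht hx h1).trans (le_of_eq ?_)
    rw [div_pow, Real.sq_sqrt ht.le]
    congr 1; field_simp

lemma I1_alg (d k G : ℝ) {s q u : ℝ} (hs : s ≠ 0) (hq : q ≠ 0) (hu : u ≠ 0) :
    d / s * (1 - k) * (G / (q * u)) * u = 1 / (s * s * q) * (s * (d * (1 - k) * G)) := by
  field_simp

set_option maxHeartbeats 1000000 in
lemma I1_asym {M g : ℝ → ℝ} {K ε ν A x : ℝ} (hK : 1 ≤ K) (hε : 0 < ε) (hν1 : -4 < ν) (hν2 : ν ≤ -3) (hA : 0 < A)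
    (hεν : 6 * ε - 1 < 1 + ν/2) (hx : 0 < x)
    (hM0 : ∀ᶠ t in atTop, M t ≤ 0) (hMK : ∀ᶠ t in atTop, -M t ≤ K * t ^ ε)
    (hgm : Measurable g) (hg0 : ∀ y, 0 ≤ g y) (hgi : IntegrableOn g (Ioi 0))
    (hg : Tendsto (fun y => g y / y ^ ν) atTop (𝓝 A))
    (hI : ∀ᶠ t in atTop, IntegrableOn (fun y => (y - M t) * (1 - gk t x (y - M t)) * g y) (Ioi 0)) :
    Tendsto (fun t => t ^ (-(1 + ν/2)) * ∫ y in Ioi 0, (y - M t) * (1 - gk t x (y - M t)) * g y) atTop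
      (𝓝 (A * ∫ z in Ioi (0:ℝ), z ^ (ν+1) * (1 - Real.exp (-(1/4) * z^2)))) := by
  set H : ℝ → ℝ → ℝ := fun t y => (y - M t) * (1 - gk t x (y - M t)) * g y with hH
  have hHm : ∀ t, Measurable (H t) := by
    intro t
    have := gk_meas (fun _ => t) measurable_const x (fun y => y - M t) (by fun_prop)
    simp only [hH]; fun_prop
  have hevt : ∀ᶠ t in atTop, (1:ℝ) ≤ t := eventually_ge_atTop 1
  -- small part
  have hsmall : Tendsto (fun t => t ^ (-(1 + ν/2)) * ∫ y in Ioc 0 (t ^ (2*ε)), H t y) atTop (𝓝 0) := by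
    set G := ∫ y in Ioi 0, g y with hG
    set D := (1 + K) * (x^2 + (1+K)^2) with hD
    have hlim : Tendsto (fun t : ℝ => D * G * t ^ (-(1 + ν/2) + (6*ε - 1))) atTop (𝓝 (D * G * 0)) := by
      apply Tendsto.const_mul
      have := tendsto_rpow_neg_atTop (show 0 < (1 + ν/2) - (6*ε - 1) by linarith)
      refine this.congr fun t => ?_
      congr 1; ring
    rw [mul_zero] at hlim
    refine squeeze_zero_norm' ?_ hlim
    filter_upwards [hevt, hM0, hMK] with t ht h1 h2
    have ht0 : 0 < t := by linarith
    have hte : 1 ≤ t ^ (2*ε) := Real.one_le_rpow ht (by linarith)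
    have hte2 : t ^ ε ≤ t ^ (2*ε) := Real.rpow_le_rpow_of_exponent_le ht (by linarith)
    have hgi' : IntegrableOn g (Ioc 0 (t ^ (2*ε))) := hgi.mono_set Ioc_subset_Ioi_self
    have hb : ∀ᵐ y ∂(volume.restrict (Ioc 0 (t ^ (2*ε)))), ‖H t y‖ ≤ (D * t ^ (6*ε - 1)) * g y := by
      rw [ae_restrict_iff' measurableSet_Ioc]
      refine Filter.Eventually.of_forall fun y hy => ?_
      have hd : 0 < y - M t := by linarith [hy.1]
      have hd2 : y - M t ≤ (1 + K) * t ^ (2*ε) := by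
        have := mul_le_mul_of_nonneg_left hte2 (show 0 ≤ K by linarith)
        linarith [hy.2]
      have g1 := gk_le_one ht0 hx hd.le
      have g2 := one_sub_gk ht0 hx hd
      have g3 : 1 - gk t x (y - M t) ≤ (x^2 + (1+K)^2) * (t ^ (2*ε) * t ^ (2*ε)) * (1/t) := by
        refine g2.trans ?_
        rw [mul_one_div, div_le_div_iff₀ (by positivity) ht0]
        have b1 : (y - M t)^2 ≤ ((1 + K) * t ^ (2*ε))^2 := by gcongr
        have b2 : 1 ≤ t ^ (2*ε) * t ^ (2*ε) := by nlinarith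
        have b3 : x^2 + (y - M t)^2 ≤ (x^2 + (1+K)^2) * (t ^ (2*ε) * t ^ (2*ε)) := by nlinarith [sq_nonneg x]
        have b4 : 0 ≤ (x^2 + (1+K)^2) * (t ^ (2*ε) * t ^ (2*ε)) := by positivity
        nlinarith
      have e1 : t ^ (2*ε) * (t ^ (2*ε) * t ^ (2*ε)) * (1/t) = t ^ (6*ε - 1) := by
        rw [one_div, ← Real.rpow_neg_one, ← Real.rpow_add ht0, ← Real.rpow_add ht0, ← Real.rpow_add ht0]; congr 1; ring
      have g0 : 0 ≤ 1 - gk t x (y - M t) := by linarith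
      have gy := hg0 y
      simp only [hH]
      rw [Real.norm_eq_abs, abs_of_nonneg (by positivity)]
      calc _ ≤ ((1 + K) * t ^ (2*ε)) * ((x^2 + (1+K)^2) * (t ^ (2*ε) * t ^ (2*ε)) * (1/t)) * g y := by gcongr
        _ = D * (t ^ (2*ε) * (t ^ (2*ε) * t ^ (2*ε)) * (1/t)) * g y := by rw [hD]; ring
        _ = _ := by rw [e1]
    have h3 := norm_integral_le_of_norm_le (hgi'.const_mul (D * t ^ (6*ε - 1))) hb
    rw [integral_const_mul] at h3
    have h4 : ∫ y in Ioc 0 (t ^ (2*ε)), g y ≤ G :=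
      setIntegral_mono_set hgi (Filter.Eventually.of_forall fun y => hg0 y) (Filter.Eventually.of_forall fun y hy => hy.1)
    have tp : 0 < t ^ (-(1 + ν/2)) := by positivity
    rw [norm_mul, Real.norm_eq_abs, abs_of_pos tp]
    calc _ ≤ t ^ (-(1 + ν/2)) * (D * t ^ (6*ε - 1) * G) := by
          gcongr
          exact h3.trans (by gcongr)
      _ = D * G * (t ^ (-(1 + ν/2)) * t ^ (6*ε - 1)) := by ring
      _ = _ := by rw [← Real.rpow_add ht0]
  -- large part
  set F : ℝ → ℝ → ℝ := fun t z => t ^ (-(1 + ν/2)) * (√t * (Ioi (t ^ (2*ε))).indicator (H t) (√t * z)) with hF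
  set E := 1 + x^2 + (1 + K)^2 with hE
  have hE1 : 1 ≤ E := by nlinarith [sq_nonneg x]
  obtain ⟨Y0, hY0⟩ : ∃ Y0 : ℝ, ∀ y ≥ Y0, g y / y ^ ν ≤ 2 * A := by
    have := hg.eventually (eventually_le_nhds (show A < 2 * A by linarith))
    exact eventually_atTop.1 this
  have hYlim : Tendsto (fun t : ℝ => t ^ (2*ε)) atTop atTop := tendsto_rpow_atTop (by linarith)
  have hpow : ∀ t z : ℝ, 0 < t → 0 < z → ∀ β : ℝ, (√t * z) ^ β = t ^ (β/2) * z ^ β := by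
    intro t z ht hz β
    rw [Real.mul_rpow (by positivity) hz.le, Real.sqrt_eq_rpow, ← Real.rpow_mul ht.le]
    congr 2; ring
  have hlarge : Tendsto (fun t => ∫ z in Ioi (0:ℝ), F t z) atTop
      (𝓝 (∫ z in Ioi (0:ℝ), A * (z ^ (ν+1) * (1 - Real.exp (-(1/4) * z^2))))) := by
    refine tendsto_integral_filter_of_dominated_convergence (fun z => (1 + K) * E * (2 * A) * (z ^ (ν+1) * min 1 (z^2))) ?_ ?_
      ((minint hν1 hν2).const_mul _) ?_
    · refine Filter.Eventually.of_forall fun t => ?_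
      have := (hHm t).indicator (measurableSet_Ioi (a := t ^ (2*ε)))
      exact Measurable.aestronglyMeasurable (by fun_prop)
    · filter_upwards [hevt, hM0, hMK, hYlim.eventually_ge_atTop Y0] with t ht h1 h2 h3
      rw [ae_restrict_iff' measurableSet_Ioi]
      refine Filter.Eventually.of_forall fun z hz => ?_
      have hz0 : 0 < z := hz
      have ht0 : 0 < t := by linarith
      have hb0 : 0 ≤ (1 + K) * E * (2 * A) * (z ^ (ν+1) * min 1 (z^2)) := by positivity
      simp only [hF]
      by_cases hy : √t * z ∈ Ioi (t ^ (2*ε))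
      · rw [indicator_of_mem hy]
        have hy' : t ^ (2*ε) < √t * z := hy
        set y := √t * z with hyd
        have hte : 1 ≤ t ^ (2*ε) := Real.one_le_rpow ht (by linarith)
        have hte2 : t ^ ε ≤ t ^ (2*ε) := Real.rpow_le_rpow_of_exponent_le ht (by linarith)
        have hy0 : 0 < y := by linarith
        have hd : 0 < y - M t := by linarith
        have hd2 : y - M t ≤ (1 + K) * y := by
          have := mul_le_mul_of_nonneg_left (hte2.trans hy'.le) (show 0 ≤ K by linarith)
          linarith
        have g1 := gk_le_one ht0 hx hd.le
        have g2 := one_sub_gk ht0 hx hd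
        have gn := gk_nonneg ht0 hx hd.le
        have hyz : y^2 = t * z^2 := by rw [hyd, mul_pow, Real.sq_sqrt ht0.le]
        have g3 : 1 - gk t x (y - M t) ≤ E * min 1 (z^2) := by
          rw [mul_min_of_nonneg _ _ (by positivity)]
          apply le_min (by linarith)
          refine g2.trans ?_
          rw [div_le_iff₀ (by positivity)]
          have b1 : (y - M t)^2 ≤ ((1 + K) * y)^2 := by gcongr
          have b2 : 1 ≤ y^2 := by nlinarith
          have b3 : x^2 + (y - M t)^2 ≤ E * y^2 := by rw [hE]; nlinarith [sq_nonneg x]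
          rw [hyz] at b3
          have b4 : 0 ≤ E * (t * z^2) := by positivity
          nlinarith
        have g0 : 0 ≤ 1 - gk t x (y - M t) := by linarith
        have gy := hg0 y
        have gy2 : g y ≤ 2 * A * y ^ ν := by
          have := hY0 y (by linarith)
          rwa [div_le_iff₀ (by positivity)] at this
        simp only [hH]
        rw [Real.norm_eq_abs, abs_of_nonneg (by positivity)]
        calc _ ≤ t ^ (-(1 + ν/2)) * (√t * (((1 + K) * y) * (E * min 1 (z^2)) * (2 * A * y ^ ν))) := by gcongr
          _ = (1 + K) * E * (2 * A) * (t ^ (-(1 + ν/2)) * √t * (y ^ (1 + ν)) * min 1 (z^2)) := by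
              rw [Real.rpow_add hy0, Real.rpow_one]; ring
          _ = (1 + K) * E * (2 * A) * ((t ^ (-(1 + ν/2)) * t ^ (1/2:ℝ) * t ^ ((1 + ν)/2)) * z ^ (1 + ν) * min 1 (z^2)) := by
              rw [hyd, hpow t z ht0 hz0, Real.sqrt_eq_rpow]; ring
          _ = _ := by
              rw [← Real.rpow_add ht0, ← Real.rpow_add ht0, show -(1 + ν/2) + 1/2 + (1+ν)/2 = 0 by ring, Real.rpow_zero,
                add_comm ν 1]
              ring
      · rw [indicator_of_notMem hy]
        simpa using hb0
    · rw [ae_restrict_iff' measurableSet_Ioi]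
      refine Filter.Eventually.of_forall fun z hz => ?_
      have hz0 : 0 < z := hz
      have hsq : Tendsto (fun t : ℝ => √t * z) atTop atTop := Real.tendsto_sqrt_atTop.atTop_mul_const hz0
      have hMs : Tendsto (fun t : ℝ => M t / √t) atTop (𝓝 0) := by
        have hl : Tendsto (fun t : ℝ => K * t ^ (-(1/2 - ε))) atTop (𝓝 (K * 0)) :=
          (tendsto_rpow_neg_atTop (by linarith)).const_mul K
        rw [mul_zero] at hl
        refine squeeze_zero_norm' ?_ hl
        filter_upwards [hevt, hM0, hMK] with t ht h1 h2
        have ht0 : 0 < t := by linarith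
        rw [Real.norm_eq_abs, abs_div, abs_of_nonpos h1, abs_of_pos (Real.sqrt_pos.2 ht0), div_le_iff₀ (Real.sqrt_pos.2 ht0),
          Real.sqrt_eq_rpow, mul_assoc, ← Real.rpow_add ht0]
        rw [show -(1/2 - ε) + 1/2 = ε by ring]; exact h2
      have hds : Tendsto (fun t : ℝ => (√t * z - M t) / √t) atTop (𝓝 z) := by
        have := hMs.const_sub z
        rw [sub_zero] at this
        refine this.congr' ?_
        filter_upwards [eventually_gt_atTop 0] with t ht
        have := Real.sqrt_pos.2 ht
        field_simp
      have hgl := gk_lim hx hz0 hds (by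
        filter_upwards [hevt, hM0] with t ht h1
        have : 0 < √t * z := by positivity
        linarith)
      have hgg : Tendsto (fun t : ℝ => g (√t * z) / (√t * z) ^ ν) atTop (𝓝 A) := hg.comp hsq
      have hprod := ((hds.mul (hgl.const_sub 1)).mul hgg).mul_const (z ^ ν)
      have e : z * (1 - Real.exp (-(1/4) * z^2)) * A * z ^ ν = A * (z ^ (ν+1) * (1 - Real.exp (-(1/4) * z^2))) := by
        rw [Real.rpow_add hz0, Real.rpow_one]; ring
      rw [e] at hprod
      refine hprod.congr' ?_
      have hind : ∀ᶠ t : ℝ in atTop, t ^ (2*ε) < √t * z := by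
        have hl : Tendsto (fun t : ℝ => t ^ (-(1/2 - 2*ε))) atTop (𝓝 0) := tendsto_rpow_neg_atTop (by linarith)
        filter_upwards [hl.eventually (gt_mem_nhds hz0), eventually_gt_atTop 0] with t h1 ht
        have : t ^ (2*ε) = √t * t ^ (-(1/2 - 2*ε)) := by
          rw [Real.sqrt_eq_rpow, ← Real.rpow_add ht]; congr 1; ring
        rw [this]
        have := Real.sqrt_pos.2 ht
        gcongr
      filter_upwards [hind, eventually_gt_atTop 0] with t h1 ht
      simp only [hF]
      rw [indicator_of_mem (show √t * z ∈ Ioi (t ^ (2*ε)) from h1)]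
      simp only [hH]
      rw [hpow t z ht hz0]
      have h3 : 0 < z ^ ν := by positivity
      have h4 : 0 < t ^ (ν/2) := by positivity
      have h5 : t ^ (-(1 + ν/2)) = 1 / (√t * √t * t ^ (ν/2)) := by
        rw [Real.rpow_neg ht.le, Real.rpow_add ht, Real.rpow_one, Real.mul_self_sqrt ht.le, one_div]
      rw [h5]
      have h6 := Real.sqrt_pos.2 ht
      exact I1_alg _ _ _ h6.ne' h4.ne' h3.ne'
  rw [integral_const_mul] at hlarge
  have := hsmall.add hlarge
  rw [zero_add] at this
  refine this.congr' ?_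
  filter_upwards [hI, hevt] with t hIt ht
  have ht0 : 0 < t := by linarith
  have hs0 := Real.sqrt_pos.2 ht0
  have h1 : ∫ z in Ioi (0:ℝ), F t z = t ^ (-(1 + ν/2)) * ∫ y in Ioi (t ^ (2*ε)), H t y := by
    simp only [hF]
    rw [integral_const_mul, integral_const_mul, integral_comp_mul_left_Ioi _ _ hs0, mul_zero, smul_eq_mul,
      setIntegral_indicator measurableSet_Ioi, Ioi_inter_Ioi, max_eq_right (by positivity)]
    field_simp
  rw [h1, ← mul_add, ← setIntegral_union (Ioc_disjoint_Ioi le_rfl) measurableSet_Ioi, Ioc_union_Ioi_eq_Ioi (by positivity)]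
  · exact hIt.mono_set Ioc_subset_Ioi_self
  · exact hIt.mono_set (Ioi_subset_Ioi (by positivity))

end PartQ

open MeasureTheory ProbabilityTheory Filter Real Set Asymptotics
open scoped NNReal ENNReal Topology
set_option linter.all false
set_option linter.deprecated false

section PartR

variable {M : ℝ → ℝ} {w : ℝ → ℝ → ℝ≥0∞} {J : Measure ℝ} {θ C T ε K : ℝ} {j : ℝ → ℝ}

lemma rpow_littleO {q p : ℝ} (hqp : q < p) : (fun t : ℝ => t ^ q) =o[atTop] fun t : ℝ => t ^ p := by
  rw [isLittleO_iff_tendsto']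
  · have h2 : Tendsto (fun t : ℝ => t ^ (-(p - q))) atTop (𝓝 0) := tendsto_rpow_neg_atTop (by linarith)
    refine h2.congr' ?_
    filter_upwards [eventually_gt_atTop 0] with t ht
    rw [← Real.rpow_sub ht]; congr 1; ring
  · filter_upwards [eventually_gt_atTop 0] with t ht h0
    exact absurd h0 (Real.rpow_pos_of_pos ht p).ne'

lemma littleO_of_bd {f : ℝ → ℝ} {D q p T : ℝ} (hqp : q < p) (h : ∀ t, T < t → |f t| ≤ D * t ^ q) :
    f =o[atTop] fun t : ℝ => t ^ p := by
  have h1 : f =O[atTop] fun t : ℝ => t ^ q := by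
    refine IsBigO.of_bound D ?_
    filter_upwards [eventually_gt_atTop T, eventually_gt_atTop 0] with t ht ht0
    rw [Real.norm_eq_abs, Real.norm_eq_abs, abs_of_pos (Real.rpow_pos_of_pos ht0 q)]
    exact h t ht
  exact h1.trans_isLittleO (rpow_littleO hqp)

lemma littleO_of_lim {f : ℝ → ℝ} {b p : ℝ} (h : Tendsto (fun t : ℝ => t ^ (-p) * f t) atTop (𝓝 b)) :
    (fun t => f t - b * t ^ p) =o[atTop] fun t : ℝ => t ^ p := by
  rw [isLittleO_iff_tendsto']
  · have h2 := h.sub_const b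
    rw [sub_self] at h2
    refine h2.congr' ?_
    filter_upwards [eventually_gt_atTop 0] with t ht
    have := Real.rpow_pos_of_pos ht p
    rw [Real.rpow_neg ht.le]
    field_simp
  · filter_upwards [eventually_gt_atTop 0] with t ht h0
    exact absurd h0 (Real.rpow_pos_of_pos ht p).ne'

lemma SD.result (h : SD M w J θ C T ε j K)
    (hmom : Integrable (fun y => (1+|y|)^(1+2*(θ+2*ε))) (mu0 w)) {p b' x : ℝ} (hp : -1/2-θ < p) (hx : 0 < x)
    (hI1 : Tendsto (fun t : ℝ => t ^ (-p) * I1p M w x t) atTop (𝓝 b')) :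
    (fun t => Wn M w x t - (cc M w J - 3 * √π * cc M w J * t ^ (-1/2:ℝ) - b' * t ^ p)) =o[atTop] fun t : ℝ => t ^ p := by
  have hT := h.mh.T1
  obtain ⟨C1, hC1, hj⟩ := h.stepD hmom
  obtain ⟨D3, hD3, h3⟩ := h.I3_asym hC1 hj
  obtain ⟨D2, hD2, h2⟩ := h.I2p_asym hC1 hj
  obtain ⟨De, hDe, he⟩ := h.I2e_bound x
  obtain ⟨D1, hD1, h1⟩ := h.I1p_bound hmom x
  have o1 := littleO_of_lim hI1
  have o3 := littleO_of_bd (T := T) hp (fun t ht => h3 t ht.le)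
  have o2 := littleO_of_bd (T := 2*T) hp (fun t ht => h2 t ht.le)
  have oe := littleO_of_bd (T := 2*T) (f := fun t => I2e M J T x t) hp (fun t ht => he t x ht.le hx le_rfl)
  have oE := littleO_of_bd (T := T) (f := fun t => E2 M j T x t) hp (fun t ht => (h.E2_bound ht hx le_rfl).2)
  have := (((o1.neg_left.sub o3).sub oe).sub o2).add oE
  refine this.congr' ?_ EventuallyEq.rfl
  filter_upwards [eventually_gt_atTop T] with t ht
  rw [h.decomp ht hx (h1 t x ht.le hx le_rfl).1]
  have hpi : π = √π * √π := (Real.mul_self_sqrt Real.pi_pos.le).symm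
  have hs : 0 < √π := Real.sqrt_pos.2 Real.pi_pos
  have e : 6 * π * (cc M w J / (2 * √π)) = 3 * √π * cc M w J := by
    rw [div_eq_mul_inv]
    nth_rw 1 [hpi]
    field_simp; ring
  linear_combination (t ^ (-1/2:ℝ)) * e

lemma c_pos {M w J} {p b' x : ℝ} (hp : p < 0) (hb : 0 < b') (hx : 0 < x)
    (h : (fun t => Wn M w x t - (cc M w J - 3 * √π * cc M w J * t ^ (-1/2:ℝ) - b' * t ^ p)) =o[atTop] fun t : ℝ => t ^ p) :
    0 < cc M w J := by
  by_contra hc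
  push Not at hc
  have h1 := h.bound (half_pos hb)
  have h2 : Tendsto (fun t : ℝ => t ^ (-(1/2:ℝ))) atTop (𝓝 0) := tendsto_rpow_neg_atTop (by norm_num)
  have h3 := h2.const_mul (3 * √π)
  rw [mul_zero] at h3
  obtain ⟨t, h4, h5, ht⟩ := (h1.and ((h3.eventually (gt_mem_nhds one_pos)).and (eventually_gt_atTop 0))).exists
  have tp := Real.rpow_pos_of_pos ht p
  rw [Real.norm_eq_abs, Real.norm_eq_abs, abs_of_pos tp] at h4
  have h6 := (abs_le.1 h4).2
  have h7 := Wn_nonneg (M := M) (w := w) ht.le hx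
  rw [show -(1/2:ℝ) = -1/2 by norm_num] at h5
  have h8 : cc M w J * (1 - 3 * √π * t ^ (-1/2:ℝ)) ≤ 0 := mul_nonpos_of_nonpos_of_nonneg hc (by linarith)
  nlinarith

lemma mu0_integrable {g f : ℝ → ℝ} (hgm : Measurable g) (hg0 : ∀ y, 0 ≤ g y)
    (hw : ∀ y, w y 0 = (Ioi (0:ℝ)).indicator (fun y => ENNReal.ofReal (g y)) y) :
    (Integrable f (mu0 w) ↔ IntegrableOn (fun y => f y * g y) (Ioi 0)) ∧
      ∫ y, f y ∂mu0 w = ∫ y in Ioi 0, f y * g y := by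
  have e : (fun y => w y 0) = (Ioi (0:ℝ)).indicator (fun y => ENNReal.ofReal (g y)) := funext hw
  unfold mu0
  rw [e, withDensity_indicator measurableSet_Ioi]
  have hm : Measurable fun y => ENNReal.ofReal (g y) := by fun_prop
  have hlt : ∀ᵐ y ∂(volume.restrict (Ioi (0:ℝ))), ENNReal.ofReal (g y) < ∞ := Filter.Eventually.of_forall fun y => ENNReal.ofReal_lt_top
  constructor
  · rw [integrable_withDensity_iff hm hlt]
    simp only [ENNReal.toReal_ofReal (hg0 _)]
    rfl
  · rw [integral_withDensity_eq_integral_toReal_smul hm hlt]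
    simp only [ENNReal.toReal_ofReal (hg0 _), smul_eq_mul, mul_comm]

end PartR

open MeasureTheory ProbabilityTheory Filter Real Set Asymptotics
open scoped NNReal ENNReal Topology
set_option linter.all false
set_option linter.deprecated false

section PartS

lemma g_asym {h₀ : ℝ → ℝ} {A ν : ℝ} (hA : 0 < A)
    (h₀asym : Tendsto (fun x => h₀ x / (A * x ^ ν * Real.exp (-x))) atTop (nhds 1)) :
    Tendsto (fun y => (Real.exp y * h₀ y) / y ^ ν) atTop (𝓝 A) := by
  have h := h₀asym.const_mul A
  rw [mul_one] at h
  refine h.congr' ?_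
  filter_upwards [eventually_gt_atTop 0] with y hy
  have := Real.rpow_pos_of_pos hy ν
  rw [Real.exp_neg]
  have := Real.exp_pos y
  field_simp

lemma g_moment {h₀ : ℝ → ℝ} {A ν C κ : ℝ} (hA : 0 < A) (h₀meas : Measurable h₀) (hC : ∀ x, |h₀ x| ≤ C)
    (h₀nn : ∀ x, 0 ≤ h₀ x) (hg : Tendsto (fun y => (Real.exp y * h₀ y) / y ^ ν) atTop (𝓝 A))
    (hκ : 0 ≤ κ) (hκν : κ + ν < -1) :
    IntegrableOn (fun y => (1 + |y|) ^ κ * (Real.exp y * h₀ y)) (Ioi 0) := by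
  obtain ⟨Y0, hY0⟩ : ∃ Y0 : ℝ, ∀ y ≥ Y0, (Real.exp y * h₀ y) / y ^ ν ≤ 2 * A := by
    have := hg.eventually (eventually_le_nhds (show A < 2 * A by linarith))
    exact eventually_atTop.1 this
  set Y := max Y0 1 with hY
  have hY1 : 1 ≤ Y := le_max_right _ _
  rw [← Ioc_union_Ioi_eq_Ioi (zero_le_one.trans hY1)]
  apply IntegrableOn.union
  · have h3 : IntegrableOn (fun z : ℝ => (1 + Y) ^ κ * (Real.exp Y * C)) (Ioc 0 Y) :=
      integrableOn_const (by simp)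
    refine Integrable.mono' h3 (Measurable.aestronglyMeasurable (by fun_prop)) ?_
    rw [ae_restrict_iff' measurableSet_Ioc]
    refine Filter.Eventually.of_forall fun z hz => ?_
    have hz0 := hz.1
    have hz1 := hz.2
    have hn := h₀nn z
    have hb := (le_abs_self _).trans (hC z)
    have hC0 : 0 ≤ C := hn.trans hb
    rw [Real.norm_eq_abs, abs_of_nonneg (by positivity), abs_of_pos hz0]
    gcongr
  · have h3 : IntegrableOn (fun z : ℝ => 2 ^ κ * (2 * A) * z ^ (κ + ν)) (Ioi Y) :=
      (integrableOn_Ioi_rpow_of_lt hκν (by linarith)).const_mul _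
    refine Integrable.mono' h3 (Measurable.aestronglyMeasurable (by fun_prop)) ?_
    rw [ae_restrict_iff' measurableSet_Ioi]
    refine Filter.Eventually.of_forall fun z hz => ?_
    have hz1 : Y < z := hz
    have hz0 : 0 < z := by linarith
    have hn := h₀nn z
    rw [Real.norm_eq_abs, abs_of_nonneg (by positivity), abs_of_pos hz0]
    have hb := hY0 z ((le_max_left _ _).trans hz1.le)
    rw [div_le_iff₀ (by positivity)] at hb
    calc _ ≤ (2 * z) ^ κ * (2 * A * z ^ ν) := by gcongr; linarith
      _ = _ := by rw [Real.mul_rpow (by norm_num) hz0.le, Real.rpow_add hz0]; ring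

lemma g_fin {g : ℝ → ℝ} (hg0 : ∀ y, 0 ≤ g y) (hgi : IntegrableOn g (Ioi 0)) :
    ∫⁻ y in Ioi (0:ℝ), ENNReal.ofReal (g y) ≠ ∞ := by
  have h := hgi.hasFiniteIntegral
  rw [hasFiniteIntegral_iff_ofReal (Filter.Eventually.of_forall hg0)] at h
  exact h.ne

/-- The main analytic output: the asymptotic expansion of the normalised solution. -/
theorem expansion {Ω : Type*} [MeasurableSpace Ω] (P : Measure Ω) [IsProbabilityMeasure P]
    (B : ℝ → Ω → ℝ) (hB : IsBrownianMotion P B)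
    (ν A : ℝ) (hν₁ : -4 < ν) (hν₂ : ν ≤ -3) (hA : 0 < A)
    (h₀ : ℝ → ℝ) (h₀meas : Measurable h₀) (h₀bdd : ∃ C, ∀ x, |h₀ x| ≤ C)
    (h₀nn : ∀ x, 0 ≤ h₀ x)
    (h₀asym : Tendsto (fun x => h₀ x / (A * x ^ ν * Real.exp (-x))) atTop (nhds 1))
    (a η : ℝ) (hη : 0 < η) (hην : -(3 + ν) / 2 < η)
    (m r : ℝ → ℝ) (hmC2 : ContDiff ℝ 2 m)
    (hm_eq : ∀ t, m t = 2 * t - (3/2) * Real.log (t + 1) + a + r t)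
    (hr0 : r 0 = -a) (hrlim : Tendsto r atTop (nhds 0))
    (hr'' : (fun t => deriv (deriv r) t) =O[atTop] fun t => t ^ (-2 - η)) :
    ∃ (w : ℝ → ℝ → ℝ≥0∞) (c : ℝ), 0 < c ∧
      (∀ x t : ℝ, 0 ≤ t → fkppSol P B h₀ m (m t + x) t = Real.exp (-(x + (m t - 2 * t))) *
        (w ((m t - 2 * t) + x) t).toReal) ∧
      (∀ t : ℝ, 0 ≤ t → w ((m t - 2 * t) + 0) t = 0) ∧
      ∀ x > 0, (fun t => Wn (fun t => m t - 2 * t) w x t - (c - 3 * √π * c * t ^ (-1/2:ℝ) -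
        -(A * (2 ^ (ν+1) * Real.Gamma (ν/2+1))) * t ^ (1 + ν/2))) =o[atTop] fun t : ℝ => t ^ (1 + ν/2) := by
  obtain ⟨C, hC⟩ := h₀bdd
  have hm0 : m 0 = 0 := by rw [hm_eq 0, hr0]; simp
  have hmc : Continuous m := hmC2.continuous
  obtain ⟨θ, hθl, hθu⟩ := exists_between (show max 0 (-(3+ν)/2) < min η (1/2) from
    max_lt (lt_min hη (by norm_num)) (lt_min hην (by linarith)))
  have hθ0 : 0 < θ := (le_max_left _ _).trans_lt hθl
  have hθν : -(3+ν)/2 < θ := (le_max_right _ _).trans_lt hθl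
  have hθη : θ < η := hθu.trans_le (min_le_left _ _)
  have hθ1 : θ < 1/2 := hθu.trans_le (min_le_right _ _)
  obtain ⟨C', T, hMH⟩ := MH_of hη hθ0 hθη.le hθ1 hmC2 hm_eq hr0 hrlim hr''
  set ε := (1/2 - θ)/16 with hε
  have hε0 : 0 < ε := by rw [hε]; linarith
  have hεθ : θ + 16 * ε ≤ 1/2 := by rw [hε]; linarith
  have hεθ' : 16 * ε = 1/2 - θ := by rw [hε]; ring
  set g : ℝ → ℝ := fun y => Real.exp y * h₀ y with hg
  have hgm : Measurable g := by rw [hg]; fun_prop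
  have hg0 : ∀ y, 0 ≤ g y := fun y => mul_nonneg (Real.exp_pos y).le (h₀nn y)
  have hga := g_asym hA h₀asym
  have hmomg : ∀ κ : ℝ, 0 ≤ κ → κ + ν < -1 → IntegrableOn (fun y => (1 + |y|) ^ κ * g y) (Ioi 0) :=
    fun κ h1 h2 => g_moment hA h₀meas hC h₀nn hga h1 h2
  have hgi : IntegrableOn g (Ioi 0) := by
    have := hmomg 0 le_rfl (by linarith)
    simpa using this
  set f0 : ℝ → ℝ≥0∞ := fun y => ENNReal.ofReal (h₀ y) with hf0
  have hf0m : Measurable f0 := by rw [hf0]; fun_prop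
  have hf0C : ∀ x, f0 x ≤ (Real.toNNReal C : ℝ≥0) := fun x =>
    ENNReal.ofReal_le_ofReal ((le_abs_self _).trans (hC x))
  have hf0i : ∫⁻ x in Ioi (m 0), f0 x ≠ ∞ := by
    rw [hm0]
    refine ((setLIntegral_mono' measurableSet_Ioi fun y hy => ?_).trans_lt (g_fin hg0 hgi).lt_top).ne
    apply ENNReal.ofReal_le_ofReal
    have h1 : 1 ≤ Real.exp y := Real.one_le_exp (le_of_lt hy)
    have h2 := h₀nn y
    show h₀ y ≤ Real.exp y * h₀ y
    nlinarith
  obtain ⟨hKD, hH0⟩ := Hf_KD hB hmc hf0m hf0C hf0i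
  set H := Hf P B m f0 with hH
  have hH0' : ∀ x, ENNReal.ofReal (Real.exp x) * H x 0 = (Ioi (0:ℝ)).indicator (fun y => ENNReal.ofReal (g y)) x := by
    intro x
    rw [hH0 x, hm0]
    by_cases hx : x ∈ Ioi (0:ℝ)
    · rw [indicator_of_mem hx, indicator_of_mem hx, hf0, hg]
      simp only
      rw [ENNReal.ofReal_mul (Real.exp_pos x).le]
    · rw [indicator_of_notMem hx, indicator_of_notMem hx, mul_zero]
  have hinteg : ∫⁻ x, ENNReal.ofReal (Real.exp x) * H x 0 ≠ ∞ := by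
    rw [lintegral_congr hH0', lintegral_indicator measurableSet_Ioi]
    exact g_fin hg0 hgi
  obtain ⟨J, hAD⟩ := AD_of_KD hKD hmc hinteg
  set w : ℝ → ℝ → ℝ≥0∞ := fun X t => ENNReal.ofReal (Real.exp (X + t)) * H (X + 2 * t) t with hw
  set M : ℝ → ℝ := fun t => m t - 2 * t with hM
  have hw0 : ∀ y, w y 0 = (Ioi (0:ℝ)).indicator (fun y => ENNReal.ofReal (g y)) y := by
    intro y; rw [← hH0' y]; simp [hw]
  have hmu := fun f : ℝ → ℝ => mu0_integrable (w := w) (f := f) hgm hg0 hw0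
  have hmom : Integrable (fun y => (1+|y|)^(1+2*(θ+2*ε))) (mu0 w) :=
    (hmu _).1.2 (hmomg _ (by positivity) (by linarith))
  have hy : Integrable (fun y => y) (mu0 w) := by
    refine (hmu _).1.2 (Integrable.mono' (hmomg 1 zero_le_one (by linarith)) (Measurable.aestronglyMeasurable (by fun_prop)) ?_)
    refine Filter.Eventually.of_forall fun y => ?_
    have := hg0 y
    rw [Real.rpow_one, norm_mul, Real.norm_eq_abs, Real.norm_eq_abs, abs_of_nonneg this]
    gcongr; linarith
  obtain ⟨j, K, hSD⟩ := SD_exists hAD hMH hy hε0 hεθ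
  have hres : ∀ x > 0, (fun t => Wn M w x t - (cc M w J - 3 * √π * cc M w J * t ^ (-1/2:ℝ) -
        -(A * (2 ^ (ν+1) * Real.Gamma (ν/2+1))) * t ^ (1 + ν/2))) =o[atTop] fun t : ℝ => t ^ (1 + ν/2) := by
    intro x hx
    refine hSD.result hmom (by linarith) hx ?_
    obtain ⟨D, hD, hI⟩ := hSD.I1p_bound hmom x
    have hlim := I1_asym (M := M) (g := g) (K := K) (ε := ε) (ν := ν) (A := A) (x := x) hSD.K1 hε0 hν₁ hν₂ hA (by linarith) hx
      (by filter_upwards [eventually_ge_atTop T] with t ht using hMH.neg t ht)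
      (by filter_upwards [eventually_ge_atTop T] with t ht using hSD.negM t ht)
      hgm hg0 hgi hga
      (by filter_upwards [eventually_ge_atTop T] with t ht using (hmu _).1.1 (hI t x ht hx le_rfl).1)
    rw [gamma_int hν₁ hν₂, mul_neg] at hlim
    refine hlim.congr fun t => ?_
    unfold I1p
    rw [(hmu _).2]
  refine ⟨w, cc M w J, ?_, ?_, ?_, hres⟩
  · refine c_pos (p := 1 + ν/2) (x := 1) (by linarith) ?_ one_pos (hres 1 one_pos)
    have h1 := gamma_neg hν₁ hν₂
    have h2 : (0:ℝ) < 2 ^ (ν+1) := by positivity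
    have : A * (2 ^ (ν+1) * Real.Gamma (ν/2+1)) < 0 := mul_neg_of_pos_of_neg hA (mul_neg_of_pos_of_neg h2 h1)
    linarith
  · intro x t ht
    rw [fkpp_link hB hmc h₀meas h₀nn _ ht]
    simp only [hw]
    rw [ENNReal.toReal_mul, ENNReal.toReal_ofReal (Real.exp_pos _).le, ← mul_assoc, ← Real.exp_add,
      show m t - 2 * t + x + 2 * t = m t + x by ring]
    congr 2; ring
  · intro t ht
    exact hAD.zero t ht _ (le_of_eq (add_zero _))

end PartS

open MeasureTheory ProbabilityTheory Filter Real Set Asymptotics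
open scoped NNReal ENNReal Topology
set_option linter.all false
set_option linter.deprecated false

section PartT

lemma exp_littleO {u k : ℝ → ℝ} (hu : Tendsto u atTop (𝓝 0)) :
    (fun t => Real.exp (u t) - 1) =o[atTop] k ↔ u =o[atTop] k := by
  have hs : ∀ᶠ t in atTop, |u t| < 1/2 := by
    have := hu.abs
    rw [abs_zero] at this
    exact this.eventually (gt_mem_nhds (by norm_num))
  constructor
  · intro h
    refine IsBigO.trans_isLittleO ?_ h
    refine IsBigO.of_bound 2 ?_
    filter_upwards [hs] with t ht
    have h1 := Real.abs_exp_sub_one_sub_id_le (x := u t) (by linarith)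
    rw [Real.norm_eq_abs, Real.norm_eq_abs]
    have h2 := abs_sub_abs_le_abs_sub (u t) (u t - (Real.exp (u t) - 1))
    rw [show u t - (u t - (Real.exp (u t) - 1)) = Real.exp (u t) - 1 by ring] at h2
    rw [abs_sub_comm (u t)] at h2
    have h3 : (u t)^2 ≤ |u t| * (1/2) := by
      rw [← sq_abs]; nlinarith [abs_nonneg (u t)]
    linarith
  · intro h
    refine IsBigO.trans_isLittleO ?_ h
    refine IsBigO.of_bound 2 ?_
    filter_upwards [hs] with t ht
    have h1 := Real.abs_exp_sub_one_sub_id_le (x := u t) (by linarith)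
    rw [Real.norm_eq_abs, Real.norm_eq_abs]
    have h2 := abs_add_le (Real.exp (u t) - 1 - u t) (u t)
    rw [sub_add_cancel] at h2
    have h3 : (u t)^2 ≤ |u t| * (1/2) := by
      rw [← sq_abs]; nlinarith [abs_nonneg (u t)]
    linarith [abs_nonneg (u t)]

lemma log_quad {v : ℝ} (hv : |v| ≤ 1/2) : |Real.log (1 + v) - v| ≤ 2 * v^2 := by
  obtain ⟨h1, h2⟩ := abs_le.1 hv
  have h3 : 0 < 1 + v := by linarith
  have h4 := Real.log_le_sub_one_of_pos h3
  have h5 := Real.one_sub_inv_le_log_of_pos h3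
  have h6 : 1 - (1+v)⁻¹ = v - v^2 / (1+v) := by field_simp; ring
  have h7 : v^2 / (1+v) ≤ 2 * v^2 := by
    rw [div_le_iff₀ h3]; nlinarith [sq_nonneg v]
  rw [abs_le]
  constructor <;> nlinarith [sq_nonneg v]

lemma final_equiv {r V : ℝ → ℝ} {α b p : ℝ} (hα : 0 < α) (hp1 : -1 < p) (hp2 : p ≤ -1/2)
    (hr : Tendsto r atTop (𝓝 0))
    (hV : (fun t => V t - (α - 3 * √π * α * t ^ (-1/2:ℝ) - b * t ^ p)) =o[atTop] fun t : ℝ => t ^ p) :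
    Tendsto (fun t => Real.exp (-r t) * V t) atTop (𝓝 α) ∧
    ((fun t => r t + 3 * √π / √t + (b / α) * t ^ p) =o[atTop] (fun t : ℝ => t ^ p) ↔
      (fun t => Real.exp (-r t) * V t - α) =o[atTop] fun t : ℝ => t ^ p) := by
  set v : ℝ → ℝ := fun t => V t / α - 1 with hv
  have hpO : (fun t : ℝ => t ^ p) =O[atTop] fun t : ℝ => t ^ (-1/2:ℝ) := by
    rcases hp2.eq_or_lt with h | h
    · rw [h]
    · exact (rpow_littleO h).isBigO
  have hv1 : (fun t => v t + 3 * √π * t ^ (-1/2:ℝ) + (b/α) * t ^ p) =o[atTop] fun t : ℝ => t ^ p := by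
    refine (hV.const_mul_left (1/α)).congr_left fun t => ?_
    simp only [hv]; field_simp; ring
  have hvO : v =O[atTop] fun t : ℝ => t ^ (-1/2:ℝ) := by
    have h1 := (hv1.isBigO.trans hpO).sub (((isBigO_refl (fun t : ℝ => t ^ (-1/2:ℝ)) atTop).const_mul_left (3 * √π)).add
      (hpO.const_mul_left (b/α)))
    refine h1.congr_left fun t => ?_
    ring
  have h0 : Tendsto (fun t : ℝ => t ^ (-1/2:ℝ)) atTop (𝓝 0) := by
    have := tendsto_rpow_neg_atTop (show (0:ℝ) < 1/2 by norm_num)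
    rwa [show -(1/2:ℝ) = -1/2 by norm_num] at this
  have hv0 : Tendsto v atTop (𝓝 0) := hvO.trans_tendsto h0
  have hvs : ∀ᶠ t in atTop, |v t| ≤ 1/2 := by
    have := hv0.abs
    rw [abs_zero] at this
    exact this.eventually (eventually_le_nhds (by norm_num))
  set q : ℝ → ℝ := fun t => Real.log (1 + v t) with hq
  have hqv : (fun t => q t - v t) =o[atTop] fun t : ℝ => t ^ p := by
    have h1 : (fun t => q t - v t) =O[atTop] fun t => v t * v t := by
      refine IsBigO.of_bound 2 ?_
      filter_upwards [hvs] with t ht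
      have := log_quad ht
      rw [Real.norm_eq_abs, Real.norm_eq_abs, abs_of_nonneg (mul_self_nonneg (v t))]
      simp only [hq]; linarith [sq (v t)]
    have h2 := h1.trans (hvO.mul hvO)
    refine h2.trans_isLittleO ?_
    refine (rpow_littleO hp1).congr' ?_ EventuallyEq.rfl
    filter_upwards [eventually_gt_atTop 0] with t ht
    rw [← Real.rpow_add ht]; norm_num
  have hq1 : (fun t => q t + 3 * √π * t ^ (-1/2:ℝ) + (b/α) * t ^ p) =o[atTop] fun t : ℝ => t ^ p := by
    refine (hqv.add hv1).congr_left fun t => ?_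
    ring
  have hq0 : Tendsto q atTop (𝓝 0) := by
    have := (Real.continuousAt_log (x := 1) one_ne_zero).tendsto
    rw [Real.log_one] at this
    refine this.comp ?_
    simpa using hv0.const_add 1
  have hqr : Tendsto (fun t => q t - r t) atTop (𝓝 0) := by simpa using hq0.sub hr
  have heq : ∀ᶠ t in atTop, Real.exp (-r t) * V t = α * Real.exp (q t - r t) := by
    filter_upwards [hvs] with t ht
    have h1 := (abs_le.1 ht).1
    rw [sub_eq_add_neg, Real.exp_add]
    simp only [hq]
    rw [Real.exp_log (by linarith)]
    simp only [hv]; field_simp; ring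
  constructor
  · have h1 := ((Real.continuous_exp.tendsto 0).comp hqr).const_mul α
    rw [Real.exp_zero, mul_one] at h1
    refine h1.congr' ?_
    filter_upwards [heq] with t ht using ht.symm
  · have e1 : (fun t => Real.exp (-r t) * V t - α) =ᶠ[atTop] fun t => α * (Real.exp (q t - r t) - 1) := by
      filter_upwards [heq] with t ht
      rw [ht]; ring
    rw [isLittleO_congr e1 EventuallyEq.rfl, isLittleO_const_mul_left_iff hα.ne', exp_littleO hqr]
    have hst : ∀ᶠ t : ℝ in atTop, 3 * √π / √t = 3 * √π * t ^ (-1/2:ℝ) := by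
      filter_upwards [eventually_gt_atTop 0] with t ht
      rw [show (-1/2:ℝ) = -(1/2) by norm_num, Real.rpow_neg ht.le, ← Real.sqrt_eq_rpow, div_eq_mul_inv]
    constructor
    · intro h
      refine (hq1.sub h).congr' ?_ EventuallyEq.rfl
      filter_upwards [hst] with t ht
      rw [ht]; ring
    · intro h
      refine (hq1.sub h).congr' ?_ EventuallyEq.rfl
      filter_upwards [hst] with t ht
      rw [ht]; ring

lemma factor_bd {t : ℝ} (ht : 1 ≤ t) : |((t + 1)/t) ^ (3/2:ℝ) - 1| ≤ 3 * t ^ (-1:ℝ) := by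
  have ht0 : 0 < t := by linarith
  have h1 : 1 ≤ (t+1)/t := by rw [le_div_iff₀ ht0]; linarith
  have h2 : 1 ≤ ((t+1)/t) ^ (3/2:ℝ) := Real.one_le_rpow h1 (by norm_num)
  have h3 : ((t+1)/t) ^ (3/2:ℝ) ≤ ((t+1)/t) ^ (2:ℝ) := Real.rpow_le_rpow_of_exponent_le h1 (by norm_num)
  rw [abs_of_nonneg (by linarith), Real.rpow_neg_one]
  have h4 : ((t+1)/t) ^ (2:ℝ) = 1 + 2 * t⁻¹ + t⁻¹ * t⁻¹ := by
    rw [Real.rpow_two]; field_simp; ring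
  have h5 : t⁻¹ ≤ 1 := inv_le_one_of_one_le₀ ht
  have h6 : 0 < t⁻¹ := by positivity
  nlinarith

lemma V_exp {W : ℝ → ℝ} {c b' p κ : ℝ} (hp1 : -1 < p) (hp2 : p ≤ -1/2)
    (hW : (fun t => W t - (c - 3 * √π * c * t ^ (-1/2:ℝ) - b' * t ^ p)) =o[atTop] fun t : ℝ => t ^ p) :
    (fun t => ((t + 1)/t) ^ (3/2:ℝ) * κ * W t - (κ * c - 3 * √π * (κ * c) * t ^ (-1/2:ℝ) - (κ * b') * t ^ p)) =o[atTop]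
      fun t : ℝ => t ^ p := by
  have h0 : Tendsto (fun t : ℝ => t ^ (-1/2:ℝ)) atTop (𝓝 0) := by
    have := tendsto_rpow_neg_atTop (show (0:ℝ) < 1/2 by norm_num)
    rwa [show -(1/2:ℝ) = -1/2 by norm_num] at this
  have hp0 : Tendsto (fun t : ℝ => t ^ p) atTop (𝓝 0) := by
    have := tendsto_rpow_neg_atTop (show (0:ℝ) < -p by linarith)
    rwa [neg_neg] at this
  have h1 := hW.isBigO.trans_tendsto hp0
  have h2 := h1.add ((tendsto_const_nhds (x := c)).sub (h0.const_mul (3 * √π * c)) |>.sub (hp0.const_mul b'))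
  have h3 : Tendsto W atTop (𝓝 (0 + (c - 3 * √π * c * 0 - b' * 0))) := h2.congr fun t => by ring
  have hWO : W =O[atTop] fun _ => (1:ℝ) := h3.isBigO_one ℝ
  have hF : (fun t : ℝ => ((t + 1)/t) ^ (3/2:ℝ) - 1) =O[atTop] fun t : ℝ => t ^ (-1:ℝ) := by
    refine IsBigO.of_bound 3 ?_
    filter_upwards [eventually_ge_atTop 1] with t ht
    have := Real.rpow_pos_of_pos (show 0 < t by linarith) (-1)
    rw [Real.norm_eq_abs, Real.norm_eq_abs, abs_of_pos this]
    exact factor_bd ht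
  have h4 := hF.mul hWO
  simp only [mul_one] at h4
  have h5 := (h4.trans_isLittleO (rpow_littleO hp1)).const_mul_left κ
  refine (h5.add (hW.const_mul_left κ)).congr_left fun t => ?_
  ring

end PartT

theorem stmt9 {Ω : Type*} [MeasurableSpace Ω] (P : Measure Ω) [IsProbabilityMeasure P]
    (B : ℝ → Ω → ℝ) (hB : IsBrownianMotion P B)
    (ν A : ℝ) (hν₁ : -4 < ν) (hν₂ : ν ≤ -3) (hA : 0 < A)
    (h₀ : ℝ → ℝ) (h₀meas : Measurable h₀) (h₀bdd : ∃ C, ∀ x, |h₀ x| ≤ C)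
    (h₀nn : ∀ x, 0 ≤ h₀ x) (h₀ne : ¬ (h₀ =ᵐ[volume] 0))
    (h₀asym : Tendsto (fun x => h₀ x / (A * x ^ ν * Real.exp (-x))) atTop (nhds 1))
    (a η : ℝ) (hη : 0 < η) (hην : -(3 + ν) / 2 < η)
    (m r : ℝ → ℝ) (hmC2 : ContDiff ℝ 2 m)
    (hm_eq : ∀ t, m t = 2 * t - (3/2) * Real.log (t + 1) + a + r t)
    (hr0 : r 0 = -a) (hrlim : Tendsto r atTop (nhds 0))
    (hr'' : (fun t => deriv (deriv r) t) =O[atTop] fun t => t ^ (-2 - η))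
    (b : ℝ)
    (hb_def : b = -(A * Real.exp (-a) / (2 * Real.sqrt π)) * 2 ^ (ν + 1) *
      Real.Gamma (ν/2 + 1)) :
    0 < b ∧
    ∃ α > 0,
      (∀ x ≥ 0, Tendsto (fun t => fkppSol P B h₀ m (m t + x) t) atTop
        (nhds (α * (x * Real.exp (-x))))) ∧
      ∀ x > 0,
        ((fun t => r t + 3 * Real.sqrt π / Real.sqrt t + (b / α) * t ^ (1 + ν/2))
            =o[atTop] (fun t : ℝ => t ^ (1 + ν/2)) ↔
          (fun t => fkppSol P B h₀ m (m t + x) t - α * (x * Real.exp (-x))) =o[atTop]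
            fun t : ℝ => t ^ (1 + ν/2)) := by
  obtain ⟨w, c, hc, hlink, hzero, hexp⟩ := expansion P B hB ν A hν₁ hν₂ hA h₀ h₀meas h₀bdd h₀nn h₀asym a η hη hην m r hmC2
    hm_eq hr0 hrlim hr''
  have hsp : 0 < √π := Real.sqrt_pos.2 Real.pi_pos
  set κ := Real.exp (-a) / (2 * √π) with hκ
  have hκ0 : 0 < κ := by positivity
  have hb : b = κ * -(A * (2 ^ (ν+1) * Real.Gamma (ν/2+1))) := by rw [hb_def, hκ]; ring
  have hb0 : 0 < b := by
    rw [hb]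
    have h1 := gamma_neg hν₁ hν₂
    have h2 : (0:ℝ) < 2 ^ (ν+1) := by positivity
    have : A * (2 ^ (ν+1) * Real.Gamma (ν/2+1)) < 0 := mul_neg_of_pos_of_neg hA (mul_neg_of_pos_of_neg h2 h1)
    exact mul_pos hκ0 (by linarith)
  set V : ℝ → ℝ → ℝ := fun x t => ((t + 1)/t) ^ (3/2:ℝ) * κ * Wn (fun t => m t - 2 * t) w x t with hVdef
  have hV : ∀ x > 0, Tendsto (fun t => Real.exp (-r t) * V x t) atTop (𝓝 (κ * c)) ∧
    ((fun t => r t + 3 * √π / √t + (b / (κ * c)) * t ^ (1 + ν/2)) =o[atTop] (fun t : ℝ => t ^ (1 + ν/2)) ↔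
      (fun t => Real.exp (-r t) * V x t - κ * c) =o[atTop] fun t : ℝ => t ^ (1 + ν/2)) := by
    intro x hx
    have h1 := V_exp (κ := κ) (by linarith) (by linarith) (hexp x hx)
    rw [← hb] at h1
    exact final_equiv (by positivity) (by linarith) (by linarith) hrlim h1
  have hsol : ∀ x > 0, ∀ᶠ t in atTop, fkppSol P B h₀ m (m t + x) t = x * Real.exp (-x) * (Real.exp (-r t) * V x t) := by
    intro x hx
    filter_upwards [eventually_gt_atTop 0] with t ht
    rw [hlink x t ht.le]
    simp only [hVdef, Wn]
    have ht1 : 0 < t + 1 := by linarith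
    have e1 : Real.exp (-(x + (m t - 2 * t))) = Real.exp (-x) * Real.exp (-a) * Real.exp (-r t) * (t+1) ^ (3/2:ℝ) := by
      rw [Real.rpow_def_of_pos ht1, ← Real.exp_add, ← Real.exp_add, ← Real.exp_add, hm_eq t]
      congr 1; ring
    have h3 := Real.rpow_pos_of_pos ht (3/2)
    rw [e1, Real.div_rpow ht1.le ht.le, hκ]
    field_simp
  refine ⟨hb0, κ * c, by positivity, ?_, ?_⟩
  · intro x hx
    rcases hx.eq_or_lt with h | h
    · subst h
      rw [zero_mul, mul_zero]
      refine tendsto_const_nhds.congr' ?_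
      filter_upwards [eventually_ge_atTop 0] with t ht
      rw [hlink 0 t ht, hzero t ht]; simp
    · have h1 := (hV x h).1.const_mul (x * Real.exp (-x))
      rw [mul_comm (x * Real.exp (-x))] at h1
      refine h1.congr' ?_
      filter_upwards [hsol x h] with t ht using ht.symm
  · intro x hx
    rw [(hV x hx).2]
    have e1 : (fun t => fkppSol P B h₀ m (m t + x) t - κ * c * (x * Real.exp (-x))) =ᶠ[atTop]
        fun t => (x * Real.exp (-x)) * (Real.exp (-r t) * V x t - κ * c) := by
      filter_upwards [hsol x hx] with t ht
      rw [ht]; ring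
    have hne : x * Real.exp (-x) ≠ 0 := by positivity
    rw [isLittleO_congr e1 EventuallyEq.rfl, isLittleO_const_mul_left_iff hne]
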